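/- **Data-aware BPMN models.** A *data schema* has finitely many types: primitive types, one identifier type $\mathsf{id}_R$ for each relation $R$ of a finite read-only *catalog*, and a case identifier type. Each type has a domain with a distinguished object $\mathtt{undef}$; the domains of the identifier types and of the case identifier type are infinite. Finitely many objects are named by constants, none of the case identifier type, and all objects other than $\mathtt{undef}$ of a finite primitive type are named. A catalog relation $R$ has a primary key of type $\mathsf{id}_R$ and further attributes of primitive or identifier type; an attribute of type $\mathsf{id}_{R'}$ is a foreign key to $R'$. Repository relations have at least one attribute, of arbitrary types, and there are finitely many typed case variables together with a never-modified variable $\mathit{self}$ of case identifier type. A *catalog instance* consists of finite relations without $\mathtt{undef}$ that satisfy all primary and foreign keys and contain every identifier other than $\mathtt{undef}$ that is named by a constant. A *guard* is a union of conjunctive queries whose literals are equalities and disequalities, possibly negated catalog atoms, and (positive) repository atoms, over variables, constants, $\mathtt{undef}$, case variables and $\mathit{self}$. An *update specification* consists of a guard and one effect: insert a tuple and set case variables; set case variables; delete a tuple and set case variables; or a conditional update, which rewrites every tuple of one repository relation by nested if-then-else rules whose conditions do not query the repository. A *DAB* $M$ is a data schema with a root process block, built from start and end events and the blocks: empty,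 atomic task, nonatomic task (changing case variables only), catch event, subprocess, sequence, possible completion, deferred choice, parallel, exclusive choice, inclusive choice, loop, event-driven choice, backward exception, forward exception, and non-interrupting exception. Tasks and start, end and catch events carry update specifications, and choice points carry Boolean combinations of equalities over case variables. **Executions.** Fix $k\in\mathbb N$ and a catalog instance. A snapshot consists of a finite multiset of tuples for each repository relation, a case map (case identifier $\mapsto$ values of the case variables) and a control map (case identifier $\mapsto$ lifecycle state of each block, with the values chosen by nonatomic tasks in progress). A step either creates a new case (fresh identifier, case variables $\mathtt{undef}$, all blocks idle) if fewer than $k$ cases exist, or progresses one existing case by one lifecycle rule of one of its blocks; when an update specification is executed, a binding of its variables satisfying its guard is chosen, in which every value of identifier type is $\mathtt{undef}$ or occurs as primary key in the catalog instance, and every value of case identifier type is $\mathtt{undef}$ or an existing case. Inserting a tuple $u$ adds a new occurrence of $u$ (*multiset semantics*), or, given a set of key attributes for each repository relation, replaces the tuples that agree with $u$ on the key by $u$ (*set semantics*). **Properties.** A property $\upsilon=\bigwedge_{i=1}^n G_i[i]$ consists of guards $G_i$ that may also compare lifecycle states of blocks with each other and with constants, and in which every variable of a disjunct occurs in a repository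 atom of that disjunct. A snapshot satisfies $\upsilon$ if there are $n$ distinct existing cases and a binding of the variables such that $G_i$ holds for the $i$-th case, for all $i$. **BackReach.** For $k$ given, $M$ is translated into a relational artifact system. Its database signature has a unary function symbol $\mathsf{id}_R\to t$ for each non-key catalog attribute of $R$, of type $t$, and constants for $\mathtt{undef}$, the named objects, the lifecycle states and two flags. Its universal theory $T$ states that an attribute of $x$ is $\mathtt{undef}$ iff $x$ is, that constants are equal exactly if they name the same object, and that a finite primitive type contains only its named objects. It has $k$ copies of $\mathit{self}$, the case variables, the block lifecycle states and the values stored by nonatomic tasks; for each repository relation an artifact sort with one array per attribute and a flag array marking the entries that hold a tuple; for each $j<k$ a transition that creates the $j$-th case, and one transition for each lifecycle rule applied to the $j$-th case, the updates being case-defined functions. Initially everything is $\mathtt{undef}$, idle and unoccupied. The property $\upsilon$ becomes a state formula $\upsilon'$, i.e. $\exists\bar e\,\theta$ with $\theta$ quantifier-free and $\bar e$ of artifact sorts. BackReach runs backward reachability: start with $\phi:=\upsilon'$ and $B:=\bot$; if $\phi\wedge\neg B$ is $T$-unsatisfiable, answer 'no'; otherwise, if $\phi$ together with the initial formula is $T$-satisfiable,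 answer 'yes'; otherwise replace $B$ by $\phi\vee B$ and $\phi$ by a state formula equivalent to the preimage of $\phi$ under the transitions in all models of the model completion of $T$, and repeat. **Statement.** BackReach is sound and complete for detecting unsafety of case-bounded DABs, under either insertion semantics: for every DAB $M$, every bound $k$ on the number of cases, the multiset semantics or the set semantics with any keys, and every property $\upsilon$, whenever BackReach terminates on them, it answers 'yes' if and only if, for some catalog instance, some execution of $M$ with at most $k$ cases that starts with empty repository, empty case map and empty control map reaches a snapshot satisfying $\upsilon$. -/

import Mathlib

open scoped Classical

namespace DABV

noncomputable section

/-! ## Many-sorted first-order logic over unary functions and constants -/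

/-- A many-sorted signature whose only symbols are equality, unary functions and constants. -/
structure Sig where
  Srt : Type
  Fn : Srt → Srt → Type
  Cst : Srt → Type
  finSrt : Finite Srt
  finFn : ∀ s t, Finite (Fn s t)
  finCst : ∀ s, Finite (Cst s)

/-- Structures for a signature; every sort is interpreted by a nonempty set. -/
structure Str (S : Sig) where
  car : S.Srt → Type
  ne : ∀ s, Nonempty (car s)
  fn : ∀ {s t}, S.Fn s t → car s → car t
  cst : ∀ {s}, S.Cst s → car s

inductive Tm (S : Sig) : S.Srt → Type
  | var {s : S.Srt} (n : ℕ) : Tm S s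
  | cst {s : S.Srt} (c : S.Cst s) : Tm S s
  | app {s t : S.Srt} (f : S.Fn s t) (u : Tm S s) : Tm S t

/-- First-order formulae; every sort has the variables `0, 1, 2, …`. -/
inductive Fm (S : Sig) : Type
  | tt : Fm S
  | eq {s : S.Srt} (t u : Tm S s) : Fm S
  | neg (φ : Fm S) : Fm S
  | and (φ ψ : Fm S) : Fm S
  | all (s : S.Srt) (n : ℕ) (φ : Fm S) : Fm S

def Fm.QFree {S : Sig} : Fm S → Prop
  | .tt => True
  | .eq _ _ => True
  | .neg φ => φ.QFree
  | .and φ ψ => φ.QFree ∧ ψ.QFree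
  | .all _ _ _ => False

/-- Change the value of the variable `n` of sort `s`. -/
def upd {I : Type} {X : I → Type} (v : ∀ s, ℕ → X s) (s : I) (n : ℕ) (x : X s) : ∀ s, ℕ → X s :=
  Function.update v s (Function.update (v s) n x)

def Tm.eval {S : Sig} (M : Str S) (v : ∀ s, ℕ → M.car s) : {s : S.Srt} → Tm S s → M.car s
  | s, .var n => v s n
  | _, .cst c => M.cst c
  | _, .app f u => M.fn f (u.eval M v)

def Fm.eval {S : Sig} (M : Str S) : Fm S → (∀ s, ℕ → M.car s) → Prop
  | .tt, _ => True
  | .eq t u, v => t.eval M v = u.eval M v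
  | .neg φ, v => ¬ φ.eval M v
  | .and φ ψ, v => φ.eval M v ∧ ψ.eval M v
  | .all s n φ, v => ∀ x : M.car s, φ.eval M (upd v s n x)

def Fm.or {S : Sig} (φ ψ : Fm S) : Fm S := .neg (.and (.neg φ) (.neg ψ))

def Fm.iff {S : Sig} (φ ψ : Fm S) : Fm S := .or (.and φ ψ) (.and (.neg φ) (.neg ψ))

/-- Disjunction over a finite type. -/
def Fm.any {S : Sig} {ι : Type} [Finite ι] (f : ι → Fm S) : Fm S :=
  ((@Finset.univ ι (Fintype.ofFinite ι)).toList.map f).foldr .or (.neg .tt)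

/-- `M` is a model of `T`; free variables are read universally. -/
def Str.Models {S : Sig} (M : Str S) (T : Set (Fm S)) : Prop :=
  ∀ φ ∈ T, ∀ v, φ.eval M v

structure Str.Emb {S : Sig} (M N : Str S) where
  f : ∀ s, M.car s → N.car s
  inj : ∀ s, Function.Injective (f s)
  fn : ∀ {s t} (g : S.Fn s t) (x : M.car s), f t (M.fn g x) = N.fn g (f s x)
  cst : ∀ {s} (c : S.Cst s), f s (M.cst c) = N.cst c

/-- `Ts` is a model completion of the universal theory `T`: it extends `T`, every model of `T`
embeds into a model of `Ts`, and `Ts` eliminates quantifiers. -/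
structure IsModelCompletion {S : Sig} (T Ts : Set (Fm S)) : Prop where
  ext : ∀ M : Str S, M.Models Ts → M.Models T
  embeds : ∀ M : Str S, M.Models T → ∃ N : Str S, N.Models Ts ∧ Nonempty (M.Emb N)
  qe : ∀ φ : Fm S, ∃ ψ : Fm S, ψ.QFree ∧
    ∀ N : Str S, N.Models Ts → ∀ v, φ.eval N v ↔ ψ.eval N v

/-! ## Array-based relational artifact systems -/

/-- An artifact setting over a database signature: artifact sorts, artifact variables (of basic
sort) and artifact components (arrays, from an artifact sort to a basic sort). -/
structure Setting where
  Sg : Sig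
  ASrt : Type
  AVar : Sg.Srt → Type
  AComp : ASrt → Sg.Srt → Type
  finASrt : Finite ASrt
  finAVar : ∀ s, Finite (AVar s)
  finAComp : ∀ E s, Finite (AComp E s)

/-- Terms of basic sort, with `nv s` individual variables of each basic sort `s`. The individual
variables of each artifact sort are `0, 1, 2, …`. -/
inductive RTm (A : Setting) (nv : A.Sg.Srt → ℕ) : A.Sg.Srt → Type
  | var {s : A.Sg.Srt} (i : Fin (nv s)) : RTm A nv s
  | cst {s : A.Sg.Srt} (c : A.Sg.Cst s) : RTm A nv s
  | av {s : A.Sg.Srt} (x : A.AVar s) : RTm A nv s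
  | read {E : A.ASrt} {s : A.Sg.Srt} (a : A.AComp E s) (e : ℕ) : RTm A nv s
  | app {s t : A.Sg.Srt} (f : A.Sg.Fn s t) (u : RTm A nv s) : RTm A nv t

/-- Quantifier-free formulae; `ieq E m n` equates two variables of artifact sort `E`. -/
inductive QF (A : Setting) (nv : A.Sg.Srt → ℕ) : Type
  | tt : QF A nv
  | eq {s : A.Sg.Srt} (t u : RTm A nv s) : QF A nv
  | ieq (E : A.ASrt) (m n : ℕ) : QF A nv
  | neg (φ : QF A nv) : QF A nv
  | and (φ ψ : QF A nv) : QF A nv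

namespace QF

variable {A : Setting} {nv : A.Sg.Srt → ℕ}

def or (φ ψ : QF A nv) : QF A nv := .neg (.and (.neg φ) (.neg ψ))

def ne {s : A.Sg.Srt} (t u : RTm A nv s) : QF A nv := .neg (.eq t u)

def conj (l : List (QF A nv)) : QF A nv := l.foldr .and .tt

def disj (l : List (QF A nv)) : QF A nv := l.foldr .or (.neg .tt)

def all {ι : Type} [Finite ι] (f : ι → QF A nv) : QF A nv :=
  conj ((@Finset.univ ι (Fintype.ofFinite ι)).toList.map f)

def any {ι : Type} [Finite ι] (f : ι → QF A nv) : QF A nv :=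
  disj ((@Finset.univ ι (Fintype.ofFinite ι)).toList.map f)

end QF

/-- Case-defined functions, as nested if-then-else expressions. -/
inductive CTm (A : Setting) (nv : A.Sg.Srt → ℕ) (s : A.Sg.Srt) : Type
  | tm (t : RTm A nv s) : CTm A nv s
  | ite (κ : QF A nv) (t u : CTm A nv s) : CTm A nv s

/-- A transition formula `∃ e d, γ ∧ ⋀ x' = F ∧ ⋀ a' = λ y. G`. In `G`, for a component with
source `E`, the bound variable `y` is the variable `0` of the artifact sort `E`. -/
structure Transition (A : Setting) where
  nv : A.Sg.Srt → ℕ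
  guard : QF A nv
  uvar : ∀ {s}, A.AVar s → CTm A nv s
  ucomp : ∀ {E s}, A.AComp E s → CTm A nv s

/-- State formulae `∃ e φ` with `φ` quantifier-free and `e` of artifact sorts: no variable of
basic sort occurs. -/
abbrev StateFm (A : Setting) := QF A (fun _ => 0)

structure RAS where
  A : Setting
  T : Set (Fm A.Sg)
  universal : ∀ φ ∈ T, φ.QFree
  ivar : ∀ {s}, A.AVar s → A.Sg.Cst s
  icomp : ∀ {E s}, A.AComp E s → A.Sg.Cst s
  trans : List (Transition A)

/-- An assignment to the artifact setting over a structure `M` for the database signature, with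
artifact sorts interpreted by `idx`. -/
structure Asg (A : Setting) (M : Str A.Sg) (idx : A.ASrt → Type) where
  av : ∀ {s}, A.AVar s → M.car s
  ac : ∀ {E s}, A.AComp E s → idx E → M.car s

section Semantics

variable {A : Setting} {nv : A.Sg.Srt → ℕ} {M : Str A.Sg} {idx : A.ASrt → Type}

def RTm.eval (α : Asg A M idx) (ρ : ∀ s, Fin (nv s) → M.car s) (η : ∀ E, ℕ → idx E) :
    {s : A.Sg.Srt} → RTm A nv s → M.car s
  | s, .var i => ρ s i
  | _, .cst c => M.cst c
  | _, .av x => α.av x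
  | _, .read (E := E) a e => α.ac a (η E e)
  | _, .app f u => M.fn f (u.eval α ρ η)

def QF.eval (α : Asg A M idx) (ρ : ∀ s, Fin (nv s) → M.car s) (η : ∀ E, ℕ → idx E) :
    QF A nv → Prop
  | .tt => True
  | .eq t u => t.eval α ρ η = u.eval α ρ η
  | .ieq E m n => η E m = η E n
  | .neg φ => ¬ φ.eval α ρ η
  | .and φ ψ => φ.eval α ρ η ∧ ψ.eval α ρ η

def CTm.eval (α : Asg A M idx) (ρ : ∀ s, Fin (nv s) → M.car s) (η : ∀ E, ℕ → idx E)
    {s : A.Sg.Srt} : CTm A nv s → M.car s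
  | .tm t => t.eval α ρ η
  | .ite κ t u => if κ.eval α ρ η then t.eval α ρ η else u.eval α ρ η

def Transition.Fires (τ : Transition A) (α α' : Asg A M idx) : Prop :=
  ∃ (ρ : ∀ s, Fin (τ.nv s) → M.car s) (η : ∀ E, ℕ → idx E),
    τ.guard.eval α ρ η ∧
    (∀ s (x : A.AVar s), α'.av x = (τ.uvar x).eval α ρ η) ∧
    (∀ E s (a : A.AComp E s) (j : idx E), α'.ac a j = (τ.ucomp a).eval α ρ (upd η E 0 j))

def StateFm.Holds (α : Asg A M idx) (φ : StateFm A) : Prop :=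
  ∃ η : ∀ E, ℕ → idx E, QF.eval α (fun _ i => i.elim0) η φ

end Semantics

namespace RAS

variable (S : RAS)

def Initial {M : Str S.A.Sg} {idx : S.A.ASrt → Type} (α : Asg S.A M idx) : Prop :=
  (∀ s (x : S.A.AVar s), α.av x = M.cst (S.ivar x)) ∧
  (∀ E s (a : S.A.AComp E s) (j : idx E), α.ac a j = M.cst (S.icomp a))

def Step {M : Str S.A.Sg} {idx : S.A.ASrt → Type} (α α' : Asg S.A M idx) : Prop :=
  ∃ τ ∈ S.trans, τ.Fires α α'

/-- The states described by the preimage formula `Pre(τ, φ) = ∃ x' a', τ ∧ φ(x', a')`. -/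
def Pre (φ : StateFm S.A) {M : Str S.A.Sg} {idx : S.A.ASrt → Type} (α : Asg S.A M idx) : Prop :=
  ∃ α' : Asg S.A M idx, S.Step α α' ∧ StateFm.Holds α' φ

/-- `T`-satisfiability of a formula with free artifact variables and components, given by its
truth in every assignment over every structure. -/
def TSat (P : ∀ (M : Str S.A.Sg) (idx : S.A.ASrt → Type), Asg S.A M idx → Prop) : Prop :=
  ∃ (M : Str S.A.Sg) (idx : S.A.ASrt → Type) (α : Asg S.A M idx),
    M.Models S.T ∧ (∀ E, Nonempty (idx E)) ∧ P M idx α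

/-- `ψ` is a result of `QE(T*, Pre(τ, φ))`: a state formula equivalent to the preimage of `φ` in
all models of the model completion `T*` of `T`. -/
def IsQEPre (φ ψ : StateFm S.A) : Prop :=
  ∃ Ts : Set (Fm S.A.Sg), IsModelCompletion S.T Ts ∧
    ∀ (M : Str S.A.Sg) (idx : S.A.ASrt → Type) (α : Asg S.A M idx),
      M.Models Ts → (∀ E, Nonempty (idx E)) → (StateFm.Holds α ψ ↔ S.Pre φ α)

/-- Backward reachability. `S.BReach φ B b`: the loop entered with current formula `φ` and
already visited formulae `B` (a disjunction) terminates; `b = true` means that it returns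
`unsafe`, `b = false` that it returns `safe`. -/
inductive BReach : StateFm S.A → List (StateFm S.A) → Bool → Prop
  | answerNo {φ : StateFm S.A} {B : List (StateFm S.A)}
      (fix : ¬ S.TSat fun _ _ α => StateFm.Holds α φ ∧ ¬ ∃ ψ ∈ B, StateFm.Holds α ψ) :
      BReach φ B false
  | answerYes {φ : StateFm S.A} {B : List (StateFm S.A)}
      (nofix : S.TSat fun _ _ α => StateFm.Holds α φ ∧ ¬ ∃ ψ ∈ B, StateFm.Holds α ψ)
      (hit : S.TSat fun _ _ α => S.Initial α ∧ StateFm.Holds α φ) :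
      BReach φ B true
  | loop {φ φ' : StateFm S.A} {B : List (StateFm S.A)} {b : Bool}
      (nofix : S.TSat fun _ _ α => StateFm.Holds α φ ∧ ¬ ∃ ψ ∈ B, StateFm.Holds α ψ)
      (nohit : ¬ S.TSat fun _ _ α => S.Initial α ∧ StateFm.Holds α φ)
      (qe : S.IsQEPre φ φ')
      (rest : BReach φ' (φ :: B) b) :
      BReach φ B b

end RAS

/-! ## Data schemas, queries and updates -/

/-- The types used by a data schema: primitive types, one identifier type for each catalog
relation `R` (the type of its primary key), and the case identifier type. So primary keys of
distinct catalog relations have distinct types, an attribute of type `id R` is a foreign key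
to `R`, and the case identifier type differs from all identifier types of the catalog. -/
inductive Ty (V C : Type) : Type
  | val (v : V) : Ty V C
  | id (R : C) : Ty V C
  | case : Ty V C

theorem finite_ty (V C : Type) [Finite V] [Finite C] : Finite (Ty V C) := by
  refine Finite.of_surjective
    (fun x : V ⊕ C ⊕ Unit => match x with
      | .inl v => Ty.val v
      | .inr (.inl R) => Ty.id R
      | .inr (.inr _) => Ty.case) ?_
  rintro (v | R | _)
  · exact ⟨.inl v, rfl⟩
  · exact ⟨.inr (.inl R), rfl⟩
  · exact ⟨.inr (.inr ()), rfl⟩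

structure DataSchema where
  /-- primitive types -/
  Val : Type
  /-- catalog relations -/
  Cat : Type
  /-- repository relations -/
  Repo : Type
  /-- the non-key attributes of a catalog relation, by type -/
  CatAttr : Cat → Ty Val Cat → Type
  /-- the attributes of a repository relation, by type -/
  RepoAttr : Repo → Ty Val Cat → Type
  /-- the case variables other than `self`, by type -/
  CVar : Ty Val Cat → Type
  Dom : Ty Val Cat → Type
  undef : ∀ t, Dom t
  /-- names for the finitely many constant objects that may be mentioned -/
  Const : Ty Val Cat → Type
  constVal : ∀ {t}, Const t → Dom t
  finVal : Finite Val
  finCat : Finite Cat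
  finRepo : Finite Repo
  finCatAttr : ∀ R t, Finite (CatAttr R t)
  finRepoAttr : ∀ R t, Finite (RepoAttr R t)
  finCVar : ∀ t, Finite (CVar t)
  finConst : ∀ t, Finite (Const t)
  /-- catalog relations do not refer to cases -/
  catAttr_case : ∀ R, IsEmpty (CatAttr R .case)
  repoAttr_nonempty : ∀ R, ∃ t, Nonempty (RepoAttr R t)
  /-- case identifiers are only created at run time -/
  const_case : IsEmpty (Const .case)
  id_infinite : ∀ R, Infinite (Dom (.id R))
  case_infinite : Infinite (Dom .case)
  /-- the objects of a finite primitive type can all be mentioned -/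
  val_enum : ∀ v, Finite (Dom (.val v)) →
    ∀ d : Dom (.val v), d = undef (.val v) ∨ ∃ c : Const (.val v), constVal c = d

attribute [instance] DataSchema.finVal DataSchema.finCat DataSchema.finRepo
  DataSchema.finCatAttr DataSchema.finRepoAttr DataSchema.finCVar DataSchema.finConst

abbrev DataSchema.Typ (D : DataSchema) : Type := Ty D.Val D.Cat

instance (D : DataSchema) : Finite D.Typ := finite_ty _ _

/-- Terms with variables from `V`: variables, constants, `undef`, case variables, `self`. -/
inductive Term (D : DataSchema) (V : D.Typ → Type) : D.Typ → Type
  | var {t : D.Typ} (x : V t) : Term D V t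
  | const {t : D.Typ} (c : D.Const t) : Term D V t
  | undef {t : D.Typ} : Term D V t
  | cv {t : D.Typ} (x : D.CVar t) : Term D V t
  | self : Term D V .case

/-- Conditions at choice points, over the case variables. -/
inductive Cond (D : DataSchema) : Type
  | eq {t : D.Typ} (x y : Term D (fun _ => Empty) t) : Cond D
  | neg (φ : Cond D) : Cond D
  | and (φ ψ : Cond D) : Cond D

/-- Literals that do not query the repository. In `cat R k f`, the term `k` stands for the primary
key and `f` for the other attributes. -/
inductive FLit (D : DataSchema) (V : D.Typ → Type) : Type
  | eq {t : D.Typ} (x y : Term D V t) : FLit D V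
  | ne {t : D.Typ} (x y : Term D V t) : FLit D V
  | cat (R : D.Cat) (k : Term D V (.id R)) (f : ∀ t, D.CatAttr R t → Term D V t) : FLit D V
  | ncat (R : D.Cat) (k : Term D V (.id R)) (f : ∀ t, D.CatAttr R t → Term D V t) : FLit D V

/-- Literals of conjunctive queries with filters. -/
inductive Lit (D : DataSchema) (V : D.Typ → Type) : Type
  | filt (l : FLit D V) : Lit D V
  | repo (R : D.Repo) (f : ∀ t, D.RepoAttr R t → Term D V t) : Lit D V

/-- The body of a guard: a disjunction of conjunctions of literals. -/
abbrev Guard (D : DataSchema) (V : D.Typ → Type) := List (List (Lit D V))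

/-- The right-hand side of a conditional update of `R`. The extra variables in
`D.RepoAttr R t` denote the components of the tuple that is being updated. -/
inductive CondUpd (D : DataSchema) (V : D.Typ → Type) (R : D.Repo) : Type
  | tuple (f : ∀ t, D.RepoAttr R t → Term D (fun t => V t ⊕ D.RepoAttr R t) t) : CondUpd D V R
  | ite (ψ : List (List (FLit D (fun t => V t ⊕ D.RepoAttr R t)))) (η₁ η₂ : CondUpd D V R) :
      CondUpd D V R

/-- `SET` parts: a simultaneous assignment to some of the case variables other than `self`. -/
abbrev SetPart (D : DataSchema) (V : D.Typ → Type) := ∀ t, D.CVar t → Option (Term D V t)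

inductive Effect (D : DataSchema) (V : D.Typ → Type) : Type
  | insertSet (R : D.Repo) (f : ∀ t, D.RepoAttr R t → Term D V t) (σ : SetPart D V) : Effect D V
  | set (σ : SetPart D V) : Effect D V
  | deleteSet (R : D.Repo) (f : ∀ t, D.RepoAttr R t → Term D V t) (σ : SetPart D V) : Effect D V
  | update (R : D.Repo) (η : CondUpd D V R) : Effect D V

/-- Update specifications, with `nv t` variables of type `t`. The answer variables of the
precondition are those which the effect mentions. -/
structure UpdSpec (D : DataSchema) where
  nv : D.Typ → ℕ
  pre : Guard D (fun t => Fin (nv t))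
  eff : Effect D (fun t => Fin (nv t))

/-- Update specifications of nonatomic tasks: they only change case variables. -/
structure SetSpec (D : DataSchema) where
  nv : D.Typ → ℕ
  pre : Guard D (fun t => Fin (nv t))
  set : SetPart D (fun t => Fin (nv t))

/-- The two insertion semantics. For the set semantics, `K R` is the declared key of `R`;
the default is the set of all attributes. -/
inductive InsertSem (D : DataSchema) : Type
  | multiset : InsertSem D
  | set (K : ∀ (R : D.Repo) (t : D.Typ), Set (D.RepoAttr R t)) : InsertSem D

/-! ## Process blocks -/

inductive Life : Type
  | idle | enabled | active | waiting1 | waiting2 | compl | error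

theorem finite_life : Finite Life := by
  refine Finite.of_surjective
    (fun i : Fin 7 => ([.idle, .enabled, .active, .waiting1, .waiting2, .compl, .error] :
      List Life).get i) ?_
  rintro (_ | _ | _ | _ | _ | _ | _)
  exacts [⟨0, rfl⟩, ⟨1, rfl⟩, ⟨2, rfl⟩, ⟨3, rfl⟩, ⟨4, rfl⟩, ⟨5, rfl⟩, ⟨6, rfl⟩]

instance : Finite Life := finite_life

/-- Types of catch and start events. -/
inductive CatchType : Type
  | msg | timer | plain

/-- Types of end events of process blocks. -/
inductive EndType : Type
  | msg | plain

/-- Types of end events of possible completion blocks; errors carry a label. -/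
inductive ComplType : Type
  | error (ℓ : ℕ) | msg | plain

/-- Types of interrupting boundary events; errors carry a label. -/
inductive BoundaryType : Type
  | error (ℓ : ℕ) | msg | timer

/-- Types of non-interrupting boundary events. -/
inductive NonIntType : Type
  | msg | timer

/-- The start and end event of a process block, with their update specifications. -/
structure ProcHead (D : DataSchema) where
  startType : CatchType
  start : UpdSpec D
  endType : EndType
  finish : UpdSpec D

/-- Blocks. In `subproc`, the inner process block has the given start and end events and body `B`;
in the exception blocks, the subprocess `A` is given by the head and the body of its inner
process block. -/
inductive Block (D : DataSchema) : Type
  | empty : Block D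
  | atomicTask (α : UpdSpec D) : Block D
  | nonatomicTask (β : SetSpec D) : Block D
  | catchEvent (e : CatchType) (α : UpdSpec D) : Block D
  | subproc (h : ProcHead D) (B : Block D) : Block D
  | seq (B₁ B₂ : Block D) : Block D
  | possCompl (φ₁ φ₂ : Cond D) (e : ComplType) : Block D
  | deferredChoice (B₁ B₂ : Block D) : Block D
  | parallel (B₁ B₂ : Block D) : Block D
  | exclChoice (φ₁ φ₂ : Cond D) (B₁ B₂ : Block D) : Block D
  | inclChoice (φ₁ φ₂ : Cond D) (B₁ B₂ : Block D) : Block D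
  | loop (φ₁ φ₂ : Cond D) (B₁ B₂ : Block D) : Block D
  | eventChoice (e₁ e₂ : CatchType) (α₁ α₂ : UpdSpec D) (B₁ B₂ : Block D) : Block D
  | backExc (e : BoundaryType) (h : ProcHead D) (A B : Block D) : Block D
  | fwdExc (e : BoundaryType) (h : ProcHead D) (A B₁ B₂ : Block D) : Block D
  | nonIntExc (e : NonIntType) (h : ProcHead D) (A B₁ B₂ : Block D) : Block D

/-- A block and all its descendants. In the `Fin` components, `0` is the block itself; for
`subproc`, `1` is the inner process block; for `eventChoice`, `1` and `2` are the two catch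
events; for the exception blocks, `1` is the subprocess and `2` its inner process block. -/
def Block.Node {D : DataSchema} : Block D → Type
  | .empty => Fin 1
  | .atomicTask _ => Fin 1
  | .nonatomicTask _ => Fin 1
  | .catchEvent _ _ => Fin 1
  | .possCompl _ _ _ => Fin 1
  | .subproc _ B => Fin 2 ⊕ B.Node
  | .seq B₁ B₂ => Fin 1 ⊕ B₁.Node ⊕ B₂.Node
  | .deferredChoice B₁ B₂ => Fin 1 ⊕ B₁.Node ⊕ B₂.Node
  | .parallel B₁ B₂ => Fin 1 ⊕ B₁.Node ⊕ B₂.Node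
  | .exclChoice _ _ B₁ B₂ => Fin 1 ⊕ B₁.Node ⊕ B₂.Node
  | .inclChoice _ _ B₁ B₂ => Fin 1 ⊕ B₁.Node ⊕ B₂.Node
  | .loop _ _ B₁ B₂ => Fin 1 ⊕ B₁.Node ⊕ B₂.Node
  | .eventChoice _ _ _ _ B₁ B₂ => Fin 3 ⊕ B₁.Node ⊕ B₂.Node
  | .backExc _ _ A B => Fin 3 ⊕ A.Node ⊕ B.Node
  | .fwdExc _ _ A B₁ B₂ => Fin 3 ⊕ A.Node ⊕ B₁.Node ⊕ B₂.Node
  | .nonIntExc _ _ A B₁ B₂ => Fin 3 ⊕ A.Node ⊕ B₁.Node ⊕ B₂.Node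

/-- The node of the block itself. -/
def Block.top {D : DataSchema} : (B : Block D) → B.Node
  | .empty => (0 : Fin 1)
  | .atomicTask _ => (0 : Fin 1)
  | .nonatomicTask _ => (0 : Fin 1)
  | .catchEvent _ _ => (0 : Fin 1)
  | .possCompl _ _ _ => (0 : Fin 1)
  | .subproc _ _ => .inl 0
  | .seq _ _ => .inl 0
  | .deferredChoice _ _ => .inl 0
  | .parallel _ _ => .inl 0
  | .exclChoice _ _ _ _ => .inl 0
  | .inclChoice _ _ _ _ => .inl 0
  | .loop _ _ _ _ => .inl 0
  | .eventChoice _ _ _ _ _ _ => .inl 0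
  | .backExc _ _ _ _ => .inl 0
  | .fwdExc _ _ _ _ _ => .inl 0
  | .nonIntExc _ _ _ _ _ => .inl 0

theorem finite_node {D : DataSchema} (B : Block D) : Finite B.Node := by
  induction B <;> simp only [Block.Node] <;> infer_instance

instance {D : DataSchema} (B : Block D) : Finite B.Node := finite_node B

/-- The data part of a progression rule: nothing; apply an update specification; bind the answer
variables of a nonatomic task `n`; apply the effect of a nonatomic task `n` under the stored
binding. -/
inductive Act (D : DataSchema) (N : Type) : Type
  | skip : Act D N
  | spec (α : UpdSpec D) : Act D N
  | bind (n : N) (β : SetSpec D) : Act D N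
  | commit (n : N) (β : SetSpec D) : Act D N

/-- Progression rules over the blocks `N`: required lifecycle states, required conditions, data
part, new lifecycle states, and the set of blocks that are brought back to `idle`. -/
structure Rule (D : DataSchema) (N : Type) where
  pre : List (N × Life)
  cond : List (Cond D)
  act : Act D N
  post : List (N × Life)
  reset : Set N

/-- The lifecycle state that a rule assigns to a block, if any. -/
def Rule.next {D : DataSchema} {N : Type} (r : Rule D N) (n : N) : Option Life :=
  match r.post.find? (fun q => decide (q.1 = n)) with
  | some q => some q.2
  | none => if n ∈ r.reset then some .idle else none

/-- The surroundings of a block: the innermost enclosing subprocess with a handler for a given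
error label, and the innermost enclosing process block, each with its descendants. -/
structure Ctx (N : Type) where
  err : ℕ → Option (N × Set N)
  proc : N × Set N

section Rules

variable {D : DataSchema} {N : Type}

/-- A rule that depends on and changes the control state only. -/
def ctl (pre post : List (N × Life)) : Rule D N := ⟨pre, [], .skip, post, ∅⟩

/-- As `ctl`, guarded by conditions. -/
def cctl (pre : List (N × Life)) (c : List (Cond D)) (post : List (N × Life)) : Rule D N :=
  ⟨pre, c, .skip, post, ∅⟩

/-- Process block `p` with body `b`. -/
def procRules (h : ProcHead D) (p b : N) : List (Rule D N) :=
  [⟨[(p, .enabled)], [], .spec h.start, [(b, .enabled), (p, .active)], ∅⟩,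
   ⟨[(b, .compl)], [], .spec h.finish, [(b, .idle), (p, .compl)], ∅⟩]

/-- Subprocess `a` with inner process block `p`, whose body is `b`. -/
def subRules (h : ProcHead D) (a p b : N) : List (Rule D N) :=
  [ctl [(a, .enabled)] [(p, .enabled), (a, .active)],
   ctl [(p, .compl)] [(p, .idle), (a, .compl)]] ++ procRules h p b

/-- Message and timer boundary events may interrupt the subprocess `a`, with descendants `H`, at
any time. Error boundary events are triggered by error end events inside of `a` only. -/
def interruptRules (e : BoundaryType) (a : N) (H : Set N) : List (Rule D N) :=
  match e with
  | .error _ => []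
  | _ => [⟨[(a, .enabled)], [], .skip, [(a, .error)], H⟩,
          ⟨[(a, .active)], [], .skip, [(a, .error)], H⟩]

/-- The surroundings inside of a process block `p` with proper descendants `H`. -/
def Ctx.inProc (c : Ctx N) (p : N) (H : Set N) : Ctx N := ⟨c.err, (p, H)⟩

/-- The surroundings inside of a subprocess `a` with boundary event `e`, inner process block `p` and
descendants `H` of `p`. -/
def Ctx.inSub (c : Ctx N) (e : BoundaryType) (a p : N) (H : Set N) : Ctx N :=
  ⟨fun ℓ => if e = .error ℓ then some (a, insert p H) else c.err ℓ, (p, H)⟩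

/-- The end event of a possible completion block: an error moves the subprocess which handles it
to `error`; otherwise the enclosing process block completes. -/
def complRules (c : Ctx N) (n : N) (φ : Cond D) : ComplType → List (Rule D N)
  | .error ℓ =>
    match c.err ℓ with
    | some q => [⟨[(n, .enabled)], [φ], .skip, [(q.1, .error)], q.2⟩]
    | none => []
  | _ => [⟨[(n, .enabled)], [φ], .skip, [(c.proc.1, .compl)], c.proc.2⟩]

end Rules

/-- The progression rules of a block and of its descendants, where `i` places them among all
blocks `N` of the process. -/
def Block.rules {D : DataSchema} {N : Type} :
    (B : Block D) → (B.Node → N) → Ctx N → List (Rule D N)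
  | .empty, i, _ =>
    let n := i (Block.top .empty)
    [ctl [(n, .enabled)] [(n, .compl)]]
  | .atomicTask α, i, _ =>
    let n := i (Block.top (.atomicTask α))
    [⟨[(n, .enabled)], [], .spec α, [(n, .compl)], ∅⟩]
  | .nonatomicTask β, i, _ =>
    let n := i (Block.top (.nonatomicTask β))
    [⟨[(n, .enabled)], [], .bind n β, [(n, .active)], ∅⟩,
     ⟨[(n, .active)], [], .commit n β, [(n, .compl)], ∅⟩]
  | .catchEvent e α, i, _ =>
    let n := i (Block.top (.catchEvent e α))
    [⟨[(n, .enabled)], [], .spec α, [(n, .compl)], ∅⟩]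
  | .possCompl φ₁ φ₂ e, i, c =>
    let n := i (Block.top (.possCompl φ₁ φ₂ e))
    cctl [(n, .enabled)] [φ₁] [(n, .compl)] :: complRules c n φ₂ e
  | .subproc h B, i, c =>
    let a := i (.inl 0)
    let p := i (.inl 1)
    let j : B.Node → N := fun m => i (.inr m)
    subRules h a p (j B.top) ++ B.rules j (c.inProc p (Set.range j))
  | .seq B₁ B₂, i, c =>
    let n := i (.inl 0)
    let j₁ : B₁.Node → N := fun m => i (.inr (.inl m))
    let j₂ : B₂.Node → N := fun m => i (.inr (.inr m))
    let b₁ := j₁ B₁.top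
    let b₂ := j₂ B₂.top
    [ctl [(n, .enabled)] [(b₁, .enabled), (n, .active)],
     ctl [(b₁, .compl)] [(b₁, .idle), (b₂, .enabled)],
     ctl [(b₂, .compl)] [(b₂, .idle), (n, .compl)]]
    ++ B₁.rules j₁ c ++ B₂.rules j₂ c
  | .deferredChoice B₁ B₂, i, c =>
    let n := i (.inl 0)
    let j₁ : B₁.Node → N := fun m => i (.inr (.inl m))
    let j₂ : B₂.Node → N := fun m => i (.inr (.inr m))
    let b₁ := j₁ B₁.top
    let b₂ := j₂ B₂.top
    [ctl [(n, .enabled)] [(b₁, .enabled), (n, .active)],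
     ctl [(n, .enabled)] [(b₂, .enabled), (n, .active)],
     ctl [(b₁, .compl)] [(b₁, .idle), (n, .compl)],
     ctl [(b₂, .compl)] [(b₂, .idle), (n, .compl)]]
    ++ B₁.rules j₁ c ++ B₂.rules j₂ c
  | .parallel B₁ B₂, i, c =>
    let n := i (.inl 0)
    let j₁ : B₁.Node → N := fun m => i (.inr (.inl m))
    let j₂ : B₂.Node → N := fun m => i (.inr (.inr m))
    let b₁ := j₁ B₁.top
    let b₂ := j₂ B₂.top
    [ctl [(n, .enabled)] [(b₁, .enabled), (b₂, .enabled), (n, .active)],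
     ctl [(b₁, .compl), (b₂, .compl)] [(b₁, .idle), (b₂, .idle), (n, .compl)]]
    ++ B₁.rules j₁ c ++ B₂.rules j₂ c
  | .exclChoice φ₁ φ₂ B₁ B₂, i, c =>
    let n := i (.inl 0)
    let j₁ : B₁.Node → N := fun m => i (.inr (.inl m))
    let j₂ : B₂.Node → N := fun m => i (.inr (.inr m))
    let b₁ := j₁ B₁.top
    let b₂ := j₂ B₂.top
    [cctl [(n, .enabled)] [φ₁] [(b₁, .enabled), (n, .active)],
     cctl [(n, .enabled)] [φ₂] [(b₂, .enabled), (n, .active)],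
     ctl [(b₁, .compl)] [(b₁, .idle), (n, .compl)],
     ctl [(b₂, .compl)] [(b₂, .idle), (n, .compl)]]
    ++ B₁.rules j₁ c ++ B₂.rules j₂ c
  | .inclChoice φ₁ φ₂ B₁ B₂, i, c =>
    let n := i (.inl 0)
    let j₁ : B₁.Node → N := fun m => i (.inr (.inl m))
    let j₂ : B₂.Node → N := fun m => i (.inr (.inr m))
    let b₁ := j₁ B₁.top
    let b₂ := j₂ B₂.top
    [cctl [(n, .enabled)] [φ₁, .neg φ₂] [(b₁, .enabled), (n, .waiting1)],
     cctl [(n, .enabled)] [φ₂, .neg φ₁] [(b₂, .enabled), (n, .waiting1)],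
     cctl [(n, .enabled)] [φ₁, φ₂] [(b₁, .enabled), (b₂, .enabled), (n, .waiting2)],
     ctl [(n, .waiting1), (b₁, .compl)] [(b₁, .idle), (n, .compl)],
     ctl [(n, .waiting1), (b₂, .compl)] [(b₂, .idle), (n, .compl)],
     ctl [(n, .waiting2), (b₁, .compl), (b₂, .compl)] [(b₁, .idle), (b₂, .idle), (n, .compl)]]
    ++ B₁.rules j₁ c ++ B₂.rules j₂ c
  | .loop φ₁ φ₂ B₁ B₂, i, c =>
    let n := i (.inl 0)
    let j₁ : B₁.Node → N := fun m => i (.inr (.inl m))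
    let j₂ : B₂.Node → N := fun m => i (.inr (.inr m))
    let b₁ := j₁ B₁.top
    let b₂ := j₂ B₂.top
    [ctl [(n, .enabled)] [(b₁, .enabled), (n, .active)],
     cctl [(b₁, .compl)] [φ₁] [(b₁, .idle), (n, .compl)],
     cctl [(b₁, .compl)] [φ₂] [(b₁, .idle), (b₂, .enabled)],
     ctl [(b₂, .compl)] [(b₂, .idle), (b₁, .enabled)]]
    ++ B₁.rules j₁ c ++ B₂.rules j₂ c
  | .eventChoice _ _ α₁ α₂ B₁ B₂, i, c =>
    let n := i (.inl 0)
    let e₁ := i (.inl 1)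
    let e₂ := i (.inl 2)
    let j₁ : B₁.Node → N := fun m => i (.inr (.inl m))
    let j₂ : B₂.Node → N := fun m => i (.inr (.inr m))
    let b₁ := j₁ B₁.top
    let b₂ := j₂ B₂.top
    [ctl [(n, .enabled)] [(e₁, .enabled), (e₂, .enabled), (n, .active)],
     ⟨[(e₁, .enabled)], [], .spec α₁, [(e₁, .compl), (e₂, .idle)], ∅⟩,
     ⟨[(e₂, .enabled)], [], .spec α₂, [(e₂, .compl), (e₁, .idle)], ∅⟩,
     ctl [(e₁, .compl)] [(e₁, .idle), (b₁, .enabled)],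
     ctl [(e₂, .compl)] [(e₂, .idle), (b₂, .enabled)],
     ctl [(b₁, .compl)] [(b₁, .idle), (n, .compl)],
     ctl [(b₂, .compl)] [(b₂, .idle), (n, .compl)]]
    ++ B₁.rules j₁ c ++ B₂.rules j₂ c
  | .backExc e h A B, i, c =>
    let n := i (.inl 0)
    let a := i (.inl 1)
    let p := i (.inl 2)
    let jA : A.Node → N := fun m => i (.inr (.inl m))
    let j : B.Node → N := fun m => i (.inr (.inr m))
    let b := j B.top
    [ctl [(n, .enabled)] [(a, .enabled), (n, .active)],
     ctl [(a, .compl)] [(a, .idle), (n, .compl)],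
     ctl [(a, .error)] [(a, .idle), (b, .enabled)],
     ctl [(b, .compl)] [(b, .idle), (a, .enabled)]]
    ++ interruptRules e a (insert p (Set.range jA)) ++ subRules h a p (jA A.top)
    ++ A.rules jA (c.inSub e a p (Set.range jA)) ++ B.rules j c
  | .fwdExc e h A B₁ B₂, i, c =>
    let n := i (.inl 0)
    let a := i (.inl 1)
    let p := i (.inl 2)
    let jA : A.Node → N := fun m => i (.inr (.inl m))
    let j₁ : B₁.Node → N := fun m => i (.inr (.inr (.inl m)))
    let j₂ : B₂.Node → N := fun m => i (.inr (.inr (.inr m)))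
    let b₁ := j₁ B₁.top
    let b₂ := j₂ B₂.top
    [ctl [(n, .enabled)] [(a, .enabled), (n, .active)],
     ctl [(a, .compl)] [(a, .idle), (b₁, .enabled)],
     ctl [(b₁, .compl)] [(b₁, .idle), (n, .compl)],
     ctl [(a, .error)] [(a, .idle), (b₂, .enabled)],
     ctl [(b₂, .compl)] [(b₂, .idle), (n, .compl)]]
    ++ interruptRules e a (insert p (Set.range jA)) ++ subRules h a p (jA A.top)
    ++ A.rules jA (c.inSub e a p (Set.range jA)) ++ B₁.rules j₁ c ++ B₂.rules j₂ c
  | .nonIntExc _ h A B₁ B₂, i, c =>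
    -- `waiting2` records that the boundary event has occurred
    let n := i (.inl 0)
    let a := i (.inl 1)
    let p := i (.inl 2)
    let jA : A.Node → N := fun m => i (.inr (.inl m))
    let j₁ : B₁.Node → N := fun m => i (.inr (.inr (.inl m)))
    let j₂ : B₂.Node → N := fun m => i (.inr (.inr (.inr m)))
    let b₁ := j₁ B₁.top
    let b₂ := j₂ B₂.top
    [ctl [(n, .enabled)] [(a, .enabled), (n, .waiting1)],
     ctl [(n, .waiting1), (a, .enabled)] [(n, .waiting2), (b₂, .enabled)],
     ctl [(n, .waiting1), (a, .active)] [(n, .waiting2), (b₂, .enabled)],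
     ctl [(a, .compl)] [(a, .idle), (b₁, .enabled)],
     ctl [(n, .waiting1), (b₁, .compl)] [(b₁, .idle), (n, .compl)],
     ctl [(n, .waiting2), (b₁, .compl), (b₂, .compl)] [(b₁, .idle), (b₂, .idle), (n, .compl)]]
    ++ subRules h a p (jA A.top)
    ++ A.rules jA (c.inProc p (Set.range jA)) ++ B₁.rules j₁ c ++ B₂.rules j₂ c

/-- A data-aware BPMN model: a data schema and a root process block over it. -/
structure DAB where
  D : DataSchema
  head : ProcHead D
  body : Block D

/-- All blocks of the process; `none` is the root process block. -/
abbrev DAB.Node (M : DAB) : Type := Option M.body.Node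

/-- The progression rules of the process. The first one starts a newly created case. -/
def DAB.rules (M : DAB) : List (Rule M.D M.Node) :=
  ctl [(none, .idle)] [(none, .enabled)] :: procRules M.head none (some M.body.top)
    ++ M.body.rules some ⟨fun _ => none, (none, Set.range some)⟩

/-! ## Execution semantics -/

abbrev RTuple (D : DataSchema) (R : D.Repo) : Type := ∀ t, D.RepoAttr R t → D.Dom t

abbrev CTuple (D : DataSchema) (R : D.Cat) : Type := ∀ t, D.CatAttr R t → D.Dom t

abbrev VarVals (D : DataSchema) : Type := ∀ t, D.CVar t → D.Dom t

/-- Catalog instances: finite sets of fully defined tuples (primary key and other attributes)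
that satisfy the primary and foreign keys, and that contain the identifiers which are mentioned
as constants. -/
structure CatInst (D : DataSchema) where
  rel : ∀ R : D.Cat, Set (D.Dom (.id R) × CTuple D R)
  finite : ∀ R, (rel R).Finite
  key_ne : ∀ R, ∀ q ∈ rel R, q.1 ≠ D.undef (.id R)
  attr_ne : ∀ R, ∀ q ∈ rel R, ∀ t (a : D.CatAttr R t), q.2 t a ≠ D.undef t
  pk : ∀ R, ∀ q ∈ rel R, ∀ q' ∈ rel R, q.1 = q'.1 → q = q'
  fk : ∀ R, ∀ q ∈ rel R, ∀ R' (a : D.CatAttr R (.id R')), ∃ q' ∈ rel R', q'.1 = q.2 (.id R') a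
  const_mem : ∀ R (c : D.Const (.id R)), D.constVal c = D.undef (.id R) ∨
    ∃ q ∈ rel R, q.1 = D.constVal c

/-- What is stored for a case: the values of the case variables (`self` is the key of the entry),
the lifecycle states of the blocks, and, for active nonatomic tasks, the values that the chosen
binding is going to assign to the case variables. -/
structure Entry (M : DAB) where
  vars : VarVals M.D
  life : M.Node → Life
  pend : M.Node → VarVals M.D

/-- Snapshots over a fixed catalog instance. The implicit primary keys of the repository tuples
are not accessible, so a relation instance is a finite multiset of tuples. Case map and control
map have the same keys and are joined into one map. -/
structure Snapshot (M : DAB) where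
  repo : ∀ R : M.D.Repo, Multiset (RTuple M.D R)
  cases : M.D.Dom .case → Option (Entry M)

def Snapshot.empty (M : DAB) : Snapshot M := ⟨fun _ => 0, fun _ => none⟩

/-- The entry of a newly created case. -/
def Entry.fresh (M : DAB) : Entry M :=
  ⟨fun t _ => M.D.undef t, fun _ => .idle, fun _ t _ => M.D.undef t⟩

section Eval

variable {D : DataSchema} {V : D.Typ → Type}

/-- Value of a term under a variable binding `ρ`, for the case `c` with case variables `w`. -/
def Term.eval (ρ : ∀ t, V t → D.Dom t) (c : D.Dom .case) (w : VarVals D) :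
    {t : D.Typ} → Term D V t → D.Dom t
  | t, .var x => ρ t x
  | _, .const a => D.constVal a
  | t, .undef => D.undef t
  | t, .cv x => w t x
  | _, .self => c

def Cond.Holds (c : D.Dom .case) (w : VarVals D) : Cond D → Prop
  | .eq x y => x.eval (fun _ z => z.elim) c w = y.eval (fun _ z => z.elim) c w
  | .neg φ => ¬ φ.Holds c w
  | .and φ ψ => φ.Holds c w ∧ ψ.Holds c w

def FLit.Holds (I : CatInst D) (ρ : ∀ t, V t → D.Dom t) (c : D.Dom .case) (w : VarVals D) :
    FLit D V → Prop
  | .eq x y => x.eval ρ c w = y.eval ρ c w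
  | .ne x y => x.eval ρ c w ≠ y.eval ρ c w
  | .cat R k f => (k.eval ρ c w, fun t a => (f t a).eval ρ c w) ∈ I.rel R
  | .ncat R k f => (k.eval ρ c w, fun t a => (f t a).eval ρ c w) ∉ I.rel R

def Lit.Holds (I : CatInst D) (rp : ∀ R : D.Repo, Multiset (RTuple D R))
    (ρ : ∀ t, V t → D.Dom t) (c : D.Dom .case) (w : VarVals D) : Lit D V → Prop
  | .filt l => l.Holds I ρ c w
  | .repo R f => (fun t a => (f t a).eval ρ c w) ∈ rp R

def CondUpd.eval (I : CatInst D) (ρ : ∀ t, V t → D.Dom t) (c : D.Dom .case) (w : VarVals D)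
    {R : D.Repo} (u : RTuple D R) : CondUpd D V R → RTuple D R
  | .tuple f => fun t a => (f t a).eval (fun t => Sum.elim (ρ t) (u t)) c w
  | .ite ψ η₁ η₂ =>
    if ∃ Q ∈ ψ, ∀ l ∈ Q, FLit.Holds I (fun t => Sum.elim (ρ t) (u t)) c w l
    then η₁.eval I ρ c w u else η₂.eval I ρ c w u

/-- The case variables after a `SET` part. -/
def SetPart.apply (σ : SetPart D V) (ρ : ∀ t, V t → D.Dom t) (c : D.Dom .case) (w : VarVals D) :
    VarVals D :=
  fun t x => match σ t x with
    | some u => u.eval ρ c w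
    | none => w t x

/-- Insertion of `u`. In the set semantics, a tuple that agrees with `u` on the key is updated
to `u`, that is, replaced by `u`. -/
def InsertSem.insert (sem : InsertSem D) {R : D.Repo} (m : Multiset (RTuple D R))
    (u : RTuple D R) : Multiset (RTuple D R) :=
  match sem with
  | .multiset => u ::ₘ m
  | .set K => u ::ₘ m.filter (fun v => ¬ ∀ t, ∀ a ∈ K R t, v t a = u t a)

/-- `E.Apply … rp' w'`: the effect is executable and leads to repository `rp'` and case variables
`w'`. -/
def Effect.Apply (sem : InsertSem D) (I : CatInst D) (rp : ∀ R : D.Repo, Multiset (RTuple D R))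
    (ρ : ∀ t, V t → D.Dom t) (c : D.Dom .case) (w : VarVals D) (E : Effect D V)
    (rp' : ∀ R : D.Repo, Multiset (RTuple D R)) (w' : VarVals D) : Prop :=
  match E with
  | .insertSet R f σ =>
    rp' = Function.update rp R (sem.insert (rp R) (fun t a => (f t a).eval ρ c w)) ∧
    w' = σ.apply ρ c w
  | .set σ => rp' = rp ∧ w' = σ.apply ρ c w
  | .deleteSet R f σ =>
    (fun t a => (f t a).eval ρ c w) ∈ rp R ∧
    rp' = Function.update rp R ((rp R).erase (fun t a => (f t a).eval ρ c w)) ∧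
    w' = σ.apply ρ c w
  | .update R η => rp' = Function.update rp R ((rp R).map (fun u => η.eval I ρ c w u)) ∧ w' = w

end Eval

section Run

variable {M : DAB}

/-- Identifiers must be `undef` or satisfy the foreign keys: they refer to a tuple of the catalog
instance, or to a key of the case map. -/
def Snapshot.Valid (I : CatInst M.D) (s : Snapshot M) : (t : M.D.Typ) → M.D.Dom t → Prop
  | .val _, _ => True
  | .id R, x => x = M.D.undef (.id R) ∨ ∃ q ∈ I.rel R, q.1 = x
  | .case, x => x = M.D.undef .case ∨ s.cases x ≠ none

/-- `ρ` is an answer to the guard `G` for the case `c` with case variables `w`. -/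
def Snapshot.Answers (I : CatInst M.D) (s : Snapshot M) {V : M.D.Typ → Type}
    (ρ : ∀ t, V t → M.D.Dom t) (c : M.D.Dom .case) (w : VarVals M.D) (G : Guard M.D V) : Prop :=
  (∀ t x, s.Valid I t (ρ t x)) ∧ ∃ Q ∈ G, ∀ l ∈ Q, l.Holds I s.repo ρ c w

/-- Effect of the data part of a rule on the repository and on the entry `e` of the case `c`. -/
def Act.Apply (sem : InsertSem M.D) (I : CatInst M.D) (s : Snapshot M) (c : M.D.Dom .case)
    (e : Entry M) (a : Act M.D M.Node) (rp' : ∀ R : M.D.Repo, Multiset (RTuple M.D R))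
    (w' : VarVals M.D) (p' : M.Node → VarVals M.D) : Prop :=
  match a with
  | .skip => rp' = s.repo ∧ w' = e.vars ∧ p' = e.pend
  | .spec α => ∃ ρ, s.Answers I ρ c e.vars α.pre ∧
      α.eff.Apply sem I s.repo ρ c e.vars rp' w' ∧ p' = e.pend
  | .bind n β => ∃ ρ, s.Answers I ρ c e.vars β.pre ∧ rp' = s.repo ∧ w' = e.vars ∧
      p' = Function.update e.pend n (fun t x => match β.set t x with
        | some u => u.eval ρ c e.vars
        | none => e.pend n t x)
  | .commit n β => rp' = s.repo ∧ p' = e.pend ∧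
      w' = fun t x => if (β.set t x).isSome then e.pend n t x else e.vars t x

/-- One step of the execution of `M` over the catalog instance `I`, where at most `k` cases may
be introduced: creation of a new case, or progression of an existing case by one rule. -/
inductive Step (M : DAB) (k : ℕ) (sem : InsertSem M.D) (I : CatInst M.D) :
    Snapshot M → Snapshot M → Prop
  | newCase (s : Snapshot M) (c : M.D.Dom .case) (hc : c ≠ M.D.undef .case)
      (hfresh : s.cases c = none) (hk : {d | s.cases d ≠ none}.encard < k) :
      Step M k sem I s ⟨s.repo, Function.update s.cases c (some (Entry.fresh M))⟩
  | progress (s : Snapshot M) (c : M.D.Dom .case) (e : Entry M) (he : s.cases c = some e)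
      (r : Rule M.D M.Node) (hr : r ∈ M.rules)
      (hpre : ∀ q ∈ r.pre, e.life q.1 = q.2) (hcond : ∀ φ ∈ r.cond, φ.Holds c e.vars)
      (rp' : ∀ R : M.D.Repo, Multiset (RTuple M.D R)) (w' : VarVals M.D)
      (p' : M.Node → VarVals M.D) (hact : r.act.Apply sem I s c e rp' w' p') :
      Step M k sem I s ⟨rp', Function.update s.cases c
        (some ⟨w', fun n => (r.next n).getD (e.life n), p'⟩)⟩

/-- `s` is reached by some execution that starts with empty repository, case map and control
map. -/
def Reachable (M : DAB) (k : ℕ) (sem : InsertSem M.D) (I : CatInst M.D) (s : Snapshot M) : Prop :=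
  Relation.ReflTransGen (Step M k sem I) (Snapshot.empty M) s

end Run

/-! ## Properties -/

/-- Terms for lifecycle states: control variables of blocks, and constants. -/
inductive LTerm (M : DAB) : Type
  | block (n : M.Node) : LTerm M
  | const (l : Life) : LTerm M

/-- Literals of guards over the data schema and the case control variables. -/
inductive PLit (M : DAB) (V : M.D.Typ → Type) : Type
  | data (l : Lit M.D V) : PLit M V
  | leq (x y : LTerm M) : PLit M V
  | lne (x y : LTerm M) : PLit M V

/-- The variable `x` occurs in a repository atom. -/
def PLit.InRepo {M : DAB} {V : M.D.Typ → Type} {t : M.D.Typ} (x : V t) : PLit M V → Prop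
  | .data (.repo _ f) => ∃ a, f t a = .var x
  | _ => False

/-- The variable `x` of type `t` is the term `u`, of type `t'`. -/
def IsVar {D : DataSchema} {V : D.Typ → Type} {t t' : D.Typ} (x : V t) (u : Term D V t') : Prop :=
  (⟨t', u⟩ : Σ t, Term D V t) = ⟨t, .var x⟩

/-- The variable `x` occurs in the literal. -/
def PLit.Mentions {M : DAB} {V : M.D.Typ → Type} {t : M.D.Typ} (x : V t) : PLit M V → Prop
  | .data (.filt (.eq y z)) => IsVar x y ∨ IsVar x z
  | .data (.filt (.ne y z)) => IsVar x y ∨ IsVar x z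
  | .data (.filt (.cat _ k f)) => IsVar x k ∨ ∃ t' a, IsVar x (f t' a)
  | .data (.filt (.ncat _ k f)) => IsVar x k ∨ ∃ t' a, IsVar x (f t' a)
  | .data (.repo _ f) => ∃ t' a, IsVar x (f t' a)
  | .leq _ _ => False
  | .lne _ _ => False

/-- Properties `⋀ i, G i [i]` over `n` distinct cases. Every variable of a disjunct of a guard must
occur in a repository atom of this disjunct. -/
structure Property (M : DAB) where
  n : ℕ
  nv : M.D.Typ → ℕ
  G : Fin n → List (List (PLit M (fun t => Fin (nv t))))
  repoBound : ∀ i, ∀ Q ∈ G i, ∀ t (x : Fin (nv t)),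
    (∃ l ∈ Q, PLit.Mentions x l) → ∃ l ∈ Q, PLit.InRepo x l

def LTerm.eval {M : DAB} (life : M.Node → Life) : LTerm M → Life
  | .block n => life n
  | .const l => l

def PLit.Holds {M : DAB} (I : CatInst M.D) (s : Snapshot M) {V : M.D.Typ → Type}
    (ρ : ∀ t, V t → M.D.Dom t) (c : M.D.Dom .case) (e : Entry M) : PLit M V → Prop
  | .data l => l.Holds I s.repo ρ c e.vars
  | .leq x y => x.eval e.life = y.eval e.life
  | .lne x y => x.eval e.life ≠ y.eval e.life

/-- The snapshot satisfies the property; different indexes denote different cases. -/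
def Property.Holds {M : DAB} (υ : Property M) (I : CatInst M.D) (s : Snapshot M) : Prop :=
  ∃ (c : Fin υ.n → M.D.Dom .case) (e : Fin υ.n → Entry M) (ρ : ∀ t, Fin (υ.nv t) → M.D.Dom t),
    Function.Injective c ∧ (∀ i, s.cases (c i) = some (e i)) ∧
    ∀ i, ∃ Q ∈ υ.G i, ∀ l ∈ Q, l.Holds I s ρ (c i) (e i)

/-! ## Translation into an array-based system -/

/-- Basic sorts: the types of the data schema, the lifecycle states, and a sort with constants
`true` and `false` used to mark the entries of the arrays which hold a tuple. -/
inductive RSrt (D : DataSchema) : Type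
  | data (t : D.Typ) : RSrt D
  | life : RSrt D
  | flag : RSrt D

theorem finite_rsrt (D : DataSchema) : Finite (RSrt D) := by
  refine Finite.of_surjective
    (fun x : D.Typ ⊕ Bool => match x with
      | .inl t => RSrt.data t
      | .inr true => RSrt.life
      | .inr false => RSrt.flag) ?_
  rintro (t | _ | _)
  · exact ⟨.inl t, rfl⟩
  · exact ⟨.inr true, rfl⟩
  · exact ⟨.inr false, rfl⟩

/-- Function symbols: one for each non-key attribute of a catalog relation `R`, from the
identifier type of `R` to the type of the attribute. -/
def RFn (D : DataSchema) : RSrt D → RSrt D → Type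
  | .data (.id R), .data t => D.CatAttr R t
  | _, _ => Empty

/-- Constant symbols; `none` stands for `undef`. -/
def RCst (D : DataSchema) : RSrt D → Type
  | .data t => Option (D.Const t)
  | .life => Life
  | .flag => Bool

theorem finite_rfn (D : DataSchema) (s t : RSrt D) : Finite (RFn D s t) := by
  rcases s with ((_ | _ | _) | _ | _) <;> rcases t with (_ | _ | _) <;> simp only [RFn] <;>
    infer_instance

theorem finite_rcst (D : DataSchema) (s : RSrt D) : Finite (RCst D s) := by
  rcases s with (_ | _ | _) <;> simp only [RCst] <;> infer_instance

instance (D : DataSchema) (s : RSrt D) : Finite (RCst D s) := finite_rcst D s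

abbrev sig (D : DataSchema) : Sig where
  Srt := RSrt D
  Fn := RFn D
  Cst := RCst D
  finSrt := finite_rsrt D
  finFn := finite_rfn D
  finCst := finite_rcst D

/-- The objects denoted by the constants. -/
def RDen (D : DataSchema) : RSrt D → Type
  | .data t => D.Dom t
  | .life => Life
  | .flag => Bool

def RCst.den {D : DataSchema} : {s : RSrt D} → RCst D s → RDen D s
  | .data t, none => D.undef t
  | .data _, some c => D.constVal c
  | .life, l => l
  | .flag, b => b

/-- The symbol `undef` of type `t`. -/
def cUndef (D : DataSchema) (t : D.Typ) : RCst D (.data t) := (none : Option (D.Const t))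

/-- The database theory. An attribute of an identifier is undefined iff the identifier is; constants
are equal iff they denote the same object; finite primitive types contain only the objects named
by constants. -/
inductive DBAxiom (D : DataSchema) : Fm (sig D) → Prop
  | null {R : D.Cat} {t : D.Typ} (f : RFn D (.data (.id R)) (.data t)) :
      DBAxiom D (.iff
        (.eq (s := RSrt.data (.id R)) (.var 0) (.cst (cUndef D (.id R))))
        (.eq (s := RSrt.data t) (.app (s := RSrt.data (.id R)) f (.var 0)) (.cst (cUndef D t))))
  | same {s : RSrt D} (c d : RCst D s) (h : c.den = d.den) :
      DBAxiom D (.eq (s := s) (.cst c) (.cst d))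
  | diff {s : RSrt D} (c d : RCst D s) (h : c.den ≠ d.den) :
      DBAxiom D (.neg (.eq (s := s) (.cst c) (.cst d)))
  | closed (v : D.Val) (h : Finite (D.Dom (.val v))) :
      DBAxiom D (.any fun c : RCst D (.data (.val v)) =>
        .eq (s := RSrt.data (.val v)) (.var 0) (.cst c))

theorem qfree_any {S : Sig} {ι : Type} [Finite ι] (f : ι → Fm S) (h : ∀ i, (f i).QFree) :
    (Fm.any f).QFree := by
  unfold Fm.any
  generalize (@Finset.univ ι (Fintype.ofFinite ι)).toList = l
  induction l with
  | nil => simp [Fm.QFree]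
  | cons a l ih =>
    simp only [List.map_cons, List.foldr_cons]
    exact ⟨h a, ih⟩

theorem qfree_of_dbAxiom {D : DataSchema} {φ : Fm (sig D)} (h : DBAxiom D φ) : φ.QFree := by
  cases h with
  | null f => simp [Fm.iff, Fm.or, Fm.QFree]
  | same c d h => trivial
  | diff c d h => trivial
  | closed v h => exact qfree_any _ fun _ => trivial

/-- Artifact variables for at most `k` cases: for each `j < k`, the case variables, `self`, the
lifecycle states of the blocks, and the values stored by nonatomic tasks. -/
inductive TVar (M : DAB) (k : ℕ) : RSrt M.D → Type
  | cv {t : M.D.Typ} (j : Fin k) (x : M.D.CVar t) : TVar M k (.data t)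
  | self (j : Fin k) : TVar M k (.data .case)
  | life (j : Fin k) (n : M.Node) : TVar M k .life
  | pend {t : M.D.Typ} (j : Fin k) (n : M.Node) (x : M.D.CVar t) : TVar M k (.data t)

/-- Artifact components of a repository relation `R`: one array for each attribute, and the array
which marks the entries that hold a tuple. -/
inductive TComp (D : DataSchema) (R : D.Repo) : RSrt D → Type
  | col {t : D.Typ} (a : D.RepoAttr R t) : TComp D R (.data t)
  | occ : TComp D R .flag

theorem finite_tvar (M : DAB) (k : ℕ) (s : RSrt M.D) : Finite (TVar M k s) := by
  have : Finite (Σ s, TVar M k s) := by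
    refine Finite.of_surjective
      (fun x : (Fin k × Σ t, M.D.CVar t) ⊕ Fin k ⊕ (Fin k × M.Node) ⊕
          (Fin k × M.Node × Σ t, M.D.CVar t) => match x with
        | .inl (j, ⟨t, x⟩) => (⟨.data t, .cv j x⟩ : Σ s, TVar M k s)
        | .inr (.inl j) => ⟨.data .case, .self j⟩
        | .inr (.inr (.inl (j, n))) => ⟨.life, .life j n⟩
        | .inr (.inr (.inr (j, n, ⟨t, x⟩))) => ⟨.data t, .pend j n x⟩) ?_
    rintro ⟨_, (⟨j, x⟩ | j | ⟨j, n⟩ | ⟨j, n, x⟩)⟩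
    · exact ⟨.inl (j, ⟨_, x⟩), rfl⟩
    · exact ⟨.inr (.inl j), rfl⟩
    · exact ⟨.inr (.inr (.inl (j, n))), rfl⟩
    · exact ⟨.inr (.inr (.inr (j, n, ⟨_, x⟩))), rfl⟩
  exact Finite.of_injective (fun x : TVar M k s => (⟨s, x⟩ : Σ s, TVar M k s))
    sigma_mk_injective

theorem finite_tcomp (D : DataSchema) (R : D.Repo) (s : RSrt D) : Finite (TComp D R s) := by
  have : Finite (Σ s, TComp D R s) := by
    refine Finite.of_surjective
      (fun x : (Σ t, D.RepoAttr R t) ⊕ Unit => match x with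
        | .inl ⟨t, a⟩ => (⟨.data t, .col a⟩ : Σ s, TComp D R s)
        | .inr _ => ⟨.flag, .occ⟩) ?_
    rintro ⟨_, (a | _)⟩
    · exact ⟨.inl ⟨_, a⟩, rfl⟩
    · exact ⟨.inr (), rfl⟩
  exact Finite.of_injective (fun x : TComp D R s => (⟨s, x⟩ : Σ s, TComp D R s))
    sigma_mk_injective

/-- The artifact setting of the translation, with one artifact sort for each repository
relation. -/
abbrev setting (M : DAB) (k : ℕ) : Setting where
  Sg := sig M.D
  ASrt := M.D.Repo
  AVar := TVar M k
  AComp := TComp M.D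
  finASrt := M.D.finRepo
  finAVar := finite_tvar M k
  finAComp := finite_tcomp M.D

section Translation

variable {M : DAB} {k : ℕ} {nv : RSrt M.D → ℕ}

abbrev RT (M : DAB) (k : ℕ) (nv : RSrt M.D → ℕ) (s : RSrt M.D) : Type := RTm (setting M k) nv s

abbrev FT (M : DAB) (k : ℕ) (nv : RSrt M.D → ℕ) : Type := QF (setting M k) nv

abbrev CT (M : DAB) (k : ℕ) (nv : RSrt M.D → ℕ) (s : RSrt M.D) : Type := CTm (setting M k) nv s

def tUndef (t : M.D.Typ) : RT M k nv (.data t) := .cst (cUndef M.D t)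

def tConst {t : M.D.Typ} (c : M.D.Const t) : RT M k nv (.data t) :=
  .cst (show RCst M.D (.data t) from some c)

def tLife (l : Life) : RT M k nv .life := .cst (show RCst M.D .life from l)

def tFlag (b : Bool) : RT M k nv .flag := .cst (show RCst M.D .flag from b)

def tVar {s : RSrt M.D} (x : TVar M k s) : RT M k nv s := .av x

def tRead {R : M.D.Repo} {s : RSrt M.D} (a : TComp M.D R s) (e : ℕ) : RT M k nv s := .read a e

/-- The entry `e` of the arrays of `R` holds a tuple, resp. is free. -/
def occupied (R : M.D.Repo) (e : ℕ) : FT M k nv := .eq (tRead (.occ (R := R)) e) (tFlag true)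

def free (R : M.D.Repo) (e : ℕ) : FT M k nv := .eq (tRead (.occ (R := R)) e) (tFlag false)

/-- Terms, for the `j`-th case; `f` gives the translation of the variables. -/
def trTerm {V : M.D.Typ → Type} (f : ∀ t, V t → RT M k nv (.data t)) (j : Fin k) :
    {t : M.D.Typ} → Term M.D V t → RT M k nv (.data t)
  | t, .var x => f t x
  | _, .const c => tConst c
  | t, .undef => tUndef t
  | _, .cv x => tVar (.cv j x)
  | _, .self => tVar (.self j)

def trCond (j : Fin k) : Cond M.D → FT M k nv
  | .eq x y => .eq (trTerm (fun _ z => z.elim) j x) (trTerm (fun _ z => z.elim) j y)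
  | .neg φ => .neg (trCond j φ)
  | .and φ ψ => .and (trCond j φ) (trCond j ψ)

/-- `R(x₀, …, xₙ)` iff `x₀ ≠ undef ∧ x₁ = f₁(x₀) ∧ … ∧ xₙ = fₙ(x₀)`. -/
def trCat (R : M.D.Cat) (x : RT M k nv (.data (.id R)))
    (f : ∀ t, M.D.CatAttr R t → RT M k nv (.data t)) : FT M k nv :=
  .and (.ne x (tUndef (.id R)))
    (.all fun q : Σ t, M.D.CatAttr R t =>
      .eq (s := RSrt.data q.1) (f q.1 q.2)
        (.app (s := RSrt.data (.id R)) (show RFn M.D (.data (.id R)) (.data q.1) from q.2) x))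

def trFLit {V : M.D.Typ → Type} (f : ∀ t, V t → RT M k nv (.data t)) (j : Fin k) :
    FLit M.D V → FT M k nv
  | .eq x y => .eq (trTerm f j x) (trTerm f j y)
  | .ne x y => .ne (trTerm f j x) (trTerm f j y)
  | .cat R x g => trCat R (trTerm f j x) (fun t a => trTerm f j (g t a))
  | .ncat R x g => .neg (trCat R (trTerm f j x) (fun t a => trTerm f j (g t a)))

/-- The entry `e` of the arrays of `R` agrees with `g` on the attributes in `K`. -/
def agree (R : M.D.Repo) (e : ℕ) (g : ∀ t, M.D.RepoAttr R t → RT M k nv (.data t))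
    (K : ∀ t, Set (M.D.RepoAttr R t)) : FT M k nv :=
  .all fun q : Σ t, M.D.RepoAttr R t =>
    if q.2 ∈ K q.1 then .eq (tRead (.col q.2) e) (g q.1 q.2) else .tt

/-- Literals; the variable `e` is the index of the tuple for a repository atom. -/
def trLit {V : M.D.Typ → Type} (f : ∀ t, V t → RT M k nv (.data t)) (j : Fin k) (e : ℕ) :
    Lit M.D V → FT M k nv
  | .filt l => trFLit f j l
  | .repo R g => .and (occupied R e) (agree R e (fun t a => trTerm f j (g t a)) fun _ => Set.univ)

end Translation

/-- Variables of basic sort of a transition, from the variables of an update specification. -/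
def liftNv {D : DataSchema} (nv : D.Typ → ℕ) : RSrt D → ℕ
  | .data t => nv t
  | _ => 0

section Translation

variable {M : DAB} {k : ℕ} {nv : M.D.Typ → ℕ}

def trVar (t : M.D.Typ) (x : Fin (nv t)) : RT M k (liftNv nv) (.data t) :=
  .var (show Fin (liftNv nv (.data t)) from x)

abbrev trT (j : Fin k) {t : M.D.Typ} (u : Term M.D (fun t => Fin (nv t)) t) :
    RT M k (liftNv nv) (.data t) :=
  trTerm trVar j u

/-- Guards. The index variable of the `i`-th literal is `i + 2`. Variables of the case identifier
type range over `undef` and the identifiers of the existing cases. -/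
def trGuard (j : Fin k) (G : Guard M.D (fun t => Fin (nv t))) : FT M k (liftNv nv) :=
  .and
    (.disj (G.map fun Q => .conj (Q.zipIdx.map fun q => trLit trVar j (q.2 + 2) q.1)))
    (.all fun x : Fin (nv .case) =>
      .or (.eq (trVar .case x) (tUndef .case))
        (.any fun i : Fin k => .eq (trVar .case x) (tVar (.self i))))

/-- The new value of the attribute `a` in a conditional update; the index of the tuple that is
being updated is the variable `0`. -/
def trCondUpd (j : Fin k) {R : M.D.Repo} {t : M.D.Typ} (a : M.D.RepoAttr R t) :
    CondUpd M.D (fun t => Fin (nv t)) R → CT M k (liftNv nv) (.data t)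
  | .tuple f => .tm (trTerm (fun t => Sum.elim (trVar t) fun b => tRead (.col b) 0) j (f t a))
  | .ite ψ η₁ η₂ =>
    .ite (.disj (ψ.map fun Q => .conj (Q.map
        (trFLit (fun t => Sum.elim (trVar t) fun b => tRead (.col b) 0) j))))
      (trCondUpd j a η₁) (trCondUpd j a η₂)

/-- Additional guard of an effect: a free entry for an insertion, the entry of the tuple for a
deletion. The index variable is `1`. -/
def effGuard (j : Fin k) : Effect M.D (fun t => Fin (nv t)) → FT M k (liftNv nv)
  | .insertSet R _ _ => free R 1
  | .set _ => .tt
  | .deleteSet R f _ =>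
    .and (occupied R 1) (agree R 1 (fun t a => trT j (f t a)) fun _ => Set.univ)
  | .update _ _ => .tt

def Effect.setPart {D : DataSchema} {V : D.Typ → Type} : Effect D V → SetPart D V
  | .insertSet _ _ σ => σ
  | .set σ => σ
  | .deleteSet _ _ σ => σ
  | .update _ _ => fun _ _ => none

/-- Insertion at the entry `1`, as a function of the entry `0`: `new` is written to the entry `1`;
for the set semantics, `clear` is written to the other entries that agree with the inserted
tuple on the key. -/
def insertUpd (sem : InsertSem M.D) (R : M.D.Repo)
    (g : ∀ t, M.D.RepoAttr R t → RT M k (liftNv nv) (.data t)) {s : RSrt M.D}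
    (new clear old : RT M k (liftNv nv) s) : CT M k (liftNv nv) s :=
  match sem with
  | .multiset => .ite (.ieq R 0 1) (.tm new) (.tm old)
  | .set K => .ite (.ieq R 0 1) (.tm new) (.ite (agree R 0 g (K R)) (.tm clear) (.tm old))

/-- Update of the array for the attribute `a` of `R'`. -/
def effCol (sem : InsertSem M.D) (j : Fin k) (E : Effect M.D (fun t => Fin (nv t)))
    {R' : M.D.Repo} {t : M.D.Typ} (a : M.D.RepoAttr R' t) : CT M k (liftNv nv) (.data t) :=
  let old : RT M k (liftNv nv) (.data t) := tRead (.col a) 0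
  match E with
  | .insertSet R f _ =>
    if h : R = R' then
      insertUpd sem R (fun t a => trT j (f t a)) (trT j (f t (h ▸ a))) (tUndef t) old
    else .tm old
  | .set _ => .tm old
  | .deleteSet R _ _ => if R = R' then .ite (.ieq R 0 1) (.tm (tUndef t)) (.tm old) else .tm old
  | .update R η =>
    if h : R = R' then .ite (occupied R 0) (trCondUpd j (h ▸ a) η) (.tm old) else .tm old

/-- Update of the array that marks the entries of `R'` that hold a tuple. -/
def effOcc (sem : InsertSem M.D) (j : Fin k) (E : Effect M.D (fun t => Fin (nv t)))
    (R' : M.D.Repo) : CT M k (liftNv nv) .flag :=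
  let old : RT M k (liftNv nv) .flag := tRead (.occ (R := R')) 0
  match E with
  | .insertSet R f _ =>
    if R = R' then insertUpd sem R (fun t a => trT j (f t a)) (tFlag true) (tFlag false) old
    else .tm old
  | .set _ => .tm old
  | .deleteSet R _ _ => if R = R' then .ite (.ieq R 0 1) (.tm (tFlag false)) (.tm old) else .tm old
  | .update _ _ => .tm old

/-- Control part of the guard of a rule, for the `j`-th case, which must have been created. -/
def ruleGuard {nv : RSrt M.D → ℕ} (j : Fin k) (r : Rule M.D M.Node) : FT M k nv :=
  .and (.ne (tVar (.self j)) (tUndef .case))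
    (.and (.conj (r.pre.map fun q => .eq (tVar (.life j q.1)) (tLife q.2)))
      (.conj (r.cond.map (trCond j))))

/-- Update of the artifact variables by a rule for the `j`-th case: `w` gives the new values of
the case variables of this case, and `p` the new stored values. -/
def ruleVar {nv : RSrt M.D → ℕ} (j : Fin k) (r : Rule M.D M.Node)
    (w : ∀ t, M.D.CVar t → RT M k nv (.data t))
    (p : M.Node → ∀ t, M.D.CVar t → RT M k nv (.data t)) :
    {s : RSrt M.D} → TVar M k s → CT M k nv s
  | .data t, .cv i x => .tm (if i = j then w t x else tVar (.cv i x))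
  | _, .self i => .tm (tVar (.self i))
  | _, .life i n => .tm (match (if i = j then r.next n else none) with
      | some l => tLife l
      | none => tVar (.life i n))
  | .data t, .pend i n x => .tm (if i = j then p n t x else tVar (.pend i n x))

/-- No change of the arrays. -/
def keepComp {nv : RSrt M.D → ℕ} {R : M.D.Repo} {s : RSrt M.D} (a : TComp M.D R s) :
    CT M k nv s := .tm (tRead a 0)

/-- The transition formula of a rule, for the `j`-th case. -/
def trRule (sem : InsertSem M.D) (j : Fin k) (r : Rule M.D M.Node) : Transition (setting M k) :=
  match r.act with
  | .skip =>
    { nv := fun _ => 0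
      guard := ruleGuard j r
      uvar := ruleVar j r (fun _ x => tVar (.cv j x)) (fun n _ x => tVar (.pend j n x))
      ucomp := keepComp }
  | .spec α =>
    { nv := liftNv α.nv
      guard := .and (ruleGuard j r) (.and (trGuard j α.pre) (effGuard j α.eff))
      uvar := ruleVar j r
        (fun t x => match α.eff.setPart t x with
          | some u => trT j u
          | none => tVar (.cv j x))
        (fun n _ x => tVar (.pend j n x))
      ucomp := fun {R s} a => match s, a with
        | _, .col b => effCol sem j α.eff b
        | _, .occ => effOcc sem j α.eff R }
  | .bind n β =>
    { nv := liftNv β.nv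
      guard := .and (ruleGuard j r) (trGuard j β.pre)
      uvar := ruleVar j r (fun _ x => tVar (.cv j x))
        (fun m t x => match (if m = n then β.set t x else none) with
          | some u => trT j u
          | none => tVar (.pend j m x))
      ucomp := keepComp }
  | .commit n β =>
    { nv := fun _ => 0
      guard := ruleGuard j r
      uvar := ruleVar j r
        (fun t x => if (β.set t x).isSome then tVar (.pend j n x) else tVar (.cv j x))
        (fun m _ x => tVar (.pend j m x))
      ucomp := keepComp }

/-- One variable, of the case identifier type. -/
def newNv (D : DataSchema) : RSrt D → ℕ
  | .data .case => 1
  | _ => 0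

/-- Creation of the `j`-th case, with a fresh identifier. -/
def trNew (M : DAB) (k : ℕ) (j : Fin k) : Transition (setting M k) :=
  let y : RT M k (newNv M.D) (.data .case) :=
    .var (show Fin (newNv M.D (.data .case)) from (0 : Fin 1))
  { nv := newNv M.D
    guard := .and (.eq (tVar (.self j)) (tUndef .case)) (.and (.ne y (tUndef .case))
      (.all fun i : Fin k => .ne y (tVar (.self i))))
    uvar := fun x => match x with
      | .self i => .tm (if i = j then y else tVar (.self i))
      | x => .tm (tVar x)
    ucomp := keepComp }

/-- The array-based artifact system of a DAB with at most `k` cases. -/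
def toRAS (M : DAB) (k : ℕ) (sem : InsertSem M.D) : RAS where
  A := setting M k
  T := {φ | DBAxiom M.D φ}
  universal := fun _ h => qfree_of_dbAxiom h
  ivar := fun {s} x => match s, x with
    | .data t, _ => cUndef M.D t
    | .life, _ => (Life.idle : Life)
    | .flag, _ => false
  icomp := fun {_ s} a => match s, a with
    | .data t, _ => cUndef M.D t
    | .life, _ => (Life.idle : Life)
    | .flag, _ => false
  trans := (List.finRange k).map (trNew M k) ++
    (List.finRange k).flatMap fun j => M.rules.map (trRule sem j)

/-- `y := a_R[e]`: a definition of the variable `x` of type `t` by a repository atom among the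
given literals, which come with their index variables; `undef` if there is none. -/
def defTerm {V : M.D.Typ → Type} {t : M.D.Typ} (x : V t) :
    List (ℕ × PLit M V) → RT M k (fun _ => 0) (.data t)
  | [] => tUndef t
  | (e, .data (.repo R f)) :: L =>
    if h : ∃ a : M.D.RepoAttr R t, f t a = .var x then tRead (.col h.choose) e else defTerm x L
  | _ :: L => defTerm x L

def trLTerm (j : Fin k) : LTerm M → RT M k (fun _ => 0) .life
  | .block n => tVar (.life j n)
  | .const l => tLife l

def trPLit {V : M.D.Typ → Type} (f : ∀ t, V t → RT M k (fun _ => 0) (.data t)) (j : Fin k)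
    (e : ℕ) : PLit M V → FT M k (fun _ => 0)
  | .data l => trLit f j e l
  | .leq x y => .eq (trLTerm j x) (trLTerm j y)
  | .lne x y => .ne (trLTerm j x) (trLTerm j y)

/-- The chosen disjuncts of the guards of a property, with a separate index variable for every
literal. -/
def Property.lits (υ : Property M) (ch : ∀ i, Fin (υ.G i).length) (i : Fin υ.n) :
    List (ℕ × PLit M (fun t => Fin (υ.nv t))) :=
  ((υ.G i).get (ch i)).zipIdx.map fun q => (Nat.pair i q.2, q.1)

/-- The state formula of a property: a disjunction over all assignments of different cases to the
indexes and all choices of disjuncts of the guards. -/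
def trProperty (k : ℕ) (υ : Property M) : StateFm (setting M k) :=
  .any fun π : Fin υ.n ↪ Fin k => .any fun ch : ∀ i, Fin (υ.G i).length =>
    .all fun i : Fin υ.n =>
      .and (.ne (tVar (.self (π i))) (tUndef .case))
        (.conj ((υ.lits ch i).map fun q =>
          trPLit (fun _ x => defTerm x ((List.finRange υ.n).flatMap (υ.lits ch))) (π i) q.1 q.2))

end Translation

/-- `BackReach M k sem υ b`: on the DAB `M` with at most `k` cases, the insertion semantics `sem`
and the property `υ`, the procedure terminates with the answer `b` (`true` for `yes`). -/
def BackReach (M : DAB) (k : ℕ) (sem : InsertSem M.D) (υ : Property M) (b : Bool) : Prop :=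
  (toRAS M k sem).BReach (trProperty k υ) [] b

end

end DABV

namespace DABV

noncomputable section

/-! ## Embeddings of structures act on assignments and runs -/

section Embedding

variable {A : Setting} {nv : A.Sg.Srt → ℕ} {M N : Str A.Sg} {idx : A.ASrt → Type}

/-- The image of an assignment under an embedding of structures. -/
def Asg.map (α : Asg A M idx) (g : M.Emb N) : Asg A N idx :=
  ⟨fun x => g.f _ (α.av x), fun a j => g.f _ (α.ac a j)⟩

theorem RTm.eval_map (g : M.Emb N) (α : Asg A M idx) (ρ : ∀ s, Fin (nv s) → M.car s)
    (η : ∀ E, ℕ → idx E) {s : A.Sg.Srt} (t : RTm A nv s) :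
    t.eval (α.map g) (fun s i => g.f s (ρ s i)) η = g.f s (t.eval α ρ η) := by
  induction t with
  | var i => rfl
  | cst c => exact (g.cst c).symm
  | av x => rfl
  | read a e => rfl
  | app f u ih => simp only [RTm.eval, ih, g.fn]

theorem QF.eval_map (g : M.Emb N) (α : Asg A M idx) (ρ : ∀ s, Fin (nv s) → M.car s)
    (η : ∀ E, ℕ → idx E) (φ : QF A nv) :
    φ.eval (α.map g) (fun s i => g.f s (ρ s i)) η ↔ φ.eval α ρ η := by
  induction φ with
  | tt => rfl
  | eq t u => simp only [QF.eval, RTm.eval_map, (g.inj _).eq_iff]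
  | ieq E m n => rfl
  | neg φ ih => simp only [QF.eval, ih]
  | and φ ψ ih₁ ih₂ => simp only [QF.eval, ih₁, ih₂]

theorem CTm.eval_map (g : M.Emb N) (α : Asg A M idx) (ρ : ∀ s, Fin (nv s) → M.car s)
    (η : ∀ E, ℕ → idx E) {s : A.Sg.Srt} (t : CTm A nv s) :
    t.eval (α.map g) (fun s i => g.f s (ρ s i)) η = g.f s (t.eval α ρ η) := by
  induction t with
  | tm t => exact RTm.eval_map g α ρ η t
  | ite κ t u ih₁ ih₂ =>
    simp only [CTm.eval, QF.eval_map, ih₁, ih₂]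
    split <;> rfl

theorem StateFm.holds_map (g : M.Emb N) (α : Asg A M idx) (φ : StateFm A) :
    StateFm.Holds (α.map g) φ ↔ StateFm.Holds α φ := by
  refine exists_congr fun η => ?_
  have := QF.eval_map g α (fun _ i => i.elim0) η φ
  rwa [show (fun s (i : Fin 0) => g.f s (i.elim0 : M.car s)) = fun s i => i.elim0 from
    funext fun s => funext fun i => i.elim0] at this

theorem Transition.Fires.map {τ : Transition A} {α α' : Asg A M idx} (h : τ.Fires α α')
    (g : M.Emb N) : τ.Fires (α.map g) (α'.map g) := by
  obtain ⟨ρ, η, hg, hv, hc⟩ := h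
  refine ⟨fun s i => g.f s (ρ s i), η, (QF.eval_map g α ρ η _).2 hg, fun s x => ?_,
    fun E s a j => ?_⟩
  · rw [CTm.eval_map, ← hv]; rfl
  · rw [CTm.eval_map, ← hc]; rfl

end Embedding

/-- The identity embedding. -/
def Str.Emb.id {S : Sig} (M : Str S) : M.Emb M :=
  ⟨fun _ x => x, fun _ => Function.injective_id, fun _ _ => rfl, fun _ => rfl⟩

/-- Composition of embeddings. -/
def Str.Emb.comp {S : Sig} {M N N' : Str S} (g : M.Emb N) (g' : N.Emb N') : M.Emb N' :=
  ⟨fun s x => g'.f s (g.f s x), fun s => (g'.inj s).comp (g.inj s),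
    fun h x => by rw [g.fn, g'.fn], fun c => by rw [g.cst, g'.cst]⟩

namespace RAS

variable {S : RAS}

/-- `α` is reached by some run. -/
def Reached (S : RAS) {M : Str S.A.Sg} {idx : S.A.ASrt → Type} (α : Asg S.A M idx) : Prop :=
  ∃ α₀, S.Initial α₀ ∧ Relation.ReflTransGen S.Step α₀ α

/-- Some run over some model of the theory reaches a state that satisfies `φ`. -/
def CanReach (S : RAS) (φ : StateFm S.A) : Prop :=
  S.TSat fun _ _ α => S.Reached α ∧ StateFm.Holds α φ

theorem Initial.map {M N : Str S.A.Sg} {idx : S.A.ASrt → Type} {α : Asg S.A M idx}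
    (h : S.Initial α) (g : M.Emb N) : S.Initial (α.map g) := by
  refine ⟨fun s x => ?_, fun E s a j => ?_⟩
  · rw [← g.cst, ← h.1]; rfl
  · rw [← g.cst, ← h.2 E s a j]; rfl

theorem Step.map {M N : Str S.A.Sg} {idx : S.A.ASrt → Type} {α α' : Asg S.A M idx}
    (h : S.Step α α') (g : M.Emb N) : S.Step (α.map g) (α'.map g) := by
  obtain ⟨τ, hτ, hf⟩ := h
  exact ⟨τ, hτ, hf.map g⟩

theorem Reached.map {M N : Str S.A.Sg} {idx : S.A.ASrt → Type} {α : Asg S.A M idx}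
    (h : S.Reached α) (g : M.Emb N) : S.Reached (α.map g) := by
  obtain ⟨α₀, h₀, h⟩ := h
  exact ⟨α₀.map g, h₀.map g, Relation.ReflTransGen.lift (fun α => Asg.map α g)
    (fun _ _ h => Step.map h g) _ _ h⟩

/-- If backward reachability answers `unsafe`, some run reaches the current formula. -/
theorem BReach.canReach {φ : StateFm S.A} {B : List (StateFm S.A)} {b : Bool}
    (h : S.BReach φ B b) (hb : b = true) : S.CanReach φ := by
  induction h with
  | answerNo => simp at hb
  | answerYes _ hit =>
    obtain ⟨M, idx, α, hT, hne, hi, hφ⟩ := hit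
    exact ⟨M, idx, α, hT, hne, ⟨α, hi, .refl⟩, hφ⟩
  | loop _ _ qe _ ih =>
    obtain ⟨M, idx, α, hT, hne, hr, hφ⟩ := ih hb
    obtain ⟨Ts, hTs, hqe⟩ := qe
    obtain ⟨N, hN, ⟨g⟩⟩ := hTs.embeds M hT
    obtain ⟨α', hs, hα'⟩ := (hqe N idx (α.map g) hN hne).1 ((StateFm.holds_map g α _).2 hφ)
    obtain ⟨α₀, h₀, hr⟩ := hr.map g
    exact ⟨N, idx, α', hTs.ext N hN, hne, ⟨α₀, h₀, hr.tail hs⟩, hα'⟩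

/-- A set of formulae that is closed under preimages and excludes the initial states excludes
all reachable states. -/
theorem not_canReach_of_closed {B : List (StateFm S.A)}
    (nohit : ∀ ψ ∈ B, ¬ S.TSat fun _ _ α => S.Initial α ∧ StateFm.Holds α ψ)
    (pre : ∀ ψ ∈ B, ∃ ψ', S.IsQEPre ψ ψ' ∧
      ¬ S.TSat fun _ _ α => StateFm.Holds α ψ' ∧ ¬ ∃ χ ∈ B, StateFm.Holds α χ)
    {ψ : StateFm S.A} (hψ : ψ ∈ B) : ¬ S.CanReach ψ := by
  rintro ⟨M, idx, α, hT, hne, ⟨α₀, h₀, hr⟩, hα⟩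
  suffices H : ∀ (N : Str S.A.Sg), N.Models S.T → ∀ g : M.Emb N, ∀ ψ ∈ B,
      ¬ StateFm.Holds (α.map g) ψ by
    exact H M hT (.id M) ψ hψ hα
  clear hα hψ ψ
  induction hr with
  | refl => exact fun N hN g ψ hψ h => nohit ψ hψ ⟨N, idx, _, hN, hne, h₀.map g, h⟩
  | @tail α α' _ hs ih =>
    intro N hN g ψ hψ h
    obtain ⟨ψ', ⟨Ts, hTs, hqe⟩, hfix⟩ := pre ψ hψ
    obtain ⟨N', hN', ⟨g'⟩⟩ := hTs.embeds N hN
    have hψ' : StateFm.Holds (α.map (g.comp g')) ψ' :=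
      (hqe N' idx _ hN' hne).2 ⟨α'.map (g.comp g'), hs.map _, (StateFm.holds_map g' _ ψ).2 h⟩
    refine hfix ⟨N', idx, _, hTs.ext _ hN', hne, hψ', ?_⟩
    rintro ⟨χ, hχ, h⟩
    exact ih N' (hTs.ext _ hN') _ χ hχ h

theorem CanReach.exists_of_fix {φ : StateFm S.A} {B : List (StateFm S.A)} (h : S.CanReach φ)
    (fix : ¬ S.TSat fun _ _ α => StateFm.Holds α φ ∧ ¬ ∃ ψ ∈ B, StateFm.Holds α ψ) :
    ∃ ψ ∈ B, S.CanReach ψ := by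
  obtain ⟨M, idx, α, hT, hne, hr, hφ⟩ := h
  by_contra! hB
  exact fix ⟨M, idx, α, hT, hne, hφ, fun ⟨ψ, hψ, h⟩ => hB ψ hψ ⟨M, idx, α, hT, hne, hr, h⟩⟩

/-- If backward reachability answers `safe`, no run reaches the current formula or a visited one. -/
theorem BReach.not_canReach {φ : StateFm S.A} {B : List (StateFm S.A)} {b : Bool}
    (h : S.BReach φ B b) (hb : b = false)
    (nohit : ∀ ψ ∈ B, ¬ S.TSat fun _ _ α => S.Initial α ∧ StateFm.Holds α ψ)
    (pre : ∀ ψ ∈ B, ∃ ψ', S.IsQEPre ψ ψ' ∧ ψ' ∈ φ :: B) :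
    ∀ ψ ∈ φ :: B, ¬ S.CanReach ψ := by
  induction h with
  | @answerNo φ B fix =>
    have hB : ∀ ψ ∈ B, ¬ S.CanReach ψ := by
      intro ψ hψ
      refine not_canReach_of_closed nohit (fun χ hχ => ?_) hψ
      obtain ⟨χ', hq, hχ'⟩ := pre χ hχ
      refine ⟨χ', hq, ?_⟩
      rcases List.mem_cons.1 hχ' with rfl | hχ'
      · exact fix
      · rintro ⟨M, idx, α, -, -, h, hn⟩
        exact hn ⟨χ', hχ', h⟩
    intro ψ hψ hr
    rcases List.mem_cons.1 hψ with rfl | hψ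
    · obtain ⟨χ, hχ, h⟩ := hr.exists_of_fix fix
      exact hB χ hχ h
    · exact hB ψ hψ hr
  | answerYes => simp at hb
  | @loop φ φ' B b _ nohitφ qe _ ih =>
    intro ψ hψ
    refine ih hb ?_ ?_ ψ (List.mem_cons_of_mem _ hψ)
    · intro χ hχ
      rcases List.mem_cons.1 hχ with rfl | hχ
      exacts [nohitφ, nohit χ hχ]
    · intro χ hχ
      rcases List.mem_cons.1 hχ with rfl | hχ
      · exact ⟨φ', qe, List.mem_cons_self⟩
      · obtain ⟨χ', hq, hχ'⟩ := pre χ hχ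
        exact ⟨χ', hq, List.mem_cons_of_mem _ hχ'⟩

/-- Backward reachability, if it terminates, decides whether a formula can be reached over some
model of the theory. -/
theorem BReach.correct {φ : StateFm S.A} {b : Bool} (h : S.BReach φ [] b) :
    b = true ↔ S.CanReach φ := by
  cases b with
  | true => exact ⟨fun _ => h.canReach rfl, fun _ => rfl⟩
  | false =>
    refine ⟨fun h => by simp at h, fun hr => absurd hr ?_⟩
    exact h.not_canReach rfl (by simp) (by simp) φ List.mem_cons_self

end RAS

/-! ## Runs visit finitely many elements -/

section Support

variable {A : Setting} {nv : A.Sg.Srt → ℕ} {M : Str A.Sg} {idx : A.ASrt → Type}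

theorem RTm.finite_range_eval (α : Asg A M idx) (ρ : ∀ s, Fin (nv s) → M.car s)
    (η : ∀ E, ℕ → idx E) (E : A.ASrt) (hα : ∀ s (a : A.AComp E s), (Set.range (α.ac a)).Finite)
    {s : A.Sg.Srt} (t : RTm A nv s) :
    (Set.range fun j => t.eval α ρ (upd η E 0 j)).Finite := by
  induction t with
  | var i => exact (Set.finite_singleton (ρ _ i)).subset (by rintro _ ⟨j, rfl⟩; rfl)
  | cst c => exact (Set.finite_singleton (M.cst c)).subset (by rintro _ ⟨j, rfl⟩; rfl)
  | av x => exact (Set.finite_singleton (α.av x)).subset (by rintro _ ⟨j, rfl⟩; rfl)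
  | @read E' s a e =>
    by_cases h : E' = E
    · subst h
      refine (hα s a).subset ?_
      rintro _ ⟨j, rfl⟩
      exact ⟨_, rfl⟩
    · refine (Set.finite_singleton (α.ac a (η E' e))).subset ?_
      rintro _ ⟨j, rfl⟩
      simp [RTm.eval, upd, Function.update_of_ne h]
  | app f u ih =>
    refine (ih.image (M.fn f)).subset ?_
    rintro _ ⟨j, rfl⟩
    exact ⟨_, ⟨j, rfl⟩, rfl⟩

theorem CTm.finite_range_eval (α : Asg A M idx) (ρ : ∀ s, Fin (nv s) → M.car s)
    (η : ∀ E, ℕ → idx E) (E : A.ASrt) (hα : ∀ s (a : A.AComp E s), (Set.range (α.ac a)).Finite)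
    {s : A.Sg.Srt} (t : CTm A nv s) :
    (Set.range fun j => t.eval α ρ (upd η E 0 j)).Finite := by
  induction t with
  | tm t => exact t.finite_range_eval α ρ η E hα
  | ite κ t u ih₁ ih₂ =>
    refine (ih₁.union ih₂).subset ?_
    rintro _ ⟨j, rfl⟩
    simp only [CTm.eval]
    split
    exacts [.inl ⟨j, rfl⟩, .inr ⟨j, rfl⟩]

/-- All values of an assignment lie in `F`. -/
structure Asg.In (F : ∀ s, Set (M.car s)) (α : Asg A M idx) : Prop where
  av : ∀ s (x : A.AVar s), α.av x ∈ F s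
  ac : ∀ E s (a : A.AComp E s) (j : idx E), α.ac a j ∈ F s

theorem Asg.In.mono {F F' : ∀ s, Set (M.car s)} {α : Asg A M idx} (h : α.In F)
    (hF : ∀ s, F s ⊆ F' s) : α.In F' :=
  ⟨fun s x => hF s (h.av s x), fun E s a j => hF s (h.ac E s a j)⟩

theorem Asg.exists_finite_in (α : Asg A M idx)
    (hα : ∀ E s (a : A.AComp E s), (Set.range (α.ac a)).Finite) :
    ∃ F : ∀ s, Set (M.car s), (∀ s, (F s).Finite) ∧ α.In F := by
  have := A.finASrt
  have := A.finAVar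
  have := A.finAComp
  refine ⟨fun s => Set.range (α.av (s := s)) ∪ ⋃ E, ⋃ a : A.AComp E s, Set.range (α.ac a),
    fun s => ?_, fun s x => .inl ⟨x, rfl⟩, fun E s a j => .inr ?_⟩
  · exact (Set.finite_range _).union (Set.finite_iUnion fun E => Set.finite_iUnion fun a => hα E s a)
  · exact Set.mem_iUnion.2 ⟨E, Set.mem_iUnion.2 ⟨a, j, rfl⟩⟩

/-- A firing of a transition with values for the variables of basic sort in `F`. -/
def Transition.FiresIn (F : ∀ s, Set (M.car s)) (τ : Transition A) (α α' : Asg A M idx) : Prop :=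
  ∃ (ρ : ∀ s, Fin (τ.nv s) → M.car s) (η : ∀ E, ℕ → idx E),
    (∀ s i, ρ s i ∈ F s) ∧ τ.guard.eval α ρ η ∧
    (∀ s (x : A.AVar s), α'.av x = (τ.uvar x).eval α ρ η) ∧
    (∀ E s (a : A.AComp E s) (j : idx E), α'.ac a j = (τ.ucomp a).eval α ρ (upd η E 0 j))

end Support

namespace RAS

variable {S : RAS} {M : Str S.A.Sg} {idx : S.A.ASrt → Type}

/-- A step that stays inside of `F`. -/
def StepIn (S : RAS) {M : Str S.A.Sg} {idx : S.A.ASrt → Type} (F : ∀ s, Set (M.car s))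
    (α α' : Asg S.A M idx) : Prop :=
  α'.In F ∧ ∃ τ ∈ S.trans, τ.FiresIn F α α'

theorem StepIn.mono {F F' : ∀ s, Set (M.car s)} {α α' : Asg S.A M idx} (h : S.StepIn F α α')
    (hF : ∀ s, F s ⊆ F' s) : S.StepIn F' α α' := by
  obtain ⟨h', τ, hτ, ρ, η, hρ, h⟩ := h
  exact ⟨h'.mono hF, τ, hτ, ρ, η, fun s i => hF s (hρ s i), h⟩

theorem exists_finite_support {α₀ α : Asg S.A M idx} (h₀ : S.Initial α₀)
    (h : Relation.ReflTransGen S.Step α₀ α) :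
    ∃ F : ∀ s, Set (M.car s), (∀ s, (F s).Finite) ∧
      Relation.ReflTransGen (S.StepIn F) α₀ α := by
  suffices H : (∀ E s (a : S.A.AComp E s), (Set.range (α.ac a)).Finite) ∧
      ∃ F : ∀ s, Set (M.car s), (∀ s, (F s).Finite) ∧
      Relation.ReflTransGen (S.StepIn F) α₀ α from H.2
  induction h with
  | refl =>
    have hf : ∀ E s (a : S.A.AComp E s), (Set.range (α₀.ac a)).Finite := fun E s a =>
      (Set.finite_singleton (M.cst (S.icomp a))).subset (by
        rintro _ ⟨j, rfl⟩; exact h₀.2 E s a j)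
    exact ⟨hf, fun _ => ∅, fun _ => Set.finite_empty, .refl⟩
  | @tail α α' _ hs ih =>
    obtain ⟨hα, F, hF, hr⟩ := ih
    obtain ⟨τ, hτ, ρ, η, hg, hv, hc⟩ := hs
    have hf : ∀ E s (a : S.A.AComp E s), (Set.range (α'.ac a)).Finite := fun E s a => by
      rw [show α'.ac a = fun j => (τ.ucomp a).eval α ρ (upd η E 0 j) from funext (hc E s a)]
      exact CTm.finite_range_eval α ρ η E (hα E) _
    obtain ⟨F', hF', hα'⟩ := α'.exists_finite_in hf
    have hsub : ∀ s, F s ⊆ F s ∪ F' s ∪ Set.range (ρ s) := fun s =>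
      Set.subset_union_left.trans Set.subset_union_left
    refine ⟨hf, fun s => F s ∪ F' s ∪ Set.range (ρ s),
      fun s => ((hF s).union (hF' s)).union (Set.finite_range _), ?_⟩
    refine (Relation.ReflTransGen.mono (fun _ _ h => h.mono hsub) _ _ hr).tail ⟨hα'.mono fun s => ?_, τ, hτ, ρ, η,
      fun s i => .inr ⟨i, rfl⟩, hg, hv, hc⟩
    exact Set.subset_union_right.trans Set.subset_union_left

end RAS

/-! ## Evaluation of derived connectives -/

section Connectives

variable {A : Setting} {nv : A.Sg.Srt → ℕ} {N : Str A.Sg} {idx : A.ASrt → Type}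
  {α : Asg A N idx} {ρ : ∀ s, Fin (nv s) → N.car s} {η : ∀ E, ℕ → idx E}

theorem QF.eval_or {φ ψ : QF A nv} :
    (QF.or φ ψ).eval α ρ η ↔ φ.eval α ρ η ∨ ψ.eval α ρ η := by
  simp only [QF.or, QF.eval]; tauto

theorem QF.eval_ne {s : A.Sg.Srt} {t u : RTm A nv s} :
    (QF.ne t u).eval α ρ η ↔ t.eval α ρ η ≠ u.eval α ρ η := Iff.rfl

theorem QF.eval_conj {l : List (QF A nv)} :
    (QF.conj l).eval α ρ η ↔ ∀ φ ∈ l, φ.eval α ρ η := by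
  induction l with
  | nil => simp [QF.conj, QF.eval]
  | cons φ l ih =>
    rw [List.forall_mem_cons, ← ih]; rfl

theorem QF.eval_disj {l : List (QF A nv)} :
    (QF.disj l).eval α ρ η ↔ ∃ φ ∈ l, φ.eval α ρ η := by
  induction l with
  | nil => simp [QF.disj, QF.eval]
  | cons φ l ih =>
    rw [List.exists_mem_cons_iff, ← ih]; exact QF.eval_or

theorem QF.eval_all {ι : Type} [Finite ι] {f : ι → QF A nv} :
    (QF.all f).eval α ρ η ↔ ∀ i, (f i).eval α ρ η := by
  simp [QF.all, QF.eval_conj]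

theorem QF.eval_any {ι : Type} [Finite ι] {f : ι → QF A nv} :
    (QF.any f).eval α ρ η ↔ ∃ i, (f i).eval α ρ η := by
  simp [QF.any, QF.eval_disj]

end Connectives

theorem upd_self {I : Type} {X : I → Type} (v : ∀ s, ℕ → X s) (s : I) (n : ℕ) (x : X s) :
    upd v s n x s n = x := by simp [upd]

theorem upd_of_ne {I : Type} {X : I → Type} (v : ∀ s, ℕ → X s) (s : I) {n m : ℕ} (h : m ≠ n)
    (x : X s) : upd v s n x s m = v s m := by simp [upd, h]

/-! ## Frames: the data of a structure for the database signature, read in a catalog instance -/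

/-- A correspondence between the elements of a structure `N` in the sets `F t` and objects of the
data schema, such that the functions of `N` represent the catalog instance. -/
structure Frame (D : DataSchema) (N : Str (sig D)) where
  I : CatInst D
  F : ∀ t : D.Typ, Set (N.car (.data t))
  val : ∀ t : D.Typ, N.car (.data t) → D.Dom t
  inj : ∀ t, Set.InjOn (val t) (F t)
  cst_mem : ∀ t (c : RCst D (.data t)), N.cst (s := RSrt.data t) c ∈ F t
  val_cst : ∀ t (c : RCst D (.data t)), val t (N.cst (s := RSrt.data t) c) = RCst.den c
  cat : ∀ R, ∀ x ∈ F (.id R), ∀ y : ∀ t, D.CatAttr R t → N.car (.data t),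
    (∀ t a, y t a ∈ F t) →
    ((val (.id R) x, fun t a => val t (y t a)) ∈ I.rel R ↔
      x ≠ N.cst (s := RSrt.data (.id R)) (cUndef D (.id R)) ∧
      ∀ t a, y t a = N.fn (s := RSrt.data (.id R)) (t := RSrt.data t)
        (show RFn D (.data (.id R)) (.data t) from a) x)
  valid : ∀ R, ∀ x ∈ F (.id R),
    val (.id R) x = D.undef (.id R) ∨ ∃ q ∈ I.rel R, q.1 = val (.id R) x
  life_ne : ∀ l l' : Life, N.cst (s := RSrt.life) l = N.cst (s := RSrt.life) l' → l = l'
  flag_ne : N.cst (s := RSrt.flag) true ≠ N.cst (s := RSrt.flag) false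

namespace Frame

variable {D : DataSchema} {N : Str (sig D)} (Φ : Frame D N)

/-- The element that interprets `undef`. -/
abbrev null (_ : Frame D N) (t : D.Typ) : N.car (.data t) :=
  N.cst (s := RSrt.data t) (cUndef D t)

theorem val_null (t : D.Typ) : Φ.val t (Φ.null t) = D.undef t := Φ.val_cst t _

theorem null_mem (t : D.Typ) : Φ.null t ∈ Φ.F t := Φ.cst_mem t _

theorem val_eq_iff {t : D.Typ} {x y : N.car (.data t)} (hx : x ∈ Φ.F t) (hy : y ∈ Φ.F t) :
    Φ.val t x = Φ.val t y ↔ x = y := (Φ.inj t).eq_iff hx hy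

theorem val_eq_undef {t : D.Typ} {x : N.car (.data t)} (hx : x ∈ Φ.F t) :
    Φ.val t x = D.undef t ↔ x = Φ.null t := by
  rw [← Φ.val_null, Φ.val_eq_iff hx (Φ.null_mem t)]

end Frame

section Simulation

variable {M : DAB} {k : ℕ} {N : Str (sig M.D)} {idx : M.D.Repo → Type}

/-- The tuple at the entry `j` of the arrays of `R`. -/
def Frame.tup (Φ : Frame M.D N) (α : Asg (setting M k) N idx) (R : M.D.Repo) (j : idx R) :
    RTuple M.D R :=
  fun t a => Φ.val t (α.ac (TComp.col a) j)

/-- The entry `j` holds a tuple. -/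
def Occ (α : Asg (setting M k) N idx) (R : M.D.Repo) (j : idx R) : Prop :=
  α.ac (TComp.occ (R := R)) j = N.cst (s := RSrt.flag) true

/-- The arrays of `R` store the multiset `m`. -/
def Frame.Stores (Φ : Frame M.D N) (α : Asg (setting M k) N idx) (R : M.D.Repo)
    (m : Multiset (RTuple M.D R)) : Prop :=
  (∀ j, Occ α R j ∨ α.ac (TComp.occ (R := R)) j = N.cst (s := RSrt.flag) false) ∧
  ∃ E : Finset (idx R), (∀ j, j ∈ E ↔ Occ α R j) ∧ m = E.val.map (Φ.tup α R)

/-- The `j`-th copy of the artifact variables stores the entry `e`. -/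
structure Frame.Slot (Φ : Frame M.D N) (α : Asg (setting M k) N idx) (j : Fin k)
    (e : Entry M) : Prop where
  cv : ∀ t (x : M.D.CVar t), Φ.val t (α.av (TVar.cv j x)) = e.vars t x
  life : ∀ n, α.av (TVar.life j n) = N.cst (s := RSrt.life) (e.life n)
  pend : ∀ n t (x : M.D.CVar t), Φ.val t (α.av (TVar.pend j n x)) = e.pend n t x

/-- All data values of an assignment lie in the sets of the frame. -/
structure Frame.Mem (Φ : Frame M.D N) (α : Asg (setting M k) N idx) : Prop where
  av : ∀ t (x : TVar M k (.data t)), α.av x ∈ Φ.F t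
  col : ∀ R t (a : M.D.RepoAttr R t) (j : idx R), α.ac (TComp.col a) j ∈ Φ.F t

/-- The identifier of the `j`-th case. -/
abbrev slf (α : Asg (setting M k) N idx) (j : Fin k) : N.car (.data .case) := α.av (TVar.self j)

/-- The assignment `α` represents the snapshot `s`, with entry `e j` in the `j`-th slot. -/
structure Frame.Rel (Φ : Frame M.D N) (α : Asg (setting M k) N idx) (s : Snapshot M)
    (e : Fin k → Entry M) : Prop where
  mem : Φ.Mem α
  repo : ∀ R, Φ.Stores α R (s.repo R)
  slot : ∀ j, Φ.Slot α j (e j)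
  self_inj : ∀ i j, slf α i ≠ Φ.null .case → slf α i = slf α j → i = j
  cases : ∀ c x, s.cases c = some x ↔
    ∃ j, slf α j ≠ Φ.null .case ∧ Φ.val .case (slf α j) = c ∧ e j = x
  fresh : ∀ j, slf α j = Φ.null .case → e j = Entry.fresh M

variable {Φ : Frame M.D N} {α α' : Asg (setting M k) N idx} {s : Snapshot M}
  {e : Fin k → Entry M}

theorem Frame.Rel.cases_self (h : Φ.Rel α s e) {j : Fin k} (hj : slf α j ≠ Φ.null .case) :
    s.cases (Φ.val .case (slf α j)) = some (e j) :=
  (h.cases _ _).2 ⟨j, hj, rfl, rfl⟩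

theorem Frame.Stores.mem_iff {R : M.D.Repo} {m : Multiset (RTuple M.D R)}
    (h : Φ.Stores α R m) (u : RTuple M.D R) : u ∈ m ↔ ∃ j, Occ α R j ∧ Φ.tup α R j = u := by
  obtain ⟨-, E, hE, rfl⟩ := h
  simp [hE]

/-! ### Terms, literals and guards -/

section Terms

variable {nv : RSrt M.D → ℕ} {ρ : ∀ s, Fin (nv s) → N.car s} {η : ∀ E, ℕ → idx E}
  {V : M.D.Typ → Type}

variable {f : ∀ t, V t → RT M k nv (.data t)} {ρD : ∀ t, V t → M.D.Dom t} {j : Fin k}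
  {w : VarVals M.D}

/-- The `j`-th case has the case variables `w`. -/
def Frame.Vars (Φ : Frame M.D N) (α : Asg (setting M k) N idx) (j : Fin k) (w : VarVals M.D) :
    Prop :=
  ∀ t (x : M.D.CVar t), Φ.val t (α.av (TVar.cv j x)) = w t x

theorem Frame.eval_trTerm (hα : Φ.Mem α) (hw : Φ.Vars α j w) {t : M.D.Typ} (u : Term M.D V t)
    (hf : ∀ x, u = .var x → (f t x).eval α ρ η ∈ Φ.F t ∧
      Φ.val t ((f t x).eval α ρ η) = ρD t x) :
    (trTerm f j u).eval α ρ η ∈ Φ.F t ∧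
      Φ.val t ((trTerm f j u).eval α ρ η) = u.eval ρD (Φ.val .case (slf α j)) w := by
  cases u with
  | var x => exact hf x rfl
  | const c => exact ⟨Φ.cst_mem _ _, Φ.val_cst _ _⟩
  | undef => exact ⟨Φ.cst_mem _ _, Φ.val_cst _ _⟩
  | cv x => exact ⟨hα.av _ _, hw _ _⟩
  | self => exact ⟨hα.av _ _, rfl⟩

theorem Frame.eval_trCond (hα : Φ.Mem α) (hw : Φ.Vars α j w) (φ : Cond M.D) :
    (trCond j φ : FT M k nv).eval α ρ η ↔ φ.Holds (Φ.val .case (slf α j)) w := by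
  induction φ with
  | @eq t x y =>
    have hx := Φ.eval_trTerm (ρ := ρ) (η := η) (f := fun _ z => z.elim) (ρD := fun _ z => z.elim)
      hα hw x (fun z => z.elim)
    have hy := Φ.eval_trTerm (ρ := ρ) (η := η) (f := fun _ z => z.elim) (ρD := fun _ z => z.elim)
      hα hw y (fun z => z.elim)
    simp only [trCond, QF.eval, Cond.Holds]
    rw [← hx.2, ← hy.2, Φ.val_eq_iff hx.1 hy.1]
  | neg φ ih => simp only [trCond, QF.eval, Cond.Holds, ih]
  | and φ ψ ih₁ ih₂ => simp only [trCond, QF.eval, Cond.Holds, ih₁, ih₂]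

theorem Frame.eval_trCat {R : M.D.Cat} {x : RT M k nv (.data (.id R))}
    {g : ∀ t, M.D.CatAttr R t → RT M k nv (.data t)} (hx : x.eval α ρ η ∈ Φ.F (.id R))
    (hg : ∀ t a, (g t a).eval α ρ η ∈ Φ.F t) :
    (trCat R x g).eval α ρ η ↔
      (Φ.val _ (x.eval α ρ η), fun t a => Φ.val t ((g t a).eval α ρ η)) ∈ Φ.I.rel R := by
  rw [Φ.cat R _ hx _ hg]
  simp only [trCat, QF.eval, QF.eval_all, QF.ne, Sigma.forall]
  rfl

/-- The variables of a literal that does not query the repository. -/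
def FLit.Uses {t : M.D.Typ} (x : V t) (l : FLit M.D V) : Prop := PLit.Mentions x (.data (.filt l))

theorem Frame.eval_trFLit (hα : Φ.Mem α) (hw : Φ.Vars α j w) (l : FLit M.D V)
    (hf : ∀ t x, l.Uses x → (f t x).eval α ρ η ∈ Φ.F t ∧
      Φ.val t ((f t x).eval α ρ η) = ρD t x) :
    (trFLit f j l).eval α ρ η ↔ l.Holds Φ.I ρD (Φ.val .case (slf α j)) w := by
  cases l with
  | eq x y =>
    have hx := Φ.eval_trTerm (ρD := ρD) hα hw x fun z hz => hf _ z (.inl (by rw [hz]; rfl))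
    have hy := Φ.eval_trTerm (ρD := ρD) hα hw y fun z hz => hf _ z (.inr (by rw [hz]; rfl))
    simp only [trFLit, QF.eval, FLit.Holds]
    rw [← hx.2, ← hy.2, Φ.val_eq_iff hx.1 hy.1]
  | ne x y =>
    have hx := Φ.eval_trTerm (ρD := ρD) hα hw x fun z hz => hf _ z (.inl (by rw [hz]; rfl))
    have hy := Φ.eval_trTerm (ρD := ρD) hα hw y fun z hz => hf _ z (.inr (by rw [hz]; rfl))
    simp only [trFLit, QF.eval, QF.ne, FLit.Holds]
    rw [← hx.2, ← hy.2, ne_eq, Φ.val_eq_iff hx.1 hy.1]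
  | cat R x g =>
    have hx := Φ.eval_trTerm (ρD := ρD) hα hw x fun z hz => hf _ z (.inl (by rw [hz]; rfl))
    have hg := fun t a => Φ.eval_trTerm (ρD := ρD) hα hw (g t a)
      fun z hz => hf _ z (.inr ⟨t, a, by rw [hz]; rfl⟩)
    simp only [trFLit, FLit.Holds]
    rw [Φ.eval_trCat hx.1 fun t a => (hg t a).1]
    simp only [hx.2, (hg _ _).2]
  | ncat R x g =>
    have hx := Φ.eval_trTerm (ρD := ρD) hα hw x fun z hz => hf _ z (.inl (by rw [hz]; rfl))
    have hg := fun t a => Φ.eval_trTerm (ρD := ρD) hα hw (g t a)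
      fun z hz => hf _ z (.inr ⟨t, a, by rw [hz]; rfl⟩)
    simp only [trFLit, FLit.Holds, QF.eval]
    rw [Φ.eval_trCat hx.1 fun t a => (hg t a).1]
    simp only [hx.2, (hg _ _).2]

theorem Frame.eval_agree (hα : Φ.Mem α) {R : M.D.Repo} {i : ℕ}
    {g : ∀ t, M.D.RepoAttr R t → RT M k nv (.data t)} {K : ∀ t, Set (M.D.RepoAttr R t)}
    {u : RTuple M.D R} (hg : ∀ t a, (g t a).eval α ρ η ∈ Φ.F t ∧
      Φ.val t ((g t a).eval α ρ η) = u t a) :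
    (agree R i g K).eval α ρ η ↔ ∀ t, ∀ a ∈ K t, Φ.tup α R (η R i) t a = u t a := by
  simp only [agree, QF.eval_all, Sigma.forall]
  refine forall_congr' fun t => forall_congr' fun a => ?_
  by_cases h : a ∈ K t
  · simp only [h, if_true, forall_const, QF.eval]
    rw [← (hg t a).2, Frame.tup, Φ.val_eq_iff (hα.col _ _ _ _) (hg t a).1]
    rfl
  · simp [h, QF.eval]

theorem Frame.eval_agree_univ (hα : Φ.Mem α) {R : M.D.Repo} {i : ℕ}
    {g : ∀ t, M.D.RepoAttr R t → RT M k nv (.data t)}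
    {u : RTuple M.D R} (hg : ∀ t a, (g t a).eval α ρ η ∈ Φ.F t ∧
      Φ.val t ((g t a).eval α ρ η) = u t a) :
    (agree R i g fun _ => Set.univ).eval α ρ η ↔ Φ.tup α R (η R i) = u := by
  rw [Φ.eval_agree hα hg]
  simp only [Set.mem_univ, forall_const, funext_iff]

/-- The literal holds, and in case of a repository atom, its tuple is stored at the entry `o R`. -/
def Frame.LitAt (Φ : Frame M.D N) (α : Asg (setting M k) N idx) (o : ∀ R, idx R)
    (ρD : ∀ t, V t → M.D.Dom t) (c : M.D.Dom .case) (w : VarVals M.D) : Lit M.D V → Prop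
  | .filt l => l.Holds Φ.I ρD c w
  | .repo R g => Occ α R (o R) ∧ Φ.tup α R (o R) = fun t a => (g t a).eval ρD c w

theorem Frame.eval_trLit (hα : Φ.Mem α) (hw : Φ.Vars α j w) {i : ℕ} (l : Lit M.D V)
    (hf : ∀ t x, PLit.Mentions x (.data l) → (f t x).eval α ρ η ∈ Φ.F t ∧
      Φ.val t ((f t x).eval α ρ η) = ρD t x) :
    (trLit f j i l).eval α ρ η ↔
      Φ.LitAt α (fun R => η R i) ρD (Φ.val .case (slf α j)) w l := by
  cases l with
  | filt l => exact Φ.eval_trFLit hα hw l hf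
  | repo R g =>
    have hg := fun t a => Φ.eval_trTerm (ρD := ρD) hα hw (g t a)
      fun z hz => hf _ z ⟨t, a, by rw [hz]; rfl⟩
    simp only [trLit, QF.eval]
    rw [Φ.eval_agree_univ hα hg]
    rfl

theorem Frame.LitAt.holds {o : ∀ R, idx R} {c : M.D.Dom .case} {l : Lit M.D V}
    {rp : ∀ R, Multiset (RTuple M.D R)} (hs : ∀ R, Φ.Stores α R (rp R))
    (h : Φ.LitAt α o ρD c w l) : l.Holds Φ.I rp ρD c w := by
  cases l with
  | filt l => exact h
  | repo R g => exact ((hs R).mem_iff _).2 ⟨o R, h⟩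

theorem Frame.exists_litAt [∀ R, Nonempty (idx R)] {c : M.D.Dom .case} {l : Lit M.D V}
    {rp : ∀ R, Multiset (RTuple M.D R)} (hs : ∀ R, Φ.Stores α R (rp R))
    (h : l.Holds Φ.I rp ρD c w) : ∃ o : ∀ R, idx R, Φ.LitAt α o ρD c w l := by
  cases l with
  | filt l => exact ⟨fun R => Classical.arbitrary _, h⟩
  | repo R g =>
    obtain ⟨j, hj⟩ := ((hs R).mem_iff _).1 h
    refine ⟨Function.update (fun R => Classical.arbitrary _) R j, ?_⟩
    simpa [Frame.LitAt] using hj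

end Terms

end Simulation

/-! ### Effects as functions -/

section Effects

variable {D : DataSchema} {V : D.Typ → Type}

/-- The repository after an effect. -/
def Effect.outRepo (sem : InsertSem D) (I : CatInst D) (rp : ∀ R : D.Repo, Multiset (RTuple D R))
    (ρ : ∀ t, V t → D.Dom t) (c : D.Dom .case) (w : VarVals D) :
    Effect D V → ∀ R : D.Repo, Multiset (RTuple D R)
  | .insertSet R f _ =>
    Function.update rp R (sem.insert (rp R) (fun t a => (f t a).eval ρ c w))
  | .set _ => rp
  | .deleteSet R f _ => Function.update rp R ((rp R).erase (fun t a => (f t a).eval ρ c w))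
  | .update R η => Function.update rp R ((rp R).map (fun u => η.eval I ρ c w u))

/-- The effect is executable. -/
def Effect.Ok (rp : ∀ R : D.Repo, Multiset (RTuple D R))
    (ρ : ∀ t, V t → D.Dom t) (c : D.Dom .case) (w : VarVals D) : Effect D V → Prop
  | .deleteSet R f _ => (fun t a => (f t a).eval ρ c w) ∈ rp R
  | _ => True

theorem Effect.apply_iff {sem : InsertSem D} {I : CatInst D}
    {rp rp' : ∀ R : D.Repo, Multiset (RTuple D R)} {ρ : ∀ t, V t → D.Dom t} {c : D.Dom .case}
    {w w' : VarVals D} {E : Effect D V} :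
    E.Apply sem I rp ρ c w rp' w' ↔
      E.Ok rp ρ c w ∧ rp' = E.outRepo sem I rp ρ c w ∧ w' = E.setPart.apply ρ c w := by
  cases E with
  | deleteSet R f σ => exact Iff.rfl
  | _ => exact (iff_of_eq (true_and _)).symm

end Effects

section Simulation

variable {M : DAB} {k : ℕ} {N : Str (sig M.D)} {idx : M.D.Repo → Type}
  {Φ : Frame M.D N} {α α' : Asg (setting M k) N idx} {s : Snapshot M}
  {e : Fin k → Entry M}

/-! ### Changes of the arrays -/

section Arrays

variable {R : M.D.Repo} {m : Multiset (RTuple M.D R)}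

theorem Frame.Stores.not_occ_iff (h : Φ.Stores α R m) (i : idx R) :
    ¬ Occ α R i ↔ α.ac (TComp.occ (R := R)) i = N.cst (s := RSrt.flag) false := by
  refine ⟨fun hn => (h.1 i).resolve_left hn, fun hf ho => Φ.flag_ne ?_⟩
  rw [← hf, ← ho]

theorem Frame.Stores.keep (h : Φ.Stores α R m)
    (hc : ∀ t (a : M.D.RepoAttr R t) i, α'.ac (TComp.col a) i = α.ac (TComp.col a) i)
    (ho : ∀ i, α'.ac (TComp.occ (R := R)) i = α.ac (TComp.occ (R := R)) i) : Φ.Stores α' R m := by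
  have ht : Φ.tup α' R = Φ.tup α R := by
    funext i t a; simp only [Frame.tup, hc]
  simpa only [Frame.Stores, Occ, ht, ho] using h

theorem Frame.Stores.insert (h : Φ.Stores α R m) {i₀ : idx R} (hfree : ¬ Occ α R i₀)
    {u : RTuple M.D R} (P : RTuple M.D R → Prop)
    (hnew : Occ α' R i₀) (hu : Φ.tup α' R i₀ = u)
    (hclear : ∀ i, i ≠ i₀ → P (Φ.tup α R i) →
      α'.ac (TComp.occ (R := R)) i = N.cst (s := RSrt.flag) false)
    (hold : ∀ i, i ≠ i₀ → ¬ P (Φ.tup α R i) → Φ.tup α' R i = Φ.tup α R i ∧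
      α'.ac (TComp.occ (R := R)) i = α.ac (TComp.occ (R := R)) i) :
    Φ.Stores α' R (u ::ₘ m.filter fun v => ¬ P v) := by
  obtain ⟨h2, E, hE, rfl⟩ := h
  refine ⟨fun i => ?_, Insert.insert i₀ (E.filter fun i => ¬ P (Φ.tup α R i)), fun i => ?_, ?_⟩
  · by_cases hi : i = i₀
    · exact .inl (hi ▸ hnew)
    · by_cases hP : P (Φ.tup α R i)
      · exact .inr (hclear i hi hP)
      · simpa only [Occ, (hold i hi hP).2] using h2 i
  · by_cases hi : i = i₀
    · simp [hi, hnew]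
    · by_cases hP : P (Φ.tup α R i)
      · have : ¬ Occ α' R i := fun h => Φ.flag_ne (by rw [← hclear i hi hP, ← h])
        simp [hi, hP, this]
      · simp [hi, hP, hE, Occ, (hold i hi hP).2]
  · have hi₀ : i₀ ∉ E.filter fun i => ¬ P (Φ.tup α R i) := by simp [hE, hfree]
    rw [Finset.insert_val_of_notMem hi₀, Multiset.map_cons, hu, Multiset.filter_map,
      Finset.filter_val]
    congr 1
    refine Multiset.map_congr rfl fun i hi => ?_
    simp only [Multiset.mem_filter, Finset.mem_val, hE] at hi
    exact ((hold i (fun h => hfree (h ▸ hi.1)) hi.2).1).symm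

theorem Frame.Stores.erase (h : Φ.Stores α R m) {i₀ : idx R} (hocc : Occ α R i₀)
    (hclear : α'.ac (TComp.occ (R := R)) i₀ = N.cst (s := RSrt.flag) false)
    (hold : ∀ i, i ≠ i₀ → Φ.tup α' R i = Φ.tup α R i ∧
      α'.ac (TComp.occ (R := R)) i = α.ac (TComp.occ (R := R)) i) :
    Φ.Stores α' R (m.erase (Φ.tup α R i₀)) := by
  obtain ⟨h2, E, hE, rfl⟩ := h
  refine ⟨fun i => ?_, E.erase i₀, fun i => ?_, ?_⟩
  · by_cases hi : i = i₀
    · exact .inr (hi ▸ hclear)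
    · simpa only [Occ, (hold i hi).2] using h2 i
  · by_cases hi : i = i₀
    · have : ¬ Occ α' R i := fun h => Φ.flag_ne (by rw [← hclear, ← hi, ← h])
      simpa [hi] using hi ▸ this
    · simp [hi, hE, Occ, (hold i hi).2]
  · rw [← Multiset.map_erase_of_mem _ _ (by simpa [hE] using hocc), ← Finset.erase_val]
    refine Multiset.map_congr rfl fun i hi => ?_
    exact ((hold i (Finset.ne_of_mem_erase hi)).1).symm

theorem Frame.Stores.map (h : Φ.Stores α R m) (g : RTuple M.D R → RTuple M.D R)
    (hc : ∀ i, Occ α R i → Φ.tup α' R i = g (Φ.tup α R i))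
    (ho : ∀ i, α'.ac (TComp.occ (R := R)) i = α.ac (TComp.occ (R := R)) i) :
    Φ.Stores α' R (m.map g) := by
  obtain ⟨h2, E, hE, rfl⟩ := h
  refine ⟨fun i => by simpa only [Occ, ho] using h2 i, E, fun i => by simp [hE, Occ, ho], ?_⟩
  rw [Multiset.map_map]
  refine Multiset.map_congr rfl fun i hi => ?_
  exact (hc i ((hE i).1 hi)).symm

end Arrays

/-! ### Guards and effects -/

section Specs

variable {nv : M.D.Typ → ℕ} {ρ : ∀ s, Fin (liftNv nv s) → N.car s} {η : ∀ E, ℕ → idx E}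
  {j : Fin k} {w : VarVals M.D}

/-- The binding denoted by the values of the variables of basic sort. -/
def Frame.bnd (Φ : Frame M.D N) (ρ : ∀ s, Fin (liftNv nv s) → N.car s) (t : M.D.Typ)
    (x : Fin (nv t)) : M.D.Dom t :=
  Φ.val t (ρ (.data t) x)

/-- The values of the variables of basic sort lie in the sets of the frame. -/
def Frame.MemBnd (Φ : Frame M.D N) (ρ : ∀ s, Fin (liftNv nv s) → N.car s) : Prop :=
  ∀ t (x : Fin (nv t)), ρ (.data t) x ∈ Φ.F t

theorem Frame.eval_trT (hα : Φ.Mem α) (hρ : Φ.MemBnd ρ) (hw : Φ.Vars α j w) {t : M.D.Typ}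
    (u : Term M.D (fun t => Fin (nv t)) t) :
    (trT j u).eval α ρ η ∈ Φ.F t ∧
      Φ.val t ((trT j u).eval α ρ η) = u.eval (Φ.bnd ρ) (Φ.val .case (slf α j)) w :=
  Φ.eval_trTerm hα hw u fun x _ => ⟨hρ t x, rfl⟩

theorem Frame.Rel.valid_iff (h : Φ.Rel α s e) {t : M.D.Typ} {x : N.car (.data t)}
    (hx : x ∈ Φ.F t) : s.Valid Φ.I t (Φ.val t x) ↔
      ∀ ht : t = .case, ht ▸ x = Φ.null .case ∨ ∃ i, ht ▸ x = slf α i := by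
  cases t with
  | val v => simp [Snapshot.Valid]
  | id R => simpa [Snapshot.Valid] using Φ.valid R x hx
  | case =>
    simp only [Snapshot.Valid, Φ.val_eq_undef hx, Option.ne_none_iff_exists', h.cases,
      forall_const]
    constructor
    · rintro (hn | ⟨_, i, -, hi, -⟩)
      · exact .inl hn
      · exact .inr ⟨i, ((Φ.val_eq_iff (h.mem.av _ _) hx).1 hi).symm⟩
    · rintro (hn | ⟨i, rfl⟩)
      · exact .inl hn
      · by_cases hi : slf α i = Φ.null .case
        · exact .inl hi
        · exact .inr ⟨_, i, hi, rfl, rfl⟩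

theorem Frame.Rel.valid_bnd_iff (h : Φ.Rel α s e) (hρ : Φ.MemBnd ρ) :
    (∀ t x, s.Valid Φ.I t (Φ.bnd ρ t x)) ↔
      ∀ x : Fin (nv .case), ρ (.data .case) x = Φ.null .case ∨
        ∃ i, ρ (.data .case) x = slf α i := by
  constructor
  · intro hv x
    exact (h.valid_iff (hρ .case x)).1 (hv .case x) rfl
  · intro hv t x
    refine (h.valid_iff (hρ t x)).2 ?_
    rintro rfl
    exact hv x

theorem Frame.Rel.eval_trGuard (h : Φ.Rel α s e) (hρ : Φ.MemBnd ρ)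
    {G : Guard M.D (fun t => Fin (nv t))} :
    (trGuard j G).eval α ρ η ↔ (∀ t x, s.Valid Φ.I t (Φ.bnd ρ t x)) ∧
      ∃ Q ∈ G, ∀ q ∈ Q.zipIdx, Φ.LitAt α (fun R => η R (q.2 + 2)) (Φ.bnd ρ)
        (Φ.val .case (slf α j)) (e j).vars q.1 := by
  rw [h.valid_bnd_iff hρ, and_comm]
  simp only [trGuard, QF.eval, QF.eval_disj, QF.eval_all, QF.eval_any, QF.eval_or, QF.eval_conj,
    List.mem_map, exists_exists_and_eq_and, forall_exists_index, and_imp,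
    forall_apply_eq_imp_iff₂]
  refine and_congr (Iff.of_eq ?_) Iff.rfl
  refine congrArg _ (funext fun Q => ?_)
  refine congrArg _ (propext (forall_congr' fun q => forall_congr' fun _ => ?_))
  exact Φ.eval_trLit h.mem (h.slot j).cv q.1 fun t x _ => ⟨hρ t x, rfl⟩

theorem Frame.Rel.answers_of_trGuard (h : Φ.Rel α s e) (hρ : Φ.MemBnd ρ)
    {G : Guard M.D (fun t => Fin (nv t))} (hG : (trGuard j G).eval α ρ η) :
    s.Answers Φ.I (Φ.bnd ρ) (Φ.val .case (slf α j)) (e j).vars G := by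
  obtain ⟨hv, Q, hQ, hl⟩ := (h.eval_trGuard hρ).1 hG
  refine ⟨hv, Q, hQ, fun l hl' => ?_⟩
  obtain ⟨i, hi⟩ := List.mem_iff_getElem?.1 hl'
  exact (hl (l, i) (List.mem_zipIdx_iff_getElem?.2 hi)).holds h.repo

theorem Frame.Rel.trGuard_of_answers [∀ R, Nonempty (idx R)] (h : Φ.Rel α s e)
    (hρ : Φ.MemBnd ρ) {G : Guard M.D (fun t => Fin (nv t))}
    (hG : s.Answers Φ.I (Φ.bnd ρ) (Φ.val .case (slf α j)) (e j).vars G) :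
    ∃ η₀ : ∀ R, ℕ → idx R, ∀ η : ∀ R, ℕ → idx R, (∀ R n, η R (n + 2) = η₀ R n) →
      (trGuard j G).eval α ρ η := by
  obtain ⟨hv, Q, hQ, hl⟩ := hG
  choose! o ho using fun l hlQ => Φ.exists_litAt h.repo (hl l hlQ)
  refine ⟨fun R n => (Q[n]?).elim (Classical.arbitrary _) fun l => o l R, fun η hη => ?_⟩
  refine (h.eval_trGuard hρ).2 ⟨hv, Q, hQ, fun q hq => ?_⟩
  have hq' := List.mem_zipIdx_iff_getElem?.1 hq
  have := ho q.1 (List.mem_iff_getElem?.2 ⟨_, hq'⟩)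
  simpa only [hη, hq', Option.elim_some] using this

theorem Frame.eval_trCondUpd (hα : Φ.Mem α) (hρ : Φ.MemBnd ρ) (hw : Φ.Vars α j w)
    {R : M.D.Repo} {t : M.D.Typ} (a : M.D.RepoAttr R t) (i : idx R)
    (U : CondUpd M.D (fun t => Fin (nv t)) R) :
    Φ.val t ((trCondUpd j a U).eval α ρ (upd η R 0 i)) =
      U.eval Φ.I (Φ.bnd ρ) (Φ.val .case (slf α j)) w (Φ.tup α R i) t a := by
  have hf : ∀ t x, (Sum.elim (trVar t) (fun b => tRead (.col b) 0) x :
        RT M k (liftNv nv) (.data t)).eval α ρ (upd η R 0 i) ∈ Φ.F t ∧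
      Φ.val t ((Sum.elim (trVar t) (fun b => tRead (.col b) 0) x :
        RT M k (liftNv nv) (.data t)).eval α ρ (upd η R 0 i)) =
      Sum.elim (Φ.bnd ρ t) (Φ.tup α R i t) x := by
    rintro t (x | b)
    · exact ⟨hρ t x, rfl⟩
    · refine ⟨hα.col _ _ _ _, ?_⟩
      simp only [Sum.elim_inr, tRead, RTm.eval, upd_self, Frame.tup]
  induction U with
  | tuple f => exact (Φ.eval_trTerm hα hw (f t a) fun x _ => hf t x).2
  | ite ψ U₁ U₂ ih₁ ih₂ =>
    have hψ : (QF.disj (ψ.map fun Q => QF.conj (Q.map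
        (trFLit (fun t => Sum.elim (trVar t) fun b => tRead (.col b) 0) j))) :
          FT M k (liftNv nv)).eval α ρ (upd η R 0 i) ↔
        ∃ Q ∈ ψ, ∀ l ∈ Q, FLit.Holds Φ.I (fun t => Sum.elim (Φ.bnd ρ t) (Φ.tup α R i t))
          (Φ.val .case (slf α j)) w l := by
      simp only [QF.eval_disj, QF.eval_conj, List.mem_map, exists_exists_and_eq_and,
        forall_exists_index, and_imp, forall_apply_eq_imp_iff₂]
      refine exists_congr fun Q => and_congr_right fun _ => forall_congr' fun l =>
        forall_congr' fun _ => ?_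
      exact Φ.eval_trFLit hα hw l fun t x _ => hf t x
    simp only [trCondUpd, CTm.eval, CondUpd.eval, hψ]
    split
    exacts [ih₁, ih₂]

/-- The tuple that an effect inserts or deletes satisfies the guard of the effect. -/
theorem Frame.eval_effGuard (hα : Φ.Mem α) (hρ : Φ.MemBnd ρ) (hw : Φ.Vars α j w)
    {R : M.D.Repo} {f : ∀ t, M.D.RepoAttr R t → Term M.D (fun t => Fin (nv t)) t}
    {σ : SetPart M.D (fun t => Fin (nv t))} :
    (effGuard j (.deleteSet R f σ)).eval α ρ η ↔ Occ α R (η R 1) ∧ Φ.tup α R (η R 1) =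
      fun t a => (f t a).eval (Φ.bnd ρ) (Φ.val .case (slf α j)) w := by
  simp only [effGuard, QF.eval]
  rw [Φ.eval_agree_univ hα fun t a => Φ.eval_trT hα hρ hw (f t a)]
  rfl

theorem Frame.ok_of_effGuard (hα : Φ.Mem α) (hρ : Φ.MemBnd ρ) (hw : Φ.Vars α j w)
    {rp : ∀ R, Multiset (RTuple M.D R)} (hs : ∀ R, Φ.Stores α R (rp R))
    {E : Effect M.D (fun t => Fin (nv t))} (hE : (effGuard j E).eval α ρ η) :
    E.Ok rp (Φ.bnd ρ) (Φ.val .case (slf α j)) w := by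
  cases E with
  | deleteSet R f σ => exact ((hs R).mem_iff _).2 ⟨_, (Φ.eval_effGuard hα hρ hw).1 hE⟩
  | _ => trivial

theorem Frame.effGuard_of_ok [∀ R, Infinite (idx R)] (hα : Φ.Mem α) (hρ : Φ.MemBnd ρ)
    (hw : Φ.Vars α j w) {rp : ∀ R, Multiset (RTuple M.D R)} (hs : ∀ R, Φ.Stores α R (rp R))
    {E : Effect M.D (fun t => Fin (nv t))}
    (hE : E.Ok rp (Φ.bnd ρ) (Φ.val .case (slf α j)) w) :
    ∃ o : ∀ R, idx R, ∀ η : ∀ R, ℕ → idx R, (∀ R, η R 1 = o R) →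
      (effGuard j E).eval α ρ η := by
  cases E with
  | insertSet R f σ =>
    have : ∀ R, ∃ i, α.ac (TComp.occ (R := R)) i = N.cst (s := RSrt.flag) false := by
      intro R
      obtain ⟨E, hE, -⟩ := (hs R).2
      obtain ⟨i, hi⟩ := Infinite.exists_notMem_finset E
      exact ⟨i, ((hs R).not_occ_iff i).1 fun h => hi ((hE i).2 h)⟩
    choose o ho using this
    refine ⟨o, fun η hη => ?_⟩
    change α.ac (TComp.occ (R := R)) (η R 1) = _
    rw [hη]
    exact ho R
  | deleteSet R f σ =>
    obtain ⟨i, hi⟩ := ((hs R).mem_iff _).1 hE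
    refine ⟨Function.update (fun R => Classical.arbitrary _) R i, fun η hη => ?_⟩
    rw [Φ.eval_effGuard hα hρ hw, hη, Function.update_self]
    exact hi
  | set σ => exact ⟨fun R => Classical.arbitrary _, fun _ _ => trivial⟩
  | update R U => exact ⟨fun R => Classical.arbitrary _, fun _ _ => trivial⟩

theorem Frame.stores_effect {sem : InsertSem M.D} (hα : Φ.Mem α) (hρ : Φ.MemBnd ρ)
    (hw : Φ.Vars α j w) {rp : ∀ R, Multiset (RTuple M.D R)} (hs : ∀ R, Φ.Stores α R (rp R))
    {E : Effect M.D (fun t => Fin (nv t))} (hE : (effGuard j E).eval α ρ η)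
    (hcol : ∀ R t (a : M.D.RepoAttr R t) i,
      α'.ac (TComp.col a) i = (effCol sem j E a).eval α ρ (upd η R 0 i))
    (hocc : ∀ R i,
      α'.ac (TComp.occ (R := R)) i = (effOcc sem j E R).eval α ρ (upd η R 0 i)) (R' : M.D.Repo) :
    Φ.Stores α' R' (E.outRepo sem Φ.I rp (Φ.bnd ρ) (Φ.val .case (slf α j)) w R') := by
  have hold : ∀ t (a : M.D.RepoAttr R' t) (i : idx R'),
      (tRead (.col a) 0 : RT M k (liftNv nv) (.data t)).eval α ρ (upd η R' 0 i) =
        α.ac (TComp.col a) i := fun t a i => by simp only [tRead, RTm.eval, upd_self]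
  have hold' : ∀ i : idx R',
      (tRead (.occ (R := R')) 0 : RT M k (liftNv nv) .flag).eval α ρ (upd η R' 0 i) =
        α.ac (TComp.occ (R := R')) i := fun i => by simp only [tRead, RTm.eval, upd_self]
  have hieq : ∀ i : idx R', (QF.ieq R' 0 1 : FT M k (liftNv nv)).eval α ρ (upd η R' 0 i) ↔
      i = η R' 1 := fun i => by
    simp only [QF.eval, upd_self]
    rw [upd_of_ne _ _ (by decide)]
  replace hcol := hcol R'
  replace hocc := hocc R'
  cases E with
  | set σ =>
    refine (hs R').keep (fun t a i => ?_) fun i => ?_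
    · rw [hcol]; exact hold t a i
    · rw [hocc]; exact hold' i
  | insertSet R f σ =>
    by_cases hR : R = R'
    · subst hR
      have hfree : ¬ Occ α R (η R 1) := ((hs R).not_occ_iff _).2 hE
      have hg := fun i t a => Φ.eval_trT (η := upd η R 0 i) hα hρ hw (f t a)
      simp only [Effect.outRepo, Function.update_self]
      simp only [effCol, effOcc, dif_pos, if_true] at hcol hocc
      cases sem with
      | multiset =>
        simp only [insertUpd, CTm.eval, hieq, hold, hold'] at hcol hocc
        have := (hs R).insert (α' := α') hfree (fun _ => False)
          (u := fun t a => (f t a).eval (Φ.bnd ρ) (Φ.val .case (slf α j)) w)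
          (by rw [Occ, hocc, if_pos rfl]; rfl)
          (by funext t a; rw [Frame.tup, hcol, if_pos rfl]; exact (hg _ t a).2)
          (fun _ _ h => h.elim)
          (fun i hi _ => ⟨by funext t a; rw [Frame.tup, hcol, if_neg hi]; rfl,
            by rw [hocc, if_neg hi]⟩)
        simpa [InsertSem.insert] using this
      | set K =>
        have hag := fun i => Φ.eval_agree hα (i := 0) (K := K R) (hg i)
        simp only [insertUpd, CTm.eval, hieq, hold, hold', hag, upd_self] at hcol hocc
        refine (hs R).insert (α' := α') hfree
          (fun v => ∀ t, ∀ a ∈ K R t, v t a =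
            (f t a).eval (Φ.bnd ρ) (Φ.val .case (slf α j)) w)
          (by rw [Occ, hocc, if_pos rfl]; rfl)
          (by funext t a; rw [Frame.tup, hcol, if_pos rfl]; exact (hg _ t a).2)
          (fun i hi h => by rw [hocc, if_neg hi, if_pos h]; rfl)
          (fun i hi h => ⟨by funext t a; rw [Frame.tup, hcol, if_neg hi, if_neg h]; rfl,
            by rw [hocc, if_neg hi, if_neg h]⟩)
    · simp only [Effect.outRepo, Function.update_of_ne (Ne.symm hR)]
      refine (hs R').keep (fun t a i => ?_) fun i => ?_
      · rw [hcol, effCol, dif_neg hR]; exact hold t a i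
      · rw [hocc, effOcc, if_neg hR]; exact hold' i
  | deleteSet R f σ =>
    by_cases hR : R = R'
    · subst hR
      simp only [Effect.outRepo, Function.update_self]
      simp only [effCol, effOcc, if_true, CTm.eval, hieq, hold, hold'] at hcol hocc
      obtain ⟨ho, ht⟩ := (Φ.eval_effGuard hα hρ hw).1 hE
      rw [← ht]
      refine (hs R).erase ho (by rw [hocc, if_pos rfl]; rfl) fun i hi =>
        ⟨by funext t a; rw [Frame.tup, hcol, if_neg hi]; rfl, by rw [hocc, if_neg hi]⟩
    · simp only [Effect.outRepo, Function.update_of_ne (Ne.symm hR)]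
      refine (hs R').keep (fun t a i => ?_) fun i => ?_
      · rw [hcol, effCol, if_neg hR]; exact hold t a i
      · rw [hocc, effOcc, if_neg hR]; exact hold' i
  | update R U =>
    by_cases hR : R = R'
    · subst hR
      simp only [Effect.outRepo, Function.update_self]
      refine (hs R).map _ (fun i hi => ?_) fun i => ?_
      · funext t a
        have ho : (occupied R 0 : FT M k (liftNv nv)).eval α ρ (upd η R 0 i) := by
          simp only [occupied, QF.eval, hold']; exact hi
        rw [Frame.tup, hcol]
        simp only [effCol, dif_pos, CTm.eval, ho, if_true]
        exact Φ.eval_trCondUpd hα hρ hw a i U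
      · rw [hocc]; exact hold' i
    · simp only [Effect.outRepo, Function.update_of_ne (Ne.symm hR)]
      refine (hs R').keep (fun t a i => ?_) fun i => ?_
      · rw [hcol, effCol, dif_neg hR]; exact hold t a i
      · rw [hocc]; exact hold' i

end Specs

end Simulation

section Simulation

variable {M : DAB} {k : ℕ} {N : Str (sig M.D)} {idx : M.D.Repo → Type}
  {Φ : Frame M.D N} {α α' : Asg (setting M k) N idx} {s : Snapshot M}
  {e : Fin k → Entry M}

/-! ### Control parts of rules -/

theorem Frame.Rel.eval_ruleGuard (h : Φ.Rel α s e) {nv : RSrt M.D → ℕ}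
    {ρ : ∀ s, Fin (nv s) → N.car s} {η : ∀ E, ℕ → idx E} {j : Fin k} {r : Rule M.D M.Node} :
    (ruleGuard j r : FT M k nv).eval α ρ η ↔ slf α j ≠ Φ.null .case ∧
      (∀ q ∈ r.pre, (e j).life q.1 = q.2) ∧
      ∀ φ ∈ r.cond, φ.Holds (Φ.val .case (slf α j)) (e j).vars := by
  simp only [ruleGuard, QF.eval, QF.eval_conj, QF.eval_ne, List.mem_map, forall_exists_index,
    and_imp, forall_apply_eq_imp_iff₂, Φ.eval_trCond h.mem (h.slot j).cv]
  refine and_congr Iff.rfl (and_congr (forall₂_congr fun q _ => ?_) Iff.rfl)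
  simp only [tVar, tLife, RTm.eval, (h.slot j).life]
  exact ⟨fun h => Φ.life_ne _ _ h, fun h => by rw [h]⟩

/-- Progression of the `j`-th case by a rule, for given new values of the case variables, stored
values and repository. -/
theorem Frame.Rel.progress (h : Φ.Rel α s e) {nv : RSrt M.D → ℕ}
    {ρ : ∀ s, Fin (nv s) → N.car s} {η : ∀ E, ℕ → idx E} {j : Fin k}
    (hj : slf α j ≠ Φ.null .case) {r : Rule M.D M.Node}
    {w : ∀ t, M.D.CVar t → RT M k nv (.data t)}
    {p : M.Node → ∀ t, M.D.CVar t → RT M k nv (.data t)} (hα' : Φ.Mem α')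
    (hv : ∀ s (x : TVar M k s), α'.av x = (ruleVar j r w p x).eval α ρ η)
    {w' : VarVals M.D} {p' : M.Node → VarVals M.D} {rp' : ∀ R, Multiset (RTuple M.D R)}
    (hw : ∀ t x, Φ.val t ((w t x).eval α ρ η) = w' t x)
    (hp : ∀ n t x, Φ.val t ((p n t x).eval α ρ η) = p' n t x)
    (hrp : ∀ R, Φ.Stores α' R (rp' R)) :
    Φ.Rel α' ⟨rp', Function.update s.cases (Φ.val .case (slf α j))
        (some ⟨w', fun n => (r.next n).getD ((e j).life n), p'⟩)⟩
      (Function.update e j ⟨w', fun n => (r.next n).getD ((e j).life n), p'⟩) := by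
  have hself : ∀ i, slf α' i = slf α i := fun i => hv _ (TVar.self i)
  refine ⟨hα', hrp, fun i => ?_, ?_, fun c x => ?_, fun i hi => ?_⟩
  · by_cases hi : i = j
    · subst hi
      rw [Function.update_self]
      refine ⟨fun t x => ?_, fun n => ?_, fun n t x => ?_⟩
      · refine Eq.trans ?_ (hw t x)
        rw [hv _ (TVar.cv i x)]
        simp [ruleVar, CTm.eval]
      · rw [hv _ (TVar.life i n)]
        simp only [ruleVar, CTm.eval, if_true]
        cases r.next n with
        | some l => rfl
        | none => exact (h.slot i).life n
      · refine Eq.trans ?_ (hp n t x)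
        rw [hv _ (TVar.pend i n x)]
        simp [ruleVar, CTm.eval]
    · rw [Function.update_of_ne hi]
      refine ⟨fun t x => ?_, fun n => ?_, fun n t x => ?_⟩
      · rw [hv _ (TVar.cv i x), ← (h.slot i).cv]
        simp [ruleVar, CTm.eval, hi, tVar, RTm.eval]
      · rw [hv _ (TVar.life i n), ← (h.slot i).life]
        simp [ruleVar, CTm.eval, hi, tVar, RTm.eval]
      · rw [hv _ (TVar.pend i n x), ← (h.slot i).pend]
        simp [ruleVar, CTm.eval, hi, tVar, RTm.eval]
  · simpa only [hself] using h.self_inj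
  · simp only [hself]
    by_cases hc : c = Φ.val .case (slf α j)
    · subst hc
      rw [Function.update_self, Option.some_inj]
      constructor
      · rintro rfl
        exact ⟨j, hj, rfl, Function.update_self ..⟩
      · rintro ⟨i, hi, hij, rfl⟩
        obtain rfl := h.self_inj i j hi
          ((Φ.val_eq_iff (h.mem.av _ _) (h.mem.av _ _)).1 hij)
        rw [Function.update_self]
    · rw [Function.update_of_ne hc, h.cases]
      refine exists_congr fun i => and_congr_right fun _ => and_congr_right fun hi => ?_
      have : i ≠ j := by rintro rfl; exact hc hi.symm
      rw [Function.update_of_ne this]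
  · rw [hself] at hi
    have : i ≠ j := by rintro rfl; exact hj hi
    rw [Function.update_of_ne this]
    exact h.fresh i hi

theorem Frame.Rel.stores_keepComp (h : Φ.Rel α s e) {nv : RSrt M.D → ℕ}
    {ρ : ∀ s, Fin (nv s) → N.car s} {η : ∀ E, ℕ → idx E}
    (hc : ∀ R s (a : TComp M.D R s) i,
      α'.ac a i = (keepComp a : CT M k nv s).eval α ρ (upd η R 0 i)) (R : M.D.Repo) :
    Φ.Stores α' R (s.repo R) := by
  have : ∀ s (a : TComp M.D R s) i, α'.ac a i = α.ac a i := fun s a i => by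
    rw [hc]; simp only [keepComp, CTm.eval, tRead, RTm.eval, upd_self]
  exact (h.repo R).keep (fun t a i => this _ _ i) fun i => this _ _ i

theorem Frame.Rel.encard_lt_iff (h : Φ.Rel α s e) :
    {d | s.cases d ≠ none}.encard < k ↔ ∃ j, slf α j = Φ.null .case := by
  have himg : {d | s.cases d ≠ none} =
      (fun j => Φ.val .case (slf α j)) '' {j | slf α j ≠ Φ.null .case} := by
    ext d
    simp only [Set.mem_ofPred_eq, Option.ne_none_iff_exists', h.cases, Set.mem_image]
    exact ⟨fun ⟨_, j, hj, hd, _⟩ => ⟨j, hj, hd⟩, fun ⟨j, hj, hd⟩ => ⟨_, j, hj, hd, rfl⟩⟩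
  have hinj : Set.InjOn (fun j => Φ.val .case (slf α j)) {j | slf α j ≠ Φ.null .case} :=
    fun i hi j _ hij => h.self_inj i j hi ((Φ.val_eq_iff (h.mem.av _ _) (h.mem.av _ _)).1 hij)
  have hk : (Set.univ : Set (Fin k)).encard = k := by simp
  rw [himg, hinj.encard_image]
  constructor
  · intro hlt
    by_contra! hn
    rw [Set.eq_univ_of_forall (s := {j | slf α j ≠ Φ.null .case}) hn, hk] at hlt
    exact lt_irrefl _ hlt
  · rintro ⟨j, hj⟩
    rw [← hk]
    refine Set.Finite.encard_lt_encard (Set.toFinite _) ?_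
    exact (Set.ssubset_univ_iff).2 fun hu => (hu ▸ Set.mem_univ j : j ∈ {j | _ ≠ _}) hj

/-- Creation of the `j`-th case. -/
theorem Frame.Rel.newCase (h : Φ.Rel α s e) {ρ : ∀ s, Fin (newNv M.D s) → N.car s}
    {η : ∀ E, ℕ → idx E} {j : Fin k} {y : N.car (.data .case)}
    (hy : ρ (.data .case) (show Fin 1 from 0) = y) (hyF : y ∈ Φ.F .case)
    (hg : (trNew M k j).guard.eval α ρ η) (hα' : Φ.Mem α')
    (hv : ∀ s (x : TVar M k s), α'.av x = ((trNew M k j).uvar x).eval α ρ η)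
    (hc : ∀ R s (a : TComp M.D R s) i,
      α'.ac a i = ((trNew M k j).ucomp a).eval α ρ (upd η R 0 i)) (sem : InsertSem M.D) :
    Step M k sem Φ.I s
      ⟨s.repo, Function.update s.cases (Φ.val .case y) (some (Entry.fresh M))⟩ ∧
    Φ.Rel α' ⟨s.repo, Function.update s.cases (Φ.val .case y) (some (Entry.fresh M))⟩ e := by
  obtain ⟨hj, hyn, hyi⟩ : slf α j = Φ.null .case ∧ y ≠ Φ.null .case ∧ ∀ i, y ≠ slf α i := by
    obtain ⟨hj, hyn, hyi⟩ := hg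
    rw [QF.eval_all] at hyi
    subst hy
    exact ⟨hj, hyn, hyi⟩
  have hselfj : slf α' j = y := by
    rw [slf, hv _ (TVar.self j), ← hy]
    simp [trNew, CTm.eval, RTm.eval]
  have hself : ∀ i, i ≠ j → slf α' i = slf α i := fun i hi => by
    rw [slf, hv _ (TVar.self i)]
    simp [trNew, CTm.eval, tVar, RTm.eval, hi]
  constructor
  · refine Step.newCase s _ (fun hn => hyn ((Φ.val_eq_undef hyF).1 hn)) ?_
      (h.encard_lt_iff.2 ⟨j, hj⟩)
    rw [Option.eq_none_iff_forall_ne_some]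
    intro x hx
    obtain ⟨i, -, hi, -⟩ := (h.cases _ _).1 hx
    exact hyi i ((Φ.val_eq_iff (h.mem.av _ _) hyF).1 hi).symm
  · refine ⟨hα', h.stores_keepComp hc, fun i => ?_, fun i i' hi hii' => ?_, fun c x => ?_,
      fun i hi => ?_⟩
    · refine ⟨fun t x => ?_, fun n => ?_, fun n t x => ?_⟩
      · rw [← (h.slot i).cv, hv _ (TVar.cv i x)]; rfl
      · rw [← (h.slot i).life, hv _ (TVar.life i n)]; rfl
      · rw [← (h.slot i).pend, hv _ (TVar.pend i n x)]; rfl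
    · by_cases hij : i = j <;> by_cases hij' : i' = j
      · rw [hij, hij']
      · rw [hij, hselfj, hself i' hij'] at hii'
        exact absurd hii' (hyi _)
      · rw [hij', hselfj, hself i hij] at hii'
        exact absurd hii'.symm (hyi _)
      · rw [hself i hij, hself i' hij'] at hii'
        rw [hself i hij] at hi
        exact h.self_inj i i' hi hii'
    · change Function.update s.cases (Φ.val .case y) (some (Entry.fresh M)) c = some x ↔ _
      by_cases hcy : c = Φ.val .case y
      · subst hcy
        rw [Function.update_self, Option.some_inj]
        constructor
        · rintro rfl
          exact ⟨j, by rwa [hselfj], by rw [hselfj], h.fresh j hj⟩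
        · rintro ⟨i, hi, hiy, rfl⟩
          by_cases hij : i = j
          · rw [hij, h.fresh j hj]
          · rw [hself i hij] at hiy
            exact absurd ((Φ.val_eq_iff (h.mem.av _ _) hyF).1 hiy).symm (hyi i)
      · rw [Function.update_of_ne hcy, h.cases]
        refine exists_congr fun i => ?_
        by_cases hij : i = j
        · subst hij
          refine iff_of_false (fun hi => hi.1 hj) fun hi => hcy ?_
          rw [← hi.2.1, hselfj]
        · rw [hself i hij]
    · by_cases hij : i = j
      · rw [hij]; exact h.fresh j hj
      · rw [hself i hij] at hi
        exact h.fresh i hi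

/-! ### Progression, for the four kinds of data parts -/

section Progress

variable {r : Rule M.D M.Node} {j : Fin k} {sem : InsertSem M.D}

theorem Frame.Rel.spec (h : Φ.Rel α s e) (hj : slf α j ≠ Φ.null .case) {A : UpdSpec M.D}
    {ρ : ∀ s, Fin (liftNv A.nv s) → N.car s} {η : ∀ E, ℕ → idx E} (hρ : Φ.MemBnd ρ)
    (hα' : Φ.Mem α') (hg : (effGuard j A.eff).eval α ρ η)
    (hv : ∀ s (x : TVar M k s), α'.av x = (ruleVar j r
        (fun t x => match A.eff.setPart t x with
          | some u => trT j u
          | none => tVar (.cv j x))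
        (fun n _ x => tVar (.pend j n x)) x : CT M k (liftNv A.nv) s).eval α ρ η)
    (hcol : ∀ R t (a : M.D.RepoAttr R t) i,
      α'.ac (TComp.col a) i = (effCol sem j A.eff a).eval α ρ (upd η R 0 i))
    (hocc : ∀ R i,
      α'.ac (TComp.occ (R := R)) i = (effOcc sem j A.eff R).eval α ρ (upd η R 0 i)) :
    ∃ e', Φ.Rel α' ⟨A.eff.outRepo sem Φ.I s.repo (Φ.bnd ρ) (Φ.val .case (slf α j)) (e j).vars,
      Function.update s.cases (Φ.val .case (slf α j))
        (some ⟨A.eff.setPart.apply (Φ.bnd ρ) (Φ.val .case (slf α j)) (e j).vars,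
          fun n => (r.next n).getD ((e j).life n), (e j).pend⟩)⟩ e' := by
  refine ⟨_, h.progress hj hα' hv (fun t x => ?_) (fun n t x => (h.slot j).pend n t x)
    (Φ.stores_effect h.mem hρ (h.slot j).cv h.repo hg hcol hocc)⟩
  simp only [SetPart.apply]
  cases A.eff.setPart t x with
  | some u => exact (Φ.eval_trT h.mem hρ (h.slot j).cv u).2
  | none => exact (h.slot j).cv t x

theorem Frame.Rel.bind (h : Φ.Rel α s e) (hj : slf α j ≠ Φ.null .case) {β : SetSpec M.D}
    {n : M.Node} {ρ : ∀ s, Fin (liftNv β.nv s) → N.car s} {η : ∀ E, ℕ → idx E}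
    (hρ : Φ.MemBnd ρ) (hα' : Φ.Mem α')
    (hv : ∀ s (x : TVar M k s), α'.av x = (ruleVar j r (fun _ x => tVar (.cv j x))
        (fun m t x => match (if m = n then β.set t x else none) with
          | some u => trT j u
          | none => tVar (.pend j m x)) x : CT M k (liftNv β.nv) s).eval α ρ η)
    (hc : ∀ R s (a : TComp M.D R s) i,
      α'.ac a i = (keepComp a : CT M k (liftNv β.nv) s).eval α ρ (upd η R 0 i)) :
    ∃ e', Φ.Rel α' ⟨s.repo, Function.update s.cases (Φ.val .case (slf α j))
        (some ⟨(e j).vars, fun n => (r.next n).getD ((e j).life n),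
          Function.update (e j).pend n (fun t x => match β.set t x with
            | some u => u.eval (Φ.bnd ρ) (Φ.val .case (slf α j)) (e j).vars
            | none => (e j).pend n t x)⟩)⟩ e' := by
  refine ⟨_, h.progress hj hα' hv (fun t x => (h.slot j).cv t x) (fun m t x => ?_)
    (h.stores_keepComp hc)⟩
  by_cases hm : m = n
  · subst hm
    rw [Function.update_self]
    simp only [if_true]
    cases β.set t x with
    | some u => exact (Φ.eval_trT h.mem hρ (h.slot j).cv u).2
    | none => exact (h.slot j).pend m t x
  · rw [Function.update_of_ne hm]
    simp only [if_neg hm]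
    exact (h.slot j).pend m t x

theorem Frame.Rel.commit (h : Φ.Rel α s e) (hj : slf α j ≠ Φ.null .case) {β : SetSpec M.D}
    {n : M.Node} {ρ : ∀ _, Fin 0 → N.car _} {η : ∀ E, ℕ → idx E} (hα' : Φ.Mem α')
    (hv : ∀ s (x : TVar M k s), α'.av x = (ruleVar j r
        (fun t x => if (β.set t x).isSome then tVar (.pend j n x) else tVar (.cv j x))
        (fun m _ x => tVar (.pend j m x)) x : CT M k (fun _ => 0) s).eval α ρ η)
    (hc : ∀ R s (a : TComp M.D R s) i,
      α'.ac a i = (keepComp a : CT M k (fun _ => 0) s).eval α ρ (upd η R 0 i)) :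
    ∃ e', Φ.Rel α' ⟨s.repo, Function.update s.cases (Φ.val .case (slf α j))
        (some ⟨fun t x => if (β.set t x).isSome then (e j).pend n t x else (e j).vars t x,
          fun n => (r.next n).getD ((e j).life n), (e j).pend⟩)⟩ e' := by
  refine ⟨_, h.progress hj hα' hv (fun t x => ?_) (fun n t x => (h.slot j).pend n t x)
    (h.stores_keepComp hc)⟩
  split
  · exact (h.slot j).pend n t x
  · exact (h.slot j).cv t x

theorem Frame.Rel.skip (h : Φ.Rel α s e) (hj : slf α j ≠ Φ.null .case)
    {ρ : ∀ _, Fin 0 → N.car _} {η : ∀ E, ℕ → idx E} (hα' : Φ.Mem α')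
    (hv : ∀ s (x : TVar M k s), α'.av x = (ruleVar j r
        (fun _ x => tVar (.cv j x)) (fun m _ x => tVar (.pend j m x)) x :
        CT M k (fun _ => 0) s).eval α ρ η)
    (hc : ∀ R s (a : TComp M.D R s) i,
      α'.ac a i = (keepComp a : CT M k (fun _ => 0) s).eval α ρ (upd η R 0 i)) :
    ∃ e', Φ.Rel α' ⟨s.repo, Function.update s.cases (Φ.val .case (slf α j))
        (some ⟨(e j).vars, fun n => (r.next n).getD ((e j).life n), (e j).pend⟩)⟩ e' :=
  ⟨_, h.progress hj hα' hv (fun t x => (h.slot j).cv t x) (fun n t x => (h.slot j).pend n t x)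
    (h.stores_keepComp hc)⟩

end Progress

/-! ### The two directions of the simulation -/

theorem mem_toRAS_trans {sem : InsertSem M.D} {τ : Transition (setting M k)} :
    τ ∈ (toRAS M k sem).trans ↔
      (∃ j, trNew M k j = τ) ∨ ∃ j, ∃ r ∈ M.rules, trRule sem j r = τ := by
  change τ ∈ ((List.finRange k).map (trNew M k) ++
    (List.finRange k).flatMap fun j => M.rules.map (trRule sem j) :
      List (Transition (setting M k))) ↔ _
  rw [List.mem_append, List.mem_map, List.mem_flatMap]
  simp only [List.mem_finRange, true_and, List.mem_map]

theorem Frame.Rel.step_of_stepIn {sem : InsertSem M.D} (h : Φ.Rel α s e)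
    {F : ∀ s, Set (N.car s)} (hF : ∀ t, F (.data t) ⊆ Φ.F t)
    (hs : (toRAS M k sem).StepIn F α α') :
    ∃ s' e', Step M k sem Φ.I s s' ∧ Φ.Rel α' s' e' := by
  obtain ⟨hin, τ, hτ, ρ, η, hρ, hg, hv, hc⟩ := hs
  have hα' : Φ.Mem α' := ⟨fun t x => hF t (hin.av _ x), fun R t a i => hF t (hin.ac R _ _ i)⟩
  rcases mem_toRAS_trans.1 hτ with ⟨j, rfl⟩ | ⟨j, r, hr, rfl⟩
  · exact ⟨_, e, h.newCase rfl (hF _ (hρ _ _)) hg hα' hv hc sem⟩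
  · obtain ⟨pre, cond, act, post, reset⟩ := r
    cases act with
    | skip =>
      obtain ⟨hj, hpre, hcond⟩ := h.eval_ruleGuard.1 hg
      obtain ⟨e', he'⟩ := h.skip hj hα' hv hc
      exact ⟨_, e', .progress s _ _ (h.cases_self hj) _ hr hpre hcond _ _ _ ⟨rfl, rfl, rfl⟩, he'⟩
    | spec A =>
      obtain ⟨hg₁, hg₂, hg₃⟩ := hg
      obtain ⟨hj, hpre, hcond⟩ := h.eval_ruleGuard.1 hg₁
      have hρ' : Φ.MemBnd (nv := A.nv) ρ := fun t x => hF t (hρ _ _)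
      obtain ⟨e', he'⟩ := h.spec (A := A) hj hρ' hα' hg₃ hv (fun R t a i => hc R _ (.col a) i)
        (fun R i => hc R _ .occ i)
      refine ⟨_, e', .progress s _ _ (h.cases_self hj) _ hr hpre hcond _ _ _
        ⟨_, h.answers_of_trGuard hρ' hg₂, Effect.apply_iff.2 ⟨?_, rfl, rfl⟩, rfl⟩, he'⟩
      exact Φ.ok_of_effGuard h.mem hρ' (h.slot j).cv h.repo hg₃
    | bind n β =>
      obtain ⟨hg₁, hg₂⟩ := hg
      obtain ⟨hj, hpre, hcond⟩ := h.eval_ruleGuard.1 hg₁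
      have hρ' : Φ.MemBnd (nv := β.nv) ρ := fun t x => hF t (hρ _ _)
      obtain ⟨e', he'⟩ := h.bind (β := β) hj hρ' hα' hv hc
      exact ⟨_, e', .progress s _ _ (h.cases_self hj) _ hr hpre hcond _ _ _
        ⟨_, h.answers_of_trGuard hρ' hg₂, rfl, rfl, rfl⟩, he'⟩
    | commit n β =>
      obtain ⟨hj, hpre, hcond⟩ := h.eval_ruleGuard.1 hg
      obtain ⟨e', he'⟩ := h.commit hj hα' hv hc
      exact ⟨_, e', .progress s _ _ (h.cases_self hj) _ hr hpre hcond _ _ _ ⟨rfl, rfl, rfl⟩, he'⟩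

/-- The values that may be bound to variables; case identifiers are not restricted. -/
def CatInst.Admits {D : DataSchema} (I : CatInst D) : (t : D.Typ) → D.Dom t → Prop
  | .val _, _ => True
  | .id R, x => x = D.undef (.id R) ∨ ∃ q ∈ I.rel R, q.1 = x
  | .case, _ => True

theorem CatInst.admits_of_valid {I : CatInst M.D} {t : M.D.Typ} {x : M.D.Dom t}
    (h : s.Valid I t x) : I.Admits t x := by
  cases t with
  | val v => trivial
  | id R => exact h
  | case => trivial

/-- Every element is in the sets of the frame, and every admissible value is represented. -/
structure Frame.Full {D : DataSchema} {N : Str (sig D)} (Φ : Frame D N) : Prop where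
  mem : ∀ t x, x ∈ Φ.F t
  onto : ∀ t x, Φ.I.Admits t x → ∃ y, Φ.val t y = x

theorem Frame.Full.exists_bnd (hΦ : Φ.Full) {nv : M.D.Typ → ℕ}
    {ρD : ∀ t, Fin (nv t) → M.D.Dom t} (h : ∀ t x, s.Valid Φ.I t (ρD t x)) :
    ∃ ρ : ∀ s, Fin (liftNv nv s) → N.car s, Φ.bnd ρ = ρD := by
  choose y hy using fun t x => hΦ.onto t _ (CatInst.admits_of_valid (h t x))
  refine ⟨fun s => match s with
    | .data t => y t
    | .life => fun x => x.elim0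
    | .flag => fun x => x.elim0, ?_⟩
  funext t x
  exact hy t x

/-- The assignment that results from firing a transition. -/
def Transition.result {A : Setting} {N : Str A.Sg} {idx : A.ASrt → Type} (τ : Transition A)
    (α : Asg A N idx) (ρ : ∀ s, Fin (τ.nv s) → N.car s) (η : ∀ E, ℕ → idx E) : Asg A N idx :=
  ⟨fun x => (τ.uvar x).eval α ρ η, fun {E _} a i => (τ.ucomp a).eval α ρ (upd η E 0 i)⟩

theorem Frame.Rel.exists_step [∀ R, Infinite (idx R)] {sem : InsertSem M.D} (h : Φ.Rel α s e)
    (hΦ : Φ.Full) {s' : Snapshot M} (hs : Step M k sem Φ.I s s') :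
    ∃ α' e', (toRAS M k sem).Step α α' ∧ Φ.Rel α' s' e' := by
  have hmem : ∀ α' : Asg (setting M k) N idx, Φ.Mem α' := fun α' =>
    ⟨fun t x => hΦ.mem _ _, fun R t a i => hΦ.mem _ _⟩
  have hρ : ∀ {nv : M.D.Typ → ℕ} (ρ : ∀ s, Fin (liftNv nv s) → N.car s), Φ.MemBnd ρ :=
    fun ρ t x => hΦ.mem _ _
  cases hs with
  | newCase c hc hfresh hk =>
    obtain ⟨j, hj⟩ := h.encard_lt_iff.1 hk
    obtain ⟨y, rfl⟩ := hΦ.onto .case c trivial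
    let ρ : ∀ s, Fin (newNv M.D s) → N.car s := fun s => match s with
      | .data (.val _) => fun x => x.elim0
      | .data (.id _) => fun x => x.elim0
      | .data .case => fun _ => y
      | .life => fun x => x.elim0
      | .flag => fun x => x.elim0
    let η : ∀ R, ℕ → idx R := fun R _ => Classical.arbitrary _
    have hg : (trNew M k j).guard.eval α ρ η := by
      refine ⟨hj, fun hy => hc ?_, QF.eval_all.2 fun i hy => ?_⟩
      · exact (Φ.val_eq_undef (hΦ.mem _ _)).2 hy
      · have hy : y = slf α i := hy
        subst hy
        by_cases hi : slf α i = Φ.null .case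
        · exact hc ((Φ.val_eq_undef (hΦ.mem _ _)).2 hi)
        · rw [h.cases_self hi] at hfresh
          simp at hfresh
    refine ⟨(trNew M k j).result α ρ η, e, ⟨_, mem_toRAS_trans.2 (.inl ⟨j, rfl⟩), ρ, η, hg,
      fun _ _ => rfl, fun _ _ _ _ => rfl⟩, ?_⟩
    exact (h.newCase (y := y) rfl (hΦ.mem _ _) hg (hmem _) (fun _ _ => rfl)
      (fun _ _ _ _ => rfl) sem).2
  | progress c x he r hr hpre hcond rp' w' p' hact =>
    obtain ⟨j, hj, rfl, rfl⟩ := (h.cases _ _).1 he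
    have hrg : ∀ {nv : RSrt M.D → ℕ} (ρ : ∀ s, Fin (nv s) → N.car s) (η : ∀ E, ℕ → idx E),
        (ruleGuard j r : FT M k nv).eval α ρ η := fun ρ η =>
      h.eval_ruleGuard.2 ⟨hj, hpre, hcond⟩
    have hτ := mem_toRAS_trans (k := k) (sem := sem).2 (.inr ⟨j, r, hr, rfl⟩)
    obtain ⟨pre, cond, act, post, reset⟩ := r
    cases act with
    | skip =>
      obtain ⟨rfl, rfl, rfl⟩ := hact
      let η : ∀ R, ℕ → idx R := fun R _ => Classical.arbitrary _
      let ρ : ∀ s : RSrt M.D, Fin 0 → N.car s := fun _ i => i.elim0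
      obtain ⟨e', he'⟩ := h.skip (α' := Transition.result (trRule sem j
        ⟨pre, cond, .skip, post, reset⟩) α ρ η) (r := ⟨pre, cond, .skip, post, reset⟩) hj (hmem _)
        (fun _ _ => rfl) (fun _ _ _ _ => rfl)
      exact ⟨_, e', ⟨_, hτ, ρ, η, hrg ρ η, fun _ _ => rfl, fun _ _ _ _ => rfl⟩, he'⟩
    | spec A =>
      obtain ⟨ρD, hans, happ, rfl⟩ := hact
      obtain ⟨hok, rfl, rfl⟩ := Effect.apply_iff.1 happ
      obtain ⟨ρ, rfl⟩ := hΦ.exists_bnd hans.1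
      obtain ⟨η₀, hη₀⟩ := h.trGuard_of_answers (hρ ρ) hans
      obtain ⟨o, ho⟩ := Φ.effGuard_of_ok h.mem (hρ ρ) (h.slot j).cv h.repo hok
      let η : ∀ R, ℕ → idx R := fun R n => match n with
        | 0 => o R
        | 1 => o R
        | n + 2 => η₀ R n
      have hg₂ := hη₀ η fun _ _ => rfl
      have hg₃ := ho η fun _ => rfl
      obtain ⟨e', he'⟩ := h.spec (α' := Transition.result (trRule sem j
        ⟨pre, cond, .spec A, post, reset⟩) α ρ η) (r := ⟨pre, cond, .spec A, post, reset⟩)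
        (sem := sem) hj (hρ ρ) (hmem _) hg₃
        (fun _ _ => rfl) (fun _ _ _ _ => rfl) (fun _ _ => rfl)
      exact ⟨_, e', ⟨_, hτ, ρ, η, ⟨hrg ρ η, hg₂, hg₃⟩, fun _ _ => rfl, fun _ _ _ _ => rfl⟩, he'⟩
    | bind n β =>
      obtain ⟨ρD, hans, rfl, rfl, rfl⟩ := hact
      obtain ⟨ρ, rfl⟩ := hΦ.exists_bnd hans.1
      obtain ⟨η₀, hη₀⟩ := h.trGuard_of_answers (hρ ρ) hans
      let η : ∀ R, ℕ → idx R := fun R n => η₀ R (n - 2)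
      have hg₂ := hη₀ η fun _ _ => rfl
      obtain ⟨e', he'⟩ := h.bind (α' := Transition.result (trRule sem j
        ⟨pre, cond, .bind n β, post, reset⟩) α ρ η) (r := ⟨pre, cond, .bind n β, post, reset⟩)
        hj (hρ ρ) (hmem _) (fun _ _ => rfl) (fun _ _ _ _ => rfl)
      exact ⟨_, e', ⟨_, hτ, ρ, η, ⟨hrg ρ η, hg₂⟩, fun _ _ => rfl, fun _ _ _ _ => rfl⟩, he'⟩
    | commit n β =>
      obtain ⟨rfl, rfl, rfl⟩ := hact
      let η : ∀ R, ℕ → idx R := fun R _ => Classical.arbitrary _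
      let ρ : ∀ s : RSrt M.D, Fin 0 → N.car s := fun _ i => i.elim0
      obtain ⟨e', he'⟩ := h.commit (α' := Transition.result (trRule sem j
        ⟨pre, cond, .commit n β, post, reset⟩) α ρ η)
        (r := ⟨pre, cond, .commit n β, post, reset⟩) hj (hmem _)
        (fun _ _ => rfl) (fun _ _ _ _ => rfl)
      exact ⟨_, e', ⟨_, hτ, ρ, η, hrg ρ η, fun _ _ => rfl, fun _ _ _ _ => rfl⟩, he'⟩

/-- Initial assignments represent the empty snapshot. -/
theorem Frame.rel_initial {sem : InsertSem M.D} (hα : (toRAS M k sem).Initial α) :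
    Φ.Rel α (Snapshot.empty M) fun _ => Entry.fresh M := by
  have hav : ∀ t (x : TVar M k (.data t)), α.av x = Φ.null t := fun t x => hα.1 (.data t) x
  have hcol : ∀ R t (a : M.D.RepoAttr R t) i, α.ac (TComp.col a) i = Φ.null t :=
    fun R t a i => hα.2 R (.data t) (.col a) i
  have hocc : ∀ R i, α.ac (TComp.occ (R := R)) i = N.cst (s := RSrt.flag) false :=
    fun R i => hα.2 R .flag .occ i
  refine ⟨⟨fun t x => ?_, fun R t a i => ?_⟩, fun R => ⟨fun i => .inr (hocc R i), ∅, fun i => ?_,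
    rfl⟩, fun j => ⟨fun t x => ?_, fun n => hα.1 .life (.life j n), fun n t x => ?_⟩,
    fun i j hi => absurd (hav _ _) hi, fun c x => ?_, fun _ _ => rfl⟩
  · rw [hav]; exact Φ.null_mem t
  · rw [hcol]; exact Φ.null_mem t
  · have : ¬ Occ α R i := fun h => Φ.flag_ne (by rw [← hocc R i, ← h])
    simp [this]
  · rw [hav]; exact Φ.val_null t
  · rw [hav]; exact Φ.val_null t
  · refine iff_of_false (by simp [Snapshot.empty]) ?_
    rintro ⟨j, hj, -⟩
    exact hj (hav _ _)

end Simulation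

/-! ## Properties -/

section Properties

variable {M : DAB} {k : ℕ} {N : Str (sig M.D)} {idx : M.D.Repo → Type}
  {Φ : Frame M.D N} {α : Asg (setting M k) N idx} {s : Snapshot M}
  {e : Fin k → Entry M} {V : M.D.Typ → Type} {ρD : ∀ t, V t → M.D.Dom t}
  {ρ : ∀ s : RSrt M.D, Fin 0 → N.car s} {η : ∀ E, ℕ → idx E}

/-- The literal holds, and in case of a repository atom, its tuple is stored at the entry `o R`. -/
def Frame.PLitAt (Φ : Frame M.D N) (α : Asg (setting M k) N idx) (o : ∀ R, idx R)
    (ρD : ∀ t, V t → M.D.Dom t) (c : M.D.Dom .case) (x : Entry M) : PLit M V → Prop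
  | .data l => Φ.LitAt α o ρD c x.vars l
  | .leq a b => a.eval x.life = b.eval x.life
  | .lne a b => a.eval x.life ≠ b.eval x.life

theorem Frame.Slot.eval_trLTerm {j : Fin k} {x : Entry M} (h : Φ.Slot α j x) (a : LTerm M) :
    (trLTerm j a).eval α ρ η = N.cst (s := RSrt.life) (a.eval x.life) := by
  cases a with
  | block n => exact h.life n
  | const l => rfl

theorem Frame.Rel.eval_trPLit (h : Φ.Rel α s e) {j : Fin k} {i : ℕ}
    {f : ∀ t, V t → RT M k (fun _ => 0) (.data t)} (l : PLit M V)
    (hf : ∀ t x, PLit.Mentions x l → (f t x).eval α ρ η ∈ Φ.F t ∧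
      Φ.val t ((f t x).eval α ρ η) = ρD t x) :
    (trPLit f j i l).eval α ρ η ↔
      Φ.PLitAt α (fun R => η R i) ρD (Φ.val .case (slf α j)) (e j) l := by
  have hlife : ∀ l l' : Life,
      N.cst (s := RSrt.life) l = N.cst (s := RSrt.life) l' ↔ l = l' := fun l l' =>
    ⟨Φ.life_ne l l', fun h => by rw [h]⟩
  cases l with
  | data l => exact Φ.eval_trLit h.mem (h.slot j).cv l hf
  | leq a b =>
    simp only [trPLit, QF.eval, Frame.PLitAt, (h.slot j).eval_trLTerm]
    exact hlife _ _
  | lne a b =>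
    simp only [trPLit, QF.eval_ne, Frame.PLitAt, (h.slot j).eval_trLTerm]
    exact (hlife _ _).not

theorem Frame.PLitAt.holds {o : ∀ R, idx R} {c : M.D.Dom .case} {x : Entry M} {l : PLit M V}
    (hs : ∀ R, Φ.Stores α R (s.repo R)) (h : Φ.PLitAt α o ρD c x l) :
    l.Holds Φ.I s ρD c x := by
  cases l with
  | data l => exact Frame.LitAt.holds hs h
  | leq a b => exact h
  | lne a b => exact h

theorem Frame.exists_plitAt [∀ R, Nonempty (idx R)] {c : M.D.Dom .case} {x : Entry M}
    {l : PLit M V} (hs : ∀ R, Φ.Stores α R (s.repo R)) (h : l.Holds Φ.I s ρD c x) :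
    ∃ o : ∀ R, idx R, Φ.PLitAt α o ρD c x l := by
  cases l with
  | data l => exact Φ.exists_litAt hs h
  | leq a b => exact ⟨fun R => Classical.arbitrary _, h⟩
  | lne a b => exact ⟨fun R => Classical.arbitrary _, h⟩

theorem Frame.eval_defTerm_mem (hα : Φ.Mem α) {t : M.D.Typ} (x : V t) (L : List (ℕ × PLit M V)) :
    (defTerm x L : RT M k (fun _ => 0) (.data t)).eval α ρ η ∈ Φ.F t := by
  fun_induction defTerm (k := k) x L with
  | case1 => exact Φ.null_mem t
  | case2 => exact hα.col _ _ _ _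
  | case3 _ _ _ _ _ ih => exact ih
  | case4 _ _ _ ih => exact ih

/-- If the repository atoms hold, the definition of a variable that occurs in one of them has the
value of this variable. -/
theorem Frame.val_eval_defTerm {t : M.D.Typ} {x : V t} {L : List (ℕ × PLit M V)}
    (hL : ∀ p ∈ L, ∀ R f, p.2 = .data (.repo R f) → ∀ a, f t a = .var x →
      Φ.tup α R (η R p.1) t a = ρD t x)
    (hx : ∃ p ∈ L, PLit.InRepo x p.2) :
    Φ.val t ((defTerm x L : RT M k (fun _ => 0) (.data t)).eval α ρ η) = ρD t x := by
  fun_induction defTerm (k := k) x L with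
  | case1 => simp at hx
  | case2 i R f L h => exact hL _ List.mem_cons_self R f rfl _ h.choose_spec
  | case3 i R f L h ih =>
    refine ih (fun p hp => hL p (List.mem_cons_of_mem _ hp)) ?_
    obtain ⟨p, hp, hxp⟩ := hx
    rcases List.mem_cons.1 hp with rfl | hp
    · exact absurd hxp h
    · exact ⟨p, hp, hxp⟩
  | case4 q L hq ih =>
    refine ih (fun p hp => hL p (List.mem_cons_of_mem _ hp)) ?_
    obtain ⟨p, hp, hxp⟩ := hx
    rcases List.mem_cons.1 hp with rfl | hp
    · obtain ⟨i, l⟩ := p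
      rcases l with (l | ⟨R, f⟩) | _ | _
      · exact hxp.elim
      · exact (hq i R f rfl).elim
      · exact hxp.elim
      · exact hxp.elim
    · exact ⟨p, hp, hxp⟩

theorem Property.mem_lits {υ : Property M} {ch : ∀ i, Fin (υ.G i).length} {i : Fin υ.n}
    {q : ℕ × PLit M (fun t => Fin (υ.nv t))} :
    q ∈ υ.lits ch i ↔ ∃ m, ((υ.G i).get (ch i))[m]? = some q.2 ∧ q.1 = Nat.pair i m := by
  obtain ⟨n, l⟩ := q
  simp only [Property.lits, List.mem_map, Prod.exists, List.mem_zipIdx_iff_getElem?, Prod.mk.injEq]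
  constructor
  · rintro ⟨l', m, h, rfl, rfl⟩
    exact ⟨m, h, rfl⟩
  · rintro ⟨m, h, rfl⟩
    exact ⟨l, m, h, rfl, rfl⟩

theorem holds_trProperty (υ : Property M) :
    StateFm.Holds α (trProperty k υ) ↔
      ∃ (η : ∀ E, ℕ → idx E) (π : Fin υ.n ↪ Fin k) (ch : ∀ i, Fin (υ.G i).length), ∀ i,
        α.av (TVar.self (π i)) ≠ N.cst (s := RSrt.data .case) (cUndef M.D .case) ∧
        ∀ q ∈ υ.lits ch i, (trPLit (fun _ x => defTerm x
          ((List.finRange υ.n).flatMap (υ.lits ch))) (π i) q.1 q.2).eval α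
            (fun _ i => i.elim0) η := by
  unfold StateFm.Holds trProperty
  refine exists_congr fun η => ?_
  rw [QF.eval_any]
  refine exists_congr fun π => ?_
  rw [QF.eval_any]
  refine exists_congr fun ch => ?_
  rw [QF.eval_all]
  refine forall_congr' fun i => and_congr Iff.rfl ?_
  rw [QF.eval_conj]
  simp only [List.mem_map, forall_exists_index, and_imp, forall_apply_eq_imp_iff₂]

/-- An assignment satisfies the translation of a property iff the snapshot that it represents
satisfies the property. -/
theorem Frame.Rel.holds_property [∀ R, Nonempty (idx R)] (h : Φ.Rel α s e) (υ : Property M) :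
    StateFm.Holds α (trProperty k υ) ↔ υ.Holds Φ.I s := by
  rw [holds_trProperty]
  constructor
  · rintro ⟨η, π, ch, hπ⟩
    refine ⟨fun i => Φ.val .case (slf α (π i)), fun i => e (π i), fun t x => Φ.val t
      ((defTerm x ((List.finRange υ.n).flatMap (υ.lits ch)) :
        RT M k (fun _ => 0) (.data t)).eval α (fun _ i => i.elim0) η), ?_,
      fun i => h.cases_self (hπ i).1, fun i => ⟨_, List.get_mem _ (ch i), fun l hl => ?_⟩⟩
    · intro i i' hii'
      exact π.injective (h.self_inj _ _ (hπ i).1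
        ((Φ.val_eq_iff (h.mem.av _ _) (h.mem.av _ _)).1 hii'))
    · obtain ⟨m, hm⟩ := List.mem_iff_getElem?.1 hl
      exact ((h.eval_trPLit l fun t x _ => ⟨Φ.eval_defTerm_mem (V := fun t => Fin (υ.nv t)) h.mem x _, rfl⟩).1
        ((hπ i).2 (Nat.pair i m, l) (Property.mem_lits.2 ⟨m, hm, rfl⟩))).holds h.repo
  · rintro ⟨c, x, ρD, hc, hx, hG⟩
    choose Q hQ hl using hG
    choose π hπ hπc hπx using fun i => (h.cases _ _).1 (hx i)
    choose ch hch using fun i => List.get_of_mem (hQ i)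
    choose! o ho using fun i l hlQ => Φ.exists_plitAt h.repo (hl i l hlQ)
    let η : ∀ R, ℕ → idx R := fun R n =>
      if hn : (Nat.unpair n).1 < υ.n then
        ((Q ⟨_, hn⟩)[(Nat.unpair n).2]?).elim (Classical.arbitrary _) fun l => o ⟨_, hn⟩ l R
      else Classical.arbitrary _
    have hη : ∀ (i : Fin υ.n) m l, (Q i)[m]? = some l → (fun R => η R (Nat.pair i m)) = o i l := by
      intro i m l hm
      funext R
      simp only [η, Nat.unpair_pair, Fin.is_lt, dif_pos, Fin.eta, hm, Option.elim_some]
    have hat : ∀ i, ∀ q ∈ υ.lits ch i, q.2 ∈ Q i ∧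
        Φ.PLitAt α (fun R => η R q.1) ρD (c i) (x i) q.2 := by
      intro i q hq
      obtain ⟨m, hm, hqm⟩ := Property.mem_lits.1 hq
      rw [hch] at hm
      have hmem := List.mem_iff_getElem?.2 ⟨m, hm⟩
      rw [hqm, hη i m _ hm]
      exact ⟨hmem, ho i _ hmem⟩
    have hdef : ∀ i, ∀ q ∈ υ.lits ch i, ∀ t (z : Fin (υ.nv t)), PLit.Mentions z q.2 →
        Φ.val t ((defTerm z ((List.finRange υ.n).flatMap (υ.lits ch)) :
          RT M k (fun _ => 0) (.data t)).eval α (fun _ i => i.elim0) η) = ρD t z := by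
      intro i q hq t z hz
      refine Φ.val_eval_defTerm ?_ ?_
      · intro p hp R f hpf a ha
        obtain ⟨i', -, hp⟩ := List.mem_flatMap.1 hp
        have := (hat i' p hp).2
        rw [hpf] at this
        rw [this.2]
        change (f t a).eval ρD _ _ = ρD t z
        rw [ha]
        rfl
      · obtain ⟨l, hlQ, hzl⟩ := υ.repoBound i (Q i) (hQ i) t z ⟨_, (hat i q hq).1, hz⟩
        obtain ⟨m, hm⟩ := List.mem_iff_getElem?.1 hlQ
        rw [← hch] at hm
        exact ⟨(Nat.pair i m, l), List.mem_flatMap.2 ⟨i, List.mem_finRange i,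
          Property.mem_lits.2 ⟨m, hm, rfl⟩⟩, hzl⟩
    refine ⟨η, ⟨π, fun i i' hii' => hc ?_⟩, ch, fun i => ⟨hπ i, fun q hq => ?_⟩⟩
    · rw [← hπc, ← hπc, hii']
    · refine (h.eval_trPLit (ρD := ρD) q.2 fun t z hz =>
        ⟨Φ.eval_defTerm_mem (V := fun t => Fin (υ.nv t)) h.mem z _, hdef i q hq t z hz⟩).2 ?_
      have := (hat i q hq).2
      rw [← hπc, ← hπx] at this
      exact this

end Properties

/-! ## Models of the database theory -/

theorem Fm.eval_or {S : Sig} {N : Str S} {φ ψ : Fm S} {v : ∀ s, ℕ → N.car s} :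
    (Fm.or φ ψ).eval N v ↔ φ.eval N v ∨ ψ.eval N v := by
  simp only [Fm.or, Fm.eval]; tauto

theorem Fm.eval_iff {S : Sig} {N : Str S} {φ ψ : Fm S} {v : ∀ s, ℕ → N.car s} :
    (Fm.iff φ ψ).eval N v ↔ (φ.eval N v ↔ ψ.eval N v) := by
  simp only [Fm.iff, Fm.eval_or, Fm.eval]; tauto

theorem Fm.eval_any {S : Sig} {N : Str S} {ι : Type} [Finite ι] {f : ι → Fm S}
    {v : ∀ s, ℕ → N.car s} : (Fm.any f).eval N v ↔ ∃ i, (f i).eval N v := by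
  have H : ∀ l : List (Fm S), (l.foldr Fm.or (.neg .tt)).eval N v ↔ ∃ φ ∈ l, φ.eval N v := by
    intro l
    induction l with
    | nil => simp [Fm.eval]
    | cons φ l ih => rw [List.exists_mem_cons_iff, ← ih]; exact Fm.eval_or
  rw [Fm.any, H]
  simp

section Models

variable {D : DataSchema} {N : Str (sig D)}

theorem exists_valuation {S : Sig} (N : Str S) (s : S.Srt) (x : N.car s) :
    ∃ v : ∀ s, ℕ → N.car s, v s 0 = x := by
  have := N.ne
  exact ⟨upd (fun s _ => Classical.arbitrary _) s 0 x, upd_self _ _ _ _⟩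

theorem Str.Models.null_iff (hN : N.Models {φ | DBAxiom D φ}) {R : D.Cat} {t : D.Typ}
    (f : RFn D (.data (.id R)) (.data t)) (x : N.car (.data (.id R))) :
    x = N.cst (s := RSrt.data (.id R)) (cUndef D (.id R)) ↔
      N.fn (s := RSrt.data (.id R)) (t := RSrt.data t) f x =
        N.cst (s := RSrt.data t) (cUndef D t) := by
  obtain ⟨v, rfl⟩ := exists_valuation N _ x
  exact Fm.eval_iff.1 (hN _ (DBAxiom.null f) v)

theorem Str.Models.cst_eq_iff (hN : N.Models {φ | DBAxiom D φ}) {s : RSrt D} (c d : RCst D s) :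
    N.cst (s := s) c = N.cst (s := s) d ↔ c.den = d.den := by
  have := N.ne
  let v : ∀ s, ℕ → N.car s := fun s _ => Classical.arbitrary _
  by_cases h : c.den = d.den
  · exact iff_of_true (hN _ (DBAxiom.same c d h) v) h
  · exact iff_of_false (hN _ (DBAxiom.diff c d h) v) h

theorem Str.Models.closed (hN : N.Models {φ | DBAxiom D φ}) {v : D.Val}
    (h : Finite (D.Dom (.val v))) (x : N.car (.data (.val v))) :
    ∃ c : RCst D (.data (.val v)), N.cst (s := RSrt.data (.val v)) c = x := by
  obtain ⟨w, rfl⟩ := exists_valuation N _ x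
  obtain ⟨c, hc⟩ := Fm.eval_any.1 (hN _ (DBAxiom.closed v h) w)
  exact ⟨c, hc.symm⟩

end Models

/-! ### The structure of a catalog instance -/

namespace CatInst

variable {D : DataSchema} (I : CatInst D)

theorem admits_undef (t : D.Typ) : I.Admits t (D.undef t) := by
  cases t with
  | id R => exact .inl rfl
  | _ => trivial

theorem admits_den (t : D.Typ) (c : RCst D (.data t)) : I.Admits t c.den := by
  cases t with
  | id R =>
    rcases c with _ | c
    · exact .inl rfl
    · exact I.const_mem R c
  | _ => trivial

theorem admits_attr {R : D.Cat} {q : D.Dom (.id R) × CTuple D R} (hq : q ∈ I.rel R) (t : D.Typ)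
    (a : D.CatAttr R t) : I.Admits t (q.2 t a) := by
  cases t with
  | id R' => exact .inr (I.fk R q hq R' a)
  | _ => trivial

/-- The carriers of the structure of a catalog instance. -/
def Car : RSrt D → Type
  | .data t => {x : D.Dom t // I.Admits t x}
  | .life => Life
  | .flag => Bool

/-- The value of an attribute. -/
def attr {R : D.Cat} {t : D.Typ} (a : D.CatAttr R t) (x : {x : D.Dom (.id R) // I.Admits _ x}) :
    {x : D.Dom t // I.Admits t x} :=
  if h : ∃ q ∈ I.rel R, q.1 = x.1 then ⟨h.choose.2 t a, I.admits_attr h.choose_spec.1 t a⟩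
  else ⟨D.undef t, I.admits_undef t⟩

/-- The structure of a catalog instance: its identifiers, and all objects of the other types. -/
def str : Str (sig D) where
  car := I.Car
  ne := fun s => match s with
    | .data t => ⟨⟨D.undef t, I.admits_undef t⟩⟩
    | .life => ⟨Life.idle⟩
    | .flag => ⟨true⟩
  fn := fun {s t} f x => match s, t, f, x with
    | .data (.id _), .data _, a, x => I.attr a x
    | .data (.id _), .life, f, _ => nomatch (show Empty from f)
    | .data (.id _), .flag, f, _ => nomatch (show Empty from f)
    | .data (.val _), _, f, _ => nomatch (show Empty from f)
    | .data .case, _, f, _ => nomatch (show Empty from f)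
    | .life, _, f, _ => nomatch (show Empty from f)
    | .flag, _, f, _ => nomatch (show Empty from f)
  cst := fun {s} c => match s, c with
    | .data t, c => ⟨RCst.den (D := D) (s := .data t) c, I.admits_den t c⟩
    | .life, l => l
    | .flag, b => b

theorem attr_of_mem {R : D.Cat} {q : D.Dom (.id R) × CTuple D R} (hq : q ∈ I.rel R) {t : D.Typ}
    (a : D.CatAttr R t) (x : {x : D.Dom (.id R) // I.Admits _ x}) (hx : q.1 = x.1) :
    (I.attr a x).1 = q.2 t a := by
  have h : ∃ q ∈ I.rel R, q.1 = x.1 := ⟨q, hq, hx⟩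
  rw [attr, dif_pos h]
  change h.choose.2 t a = q.2 t a
  rw [I.pk R _ h.choose_spec.1 q hq (h.choose_spec.2.trans hx.symm)]

theorem attr_undef {R : D.Cat} {t : D.Typ} (a : D.CatAttr R t)
    (x : {x : D.Dom (.id R) // I.Admits _ x}) (hx : x.1 = D.undef _) :
    (I.attr a x).1 = D.undef t := by
  rw [attr, dif_neg]
  rintro ⟨q, hq, hqx⟩
  exact I.key_ne R q hq (hqx.trans hx)

theorem str_cst_eq_iff {s : RSrt D} (c d : RCst D s) :
    I.str.cst (s := s) c = I.str.cst (s := s) d ↔ c.den = d.den := by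
  rcases s with t | _ | _
  · exact Subtype.ext_iff
  · exact Iff.rfl
  · exact Iff.rfl

theorem str_models : I.str.Models {φ | DBAxiom D φ} := by
  intro φ hφ v
  cases hφ with
  | @null R t f =>
    rw [Fm.eval_iff]
    change v (.data (.id R)) 0 = _ ↔ I.attr f (v (.data (.id R)) 0) = _
    generalize v (.data (.id R)) 0 = x
    refine Iff.trans Subtype.ext_iff (Iff.trans ?_ Subtype.ext_iff.symm)
    change x.1 = D.undef _ ↔ (I.attr f x).1 = D.undef _
    refine ⟨I.attr_undef f x, fun h => ?_⟩
    rcases x.2 with hx | ⟨q, hq, hx⟩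
    · exact hx
    · rw [I.attr_of_mem hq f x hx] at h
      exact absurd h (I.attr_ne R q hq t f)
  | same c d h => exact (I.str_cst_eq_iff c d).2 h
  | diff c d h => exact fun h' => h ((I.str_cst_eq_iff c d).1 h')
  | closed w h =>
    rw [Fm.eval_any]
    change ∃ c : RCst D (.data (.val w)), v (.data (.val w)) 0 = _
    generalize v (.data (.val w)) 0 = x
    rcases D.val_enum w h x.1 with hx | ⟨c, hx⟩
    · exact ⟨(none : Option _), Subtype.ext hx⟩
    · exact ⟨some c, Subtype.ext hx.symm⟩

/-- The frame of a catalog instance. -/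
def frame : Frame D I.str where
  I := I
  F := fun _ => Set.univ
  val := fun t x => Subtype.val (show {x : D.Dom t // I.Admits t x} from x)
  inj := fun _ => Subtype.val_injective.injOn
  cst_mem := fun _ _ => Set.mem_univ _
  val_cst := fun _ _ => rfl
  cat := fun R x _ y _ => by
    constructor
    · intro h
      refine ⟨fun hx => I.key_ne R _ h (congrArg Subtype.val hx), fun t a => Subtype.ext ?_⟩
      exact (I.attr_of_mem h a x rfl).symm
    · rintro ⟨hx, hy⟩
      rcases x.2 with h | ⟨q, hq, h⟩
      · exact absurd (Subtype.ext h) hx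
      · refine (Prod.ext h.symm (funext fun t => funext fun a => ?_) :
          ((x.1, fun t a => (y t a).1) : D.Dom (.id R) × CTuple D R) = q) ▸ hq
        change (y t a).1 = q.2 t a
        rw [hy t a]
        exact I.attr_of_mem hq a x h
  valid := fun _ x _ => x.2
  life_ne := fun _ _ h => h
  flag_ne := Bool.noConfusion

theorem frame_full : I.frame.Full := ⟨fun _ _ => Set.mem_univ _, fun _ x hx => ⟨⟨x, hx⟩, rfl⟩⟩

end CatInst

/-! ### A finite catalog instance for finitely many elements of a model -/

theorem exists_injOn_extension {X Y C : Type} [Finite C] {S : Set X} (hS : S.Finite) (p : C → X)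
    (q : C → Y) (hpq : ∀ c d, p c = p d ↔ q c = q d) (h : Infinite Y ∨ ∀ x, ∃ c, p c = x) :
    ∃ g : X → Y, Set.InjOn g S ∧ ∀ c, g (p c) = q c := by
  have hg : ∀ x, (∃ c, p c = x) → ∃ y, ∀ c, p c = x → q c = y := by
    rintro _ ⟨c, rfl⟩
    exact ⟨q c, fun d hd => (hpq d c).1 hd⟩
  rcases h with h | h
  · have hinf : ((Set.range q)ᶜ : Set Y).Infinite := (Set.finite_range q).infinite_compl
    have := hinf.to_subtype
    have := hS.to_subtype
    obtain ⟨n, ⟨f⟩⟩ := Finite.exists_equiv_fin S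
    let g₀ : S → ((Set.range q)ᶜ : Set Y) := fun x => Infinite.natEmbedding _ (f x)
    have hg₀ : Function.Injective g₀ :=
      (Infinite.natEmbedding _).injective.comp (Fin.val_injective.comp f.injective)
    obtain ⟨y₀⟩ : Nonempty Y := inferInstance
    let g : X → Y := fun x => if hx : ∃ c, p c = x then (hg x hx).choose
      else if hxS : x ∈ S then g₀ ⟨x, hxS⟩ else y₀
    have hgp : ∀ c, g (p c) = q c := fun c => by
      have hx : ∃ d, p d = p c := ⟨c, rfl⟩
      simp only [g, dif_pos hx]
      exact ((hg _ hx).choose_spec c rfl).symm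
    have hgn : ∀ x (hx : ¬ ∃ c, p c = x) (hxS : x ∈ S), g x = g₀ ⟨x, hxS⟩ := fun x hx hxS => by
      simp only [g, dif_neg hx, dif_pos hxS]
    refine ⟨g, fun x hx y hy hxy => ?_, hgp⟩
    by_cases hcx : ∃ c, p c = x <;> by_cases hcy : ∃ c, p c = y
    · obtain ⟨c, rfl⟩ := hcx
      obtain ⟨d, rfl⟩ := hcy
      rw [hgp, hgp] at hxy
      exact (hpq c d).2 hxy
    · obtain ⟨c, rfl⟩ := hcx
      rw [hgp, hgn y hcy hy] at hxy
      exact absurd ⟨c, hxy⟩ (g₀ ⟨y, hy⟩).2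
    · obtain ⟨d, rfl⟩ := hcy
      rw [hgp, hgn x hcx hx] at hxy
      exact absurd ⟨d, hxy.symm⟩ (g₀ ⟨x, hx⟩).2
    · rw [hgn x hcx hx, hgn y hcy hy] at hxy
      exact congrArg Subtype.val (hg₀ (Subtype.ext hxy))
  · choose g hg' using fun x => hg x (h x)
    refine ⟨g, fun x _ y _ hxy => ?_, fun c => (hg' _ c rfl).symm⟩
    obtain ⟨c, rfl⟩ := h x
    obtain ⟨d, rfl⟩ := h y
    rw [← hg' _ c rfl, ← hg' _ d rfl] at hxy
    exact (hpq c d).2 hxy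

/-- Finitely many elements of a model of the database theory can be represented in a finite
catalog instance. The attributes of the given elements are kept; those of all other elements
are replaced by fixed representatives of the sorts. -/
theorem exists_frame {D : DataSchema} {N : Str (sig D)} (hN : N.Models {φ | DBAxiom D φ})
    (F₀ : ∀ t : D.Typ, Set (N.car (.data t))) (hF₀ : ∀ t, (F₀ t).Finite) :
    ∃ Φ : Frame D N, ∀ t, F₀ t ⊆ Φ.F t := by
  let null : ∀ t : D.Typ, N.car (.data t) := fun t => N.cst (s := RSrt.data t) (cUndef D t)
  let fn : ∀ {R : D.Cat} {t : D.Typ}, D.CatAttr R t → N.car (.data (.id R)) → N.car (.data t) :=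
    fun {R t} a x => N.fn (s := RSrt.data (.id R)) (t := RSrt.data t)
      (show RFn D (.data (.id R)) (.data t) from a) x
  have hnull : ∀ {R : D.Cat} {t : D.Typ} (a : D.CatAttr R t) x,
      x = null (.id R) ↔ fn a x = null t := fun a x => hN.null_iff a x
  have hrep : ∀ t : D.Typ, ∃ z : N.car (.data t), ∀ y : N.car (.data t), y ≠ null t →
      z ≠ null t := fun t => by
    by_cases h : ∃ y : N.car (.data t), y ≠ null t
    · exact ⟨h.choose, fun _ _ => h.choose_spec⟩
    · exact ⟨null t, fun y hy => absurd ⟨y, hy⟩ h⟩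
  choose rep hrep using hrep
  let F : ∀ t : D.Typ, Set (N.car (.data t)) := fun t =>
    F₀ t ∪ Set.range fun c : RCst D (.data t) => N.cst (s := RSrt.data t) c
  have hF : ∀ t, (F t).Finite := fun t => (hF₀ t).union (Set.finite_range _)
  have hcst : ∀ t (c : RCst D (.data t)), N.cst (s := RSrt.data t) c ∈ F t := fun t c =>
    .inr ⟨c, rfl⟩
  let G : ∀ t : D.Typ, Set (N.car (.data t)) := fun t =>
    F t ∪ {rep t} ∪ ⋃ R, ⋃ a : D.CatAttr R t, fn a '' F (.id R)
  have hG : ∀ t, (G t).Finite := fun t => ((hF t).union (Set.finite_singleton _)).union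
    (Set.finite_iUnion fun R => Set.finite_iUnion fun a => (hF _).image _)
  have hFG : ∀ t, F t ⊆ G t := fun t x hx => .inl (.inl hx)
  have hinf : ∀ t : D.Typ, Infinite (D.Dom t) ∨ ∀ x : N.car (.data t),
      ∃ c : RCst D (.data t), N.cst (s := RSrt.data t) c = x := by
    rintro (v | R | _)
    · rcases finite_or_infinite (D.Dom (.val v)) with h | h
      · exact .inr (hN.closed h)
      · exact .inl h
    · exact .inl (D.id_infinite R)
    · exact .inl D.case_infinite
  choose val hinj hval using fun t : D.Typ => exists_injOn_extension (hG t)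
    (fun c : RCst D (.data t) => N.cst (s := RSrt.data t) c) (fun c => (RCst.den c : D.Dom t))
    (fun c d => hN.cst_eq_iff c d) (hinf t)
  let fn' : ∀ {R : D.Cat} {t : D.Typ}, D.CatAttr R t → N.car (.data (.id R)) →
      N.car (.data t) := fun {R t} a x => if x ∈ F (.id R) then fn a x else rep t
  have hfn'F : ∀ {R : D.Cat} {t : D.Typ} (a : D.CatAttr R t) x, x ∈ F (.id R) →
      fn' a x = fn a x := fun a x hx => if_pos hx
  have hfn'G : ∀ {R : D.Cat} {t : D.Typ} (a : D.CatAttr R t) x, fn' a x ∈ G t := by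
    intro R t a x
    by_cases hx : x ∈ F (.id R)
    · rw [hfn'F a x hx]
      exact .inr (Set.mem_iUnion.2 ⟨R, Set.mem_iUnion.2 ⟨a, x, hx, rfl⟩⟩)
    · simp only [fn', if_neg hx]
      exact .inl (.inr rfl)
  have hfn'n : ∀ {R : D.Cat} {t : D.Typ} (a : D.CatAttr R t) x, x ≠ null (.id R) →
      fn' a x ≠ null t := by
    intro R t a x hx
    have hfx : fn a x ≠ null t := fun h => hx ((hnull a x).2 h)
    by_cases hxF : x ∈ F (.id R)
    · rwa [hfn'F a x hxF]
    · simp only [fn', if_neg hxF]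
      exact hrep t _ hfx
  have hvaln : ∀ t x, x ∈ G t → x ≠ null t → val t x ≠ D.undef t := by
    intro t x hx hxn h
    rw [show D.undef t = val t (null t) from (hval t (cUndef D t)).symm] at h
    exact hxn (hinj t hx (hFG t (hcst t _)) h)
  let tupl : ∀ R : D.Cat, N.car (.data (.id R)) → D.Dom (.id R) × CTuple D R := fun R x =>
    (val (.id R) x, fun t a => val t (fn' a x))
  let I : CatInst D :=
    { rel := fun R => tupl R '' {x | x ∈ G (.id R) ∧ x ≠ null (.id R)}
      finite := fun R => ((hG (.id R)).subset fun x hx => hx.1).image _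
      key_ne := by
        rintro R _ ⟨x, hx, rfl⟩
        exact hvaln _ x hx.1 hx.2
      attr_ne := by
        rintro R _ ⟨x, hx, rfl⟩ t a
        exact hvaln t _ (hfn'G a x) (hfn'n a x hx.2)
      pk := by
        rintro R _ ⟨x, hx, rfl⟩ _ ⟨y, hy, rfl⟩ h
        rw [hinj _ hx.1 hy.1 h]
      fk := by
        rintro R _ ⟨x, hx, rfl⟩ R' a
        exact ⟨_, ⟨fn' a x, ⟨hfn'G a x, hfn'n a x hx.2⟩, rfl⟩, rfl⟩
      const_mem := by
        intro R c
        let c' : RCst D (.data (.id R)) := some c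
        have hc : val _ (N.cst (s := RSrt.data (.id R)) c') = D.constVal c := hval _ c'
        by_cases h : N.cst (s := RSrt.data (.id R)) c' = null (.id R)
        · left
          rw [← hc, h]
          exact hval _ _
        · exact .inr ⟨_, ⟨_, ⟨hFG _ (hcst _ c'), h⟩, rfl⟩, hc⟩ }
  refine ⟨{ I := I, F := F, val := val, inj := fun t => (hinj t).mono (hFG t), cst_mem := hcst,
            val_cst := hval, cat := ?_, valid := ?_, life_ne := ?_, flag_ne := ?_ },
    fun t x hx => .inl hx⟩
  · intro R x hx y hy
    constructor
    · rintro ⟨z, ⟨hz, hzn⟩, hzx⟩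
      obtain rfl := hinj _ hz (hFG _ hx) (congrArg Prod.fst hzx)
      refine ⟨hzn, fun t a => ?_⟩
      have h : val t (fn' a z) = val t (y t a) :=
        congrFun (congrFun (congrArg Prod.snd hzx) t) a
      rw [← hinj t (hfn'G a z) (hFG _ (hy t a)) h, hfn'F a z hx]
    · rintro ⟨hxn, hyx⟩
      refine ⟨x, ⟨hFG _ hx, hxn⟩, Prod.ext rfl (funext fun t => funext fun a => ?_)⟩
      change val t (fn' a x) = val t (y t a)
      rw [hfn'F a x hx, hyx t a]
  · intro R x hx
    by_cases h : x = null (.id R)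
    · left
      rw [h]
      exact hval _ _
    · exact .inr ⟨_, ⟨x, ⟨hFG _ hx, h⟩, rfl⟩, rfl⟩
  · intro l l' h
    exact (hN.cst_eq_iff (s := RSrt.life) l l').1 h
  · intro h
    exact Bool.noConfusion ((hN.cst_eq_iff (s := RSrt.flag) true false).1 h)

/-! ## Correctness of the translation -/

variable {M : DAB} {k : ℕ} {sem : InsertSem M.D}

theorem exists_reachable_of_canReach {υ : Property M}
    (h : (toRAS M k sem).CanReach (trProperty k υ)) :
    ∃ (I : CatInst M.D) (s : Snapshot M), Reachable M k sem I s ∧ υ.Holds I s := by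
  obtain ⟨N, idx, α, hN, hne, ⟨α₀, h₀, hr⟩, hα⟩ := h
  obtain ⟨F, hF, hr'⟩ := RAS.exists_finite_support h₀ hr
  clear hr
  obtain ⟨Φ, hΦ⟩ := exists_frame hN (fun t => F (.data t)) fun t => hF _
  have hrel : ∃ s e, Reachable M k sem Φ.I s ∧ Φ.Rel α s e := by
    clear hα
    induction hr' with
    | refl => exact ⟨_, _, .refl, Frame.rel_initial h₀⟩
    | tail _ hs ih =>
      obtain ⟨s, e, hs', hrel⟩ := ih
      obtain ⟨s', e', hstep, hrel'⟩ := hrel.step_of_stepIn hΦ hs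
      exact ⟨s', e', hs'.tail hstep, hrel'⟩
  obtain ⟨s, e, hs, hrel⟩ := hrel
  have : ∀ R : M.D.Repo, Nonempty (idx R) := hne
  exact ⟨Φ.I, s, hs, (hrel.holds_property υ).1 hα⟩

theorem canReach_of_reachable {υ : Property M} {I : CatInst M.D} {s : Snapshot M}
    (hs : Reachable M k sem I s) (hυ : υ.Holds I s) :
    (toRAS M k sem).CanReach (trProperty k υ) := by
  let α₀ : Asg (setting M k) I.str fun _ => ℕ :=
    ⟨fun x => I.str.cst ((toRAS M k sem).ivar x), fun a _ => I.str.cst ((toRAS M k sem).icomp a)⟩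
  have h₀ : (toRAS M k sem).Initial α₀ := ⟨fun _ _ => rfl, fun _ _ _ _ => rfl⟩
  have hrel : ∃ α e, Relation.ReflTransGen (toRAS M k sem).Step α₀ α ∧ I.frame.Rel α s e := by
    clear hυ
    induction hs with
    | refl => exact ⟨α₀, _, .refl, Frame.rel_initial h₀⟩
    | tail _ hstep ih =>
      obtain ⟨α, e, hr, hrel⟩ := ih
      obtain ⟨α', e', hs, hrel'⟩ := hrel.exists_step I.frame_full hstep
      exact ⟨α', e', hr.tail hs, hrel'⟩
  obtain ⟨α, e, hr, hrel⟩ := hrel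
  exact ⟨I.str, _, α, I.str_models, fun _ => inferInstance, ⟨α₀, h₀, hr⟩,
    (hrel.holds_property υ).2 hυ⟩

end

end DABV

/-- `k` is the bound, known a priori, on the number of cases that the DAB `M` introduces. -/
theorem backReach_sound_complete_case_bounded (M : DABV.DAB) (k : ℕ)
    (sem : DABV.InsertSem M.D) (υ : DABV.Property M) (b : Bool)
    (hterm : DABV.BackReach M k sem υ b) :
    b = true ↔ ∃ (I : DABV.CatInst M.D) (s : DABV.Snapshot M),
      DABV.Reachable M k sem I s ∧ υ.Holds I s :=
  (DABV.RAS.BReach.correct hterm).trans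
    ⟨DABV.exists_reachable_of_canReach, fun ⟨_, _, hs, hυ⟩ => DABV.canReach_of_reachable hs hυ⟩
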